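/- For all integers n ≥ 1 and d ≥ 2, a general homogeneous polynomial F of degree d in n+2 complex variables has the following property: for every point P ∈ ℂ^{n+2} with F(P) ≠ 0, the Galois group of the splitting field of the polynomial f_{F,P}(t) over K is isomorphic to the symmetric group S_d. (Equivalently: every point of ℙ^{n+1} lying outside a general degree-d hypersurface X ⊂ ℙ^{n+1} is a uniform point, i.e., the monodromy group of the linear projection of X from that point is the full symmetric group S_d.) -/

import Mathlib

set_option synthInstance.maxHeartbeats 1000000
set_option maxHeartbeats 1000000

/-- The field `K = ℂ(Q₁, …, Q_m)` of rational functions in `m` variables over `ℂ`. -/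
noncomputable abbrev RatFuncField (m : ℕ) : Type :=
  FractionRing (MvPolynomial (Fin m) ℂ)

/-- `f_{F,P}(t) = F(Q₁ + t·P₁, …, Q_m + t·P_m) ∈ K[t]`, obtained by substituting
`x_i ↦ Q_i + t·P_i` in `F`. -/
noncomputable def fFP {m : ℕ} (F : MvPolynomial (Fin m) ℂ) (P : Fin m → ℂ) :
    Polynomial (RatFuncField m) :=
  MvPolynomial.eval₂
    ((Polynomial.C : RatFuncField m →+* Polynomial (RatFuncField m)).comp
      ((algebraMap (MvPolynomial (Fin m) ℂ) (RatFuncField m)).comp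
        (MvPolynomial.C : ℂ →+* MvPolynomial (Fin m) ℂ)))
    (fun i =>
      Polynomial.C (algebraMap (MvPolynomial (Fin m) ℂ) (RatFuncField m) (MvPolynomial.X i)) +
        Polynomial.C (algebraMap (MvPolynomial (Fin m) ℂ) (RatFuncField m)
          (MvPolynomial.C (P i))) * Polynomial.X)
    F

section GenericForms

open MvPolynomial

/-- A property of degree-`d` forms holds generically if it holds off the zero locus of some
polynomial function of the coefficients that is not identically zero on degree-`d` forms. -/
def GenericForm {m : ℕ} (d : ℕ) (p : MvPolynomial (Fin m) ℂ → Prop) : Prop :=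
  ∃ Φ : MvPolynomial (Fin m →₀ ℕ) ℂ,
    (∃ F₀ : MvPolynomial (Fin m) ℂ, F₀.IsHomogeneous d ∧ eval (fun s => coeff s F₀) Φ ≠ 0) ∧
    ∀ F : MvPolynomial (Fin m) ℂ, F.IsHomogeneous d → eval (fun s => coeff s F) Φ ≠ 0 → p F

variable {m d : ℕ}

lemma GenericForm.mono {p q : MvPolynomial (Fin m) ℂ → Prop} (hp : GenericForm d p)
    (h : ∀ F, F.IsHomogeneous d → p F → q F) : GenericForm d q := by
  obtain ⟨Φ, h0, h1⟩ := hp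
  exact ⟨Φ, h0, fun F hF hΦ => h F hF (h1 F hF hΦ)⟩

lemma genericForm_of_forall {p : MvPolynomial (Fin m) ℂ → Prop}
    (h : ∀ F, F.IsHomogeneous d → p F) : GenericForm d p :=
  ⟨1, ⟨0, isHomogeneous_zero _ _ _, by simp⟩, fun F hF _ => h F hF⟩

lemma GenericForm.and {p q : MvPolynomial (Fin m) ℂ → Prop} (hp : GenericForm d p)
    (hq : GenericForm d q) : GenericForm d (fun F => p F ∧ q F) := by
  obtain ⟨Φ, ⟨F₁, hF₁, h1⟩, hp⟩ := hp
  obtain ⟨Ψ, ⟨F₂, hF₂, h2⟩, hq⟩ := hq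
  refine ⟨Φ * Ψ, ?_, fun F hF h => ?_⟩
  · let g : MvPolynomial (Fin m →₀ ℕ) ℂ → Polynomial ℂ := fun Θ =>
      aeval (fun s => Polynomial.C (coeff s F₁) +
        Polynomial.X * Polynomial.C (coeff s (F₂ - F₁))) Θ
    have hg : ∀ (Θ) (t : ℂ), (g Θ).eval t = eval (fun s => coeff s (F₁ + t • (F₂ - F₁))) Θ := by
      intro Θ t
      have : (Polynomial.aeval t).toRingHom.comp (aeval (fun s => Polynomial.C (coeff s F₁) +
        Polynomial.X * Polynomial.C (coeff s (F₂ - F₁))) : _ →ₐ[ℂ] Polynomial ℂ).toRingHom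
         = eval (fun s => coeff s (F₁ + t • (F₂ - F₁))) := by
        apply MvPolynomial.ringHom_ext
        · intro r; simp
        · intro i; simp
      have h2 := congrArg (fun f => f Θ) this
      simpa [g, Polynomial.aeval_def, Polynomial.eval₂_eq_eval_map] using h2
    have hne : g Φ * g Ψ ≠ 0 := by
      apply mul_ne_zero
      · intro h0
        apply h1
        have := hg Φ 0
        rw [h0] at this
        simpa using this.symm
      · intro h0
        apply h2
        have := hg Ψ 1
        rw [h0] at this
        simpa using this.symm
    obtain ⟨t, ht⟩ : ∃ t, (g Φ * g Ψ).eval t ≠ 0 := by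
      by_contra! hall
      exact hne (Polynomial.funext (by simpa using hall))
    refine ⟨F₁ + t • (F₂ - F₁), ?_, ?_⟩
    · refine hF₁.add ?_
      rw [smul_eq_C_mul]
      simpa using (isHomogeneous_C _ t).mul (hF₂.sub hF₁)
    · rw [map_mul, ← hg, ← hg]
      simpa using ht
  · rw [map_mul] at h
    exact ⟨hp F hF (left_ne_zero_of_mul h), hq F hF (right_ne_zero_of_mul h)⟩

lemma GenericForm.forall_finite {ι : Type*} [Finite ι] {p : ι → MvPolynomial (Fin m) ℂ → Prop}
    (h : ∀ i, GenericForm d (p i)) : GenericForm d (fun F => ∀ i, p i F) := by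
  classical
  cases nonempty_fintype ι
  have key : ∀ s : Finset ι, GenericForm d (fun F => ∀ i ∈ s, p i F) := by
    intro s
    induction s using Finset.induction_on with
    | empty => exact genericForm_of_forall (by simp)
    | insert a s ha ih =>
      refine ((h a).and ih).mono ?_
      intro F _ hF i hi
      rcases Finset.mem_insert.1 hi with rfl | hi
      · exact hF.1
      · exact hF.2 i hi
  exact (key Finset.univ).mono (fun F _ hF i => hF i (Finset.mem_univ i))

/-- The index set of degree-`d` monomials in `m` variables. -/
abbrev MonIdx (m d : ℕ) : Type :=
  {s : Fin m →₀ ℕ // s ∈ (Finset.univ : Finset (Fin m)).finsuppAntidiag d}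

lemma isHomogeneous_monIdx (i : MonIdx m d) (c : ℂ) : (monomial i.1 c).IsHomogeneous d := by
  apply isHomogeneous_monomial
  have h := (Finset.mem_finsuppAntidiag.1 i.2).1
  exact (Finsupp.degree_eq_sum _).trans h

lemma eq_sum_monIdx {F : MvPolynomial (Fin m) ℂ} (hF : F.IsHomogeneous d) :
    F = ∑ i : MonIdx m d, coeff i.1 F • monomial i.1 (1 : ℂ) := by
  classical
  ext s
  simp only [coeff_sum, coeff_smul, coeff_monomial, smul_eq_mul, mul_ite, mul_one, mul_zero]
  by_cases hs : s ∈ (Finset.univ : Finset (Fin m)).finsuppAntidiag d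
  · rw [Finset.sum_eq_single (⟨s, hs⟩ : MonIdx m d)]
    · simp
    · rintro ⟨b, hb⟩ _ hne
      rw [if_neg]
      intro h
      exact hne (Subtype.ext h)
    · simp
  · rw [Finset.sum_eq_zero]
    · apply hF.coeff_eq_zero
      intro h
      apply hs
      rw [Finset.mem_finsuppAntidiag]
      refine ⟨?_, Finset.subset_univ _⟩
      rw [← h, Finsupp.degree_eq_sum]
    · rintro ⟨b, hb⟩ _
      rw [if_neg]
      rintro rfl
      exact hs hb

lemma genericForm_of_ne_zero {Φ : MvPolynomial (MonIdx m d) ℂ} (hΦ : Φ ≠ 0) :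
    GenericForm d (fun F : MvPolynomial (Fin m) ℂ =>
      eval (fun i : MonIdx m d => coeff i.1 F) Φ ≠ 0) := by
  classical
  refine ⟨rename Subtype.val Φ, ?_, fun F _ h => ?_⟩
  · obtain ⟨v, hv⟩ : ∃ v, eval v Φ ≠ 0 := by
      by_contra! hall
      exact hΦ (MvPolynomial.funext (by simpa using hall))
    refine ⟨∑ i : MonIdx m d, v i • monomial i.1 (1 : ℂ), ?_, ?_⟩
    · apply IsHomogeneous.sum
      intro i _
      rw [smul_monomial]
      exact isHomogeneous_monIdx i _
    · rw [eval_rename]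
      convert hv using 2
      congr 1
      funext i
      simp only [Function.comp, coeff_sum, coeff_smul, coeff_monomial]
      rw [Finset.sum_eq_single i]
      · simp
      · rintro b _ hne
        rw [if_neg]
        · simp
        · intro h; exact hne (Subtype.ext h)
      · simp
  · rw [eval_rename] at h
    exact h

/-- A polynomially parametrized square linear system, solvable for as many coefficients of `F` as
there are equations, is not solvable for generic `F` if there are fewer parameters than
equations. -/
lemma genericForm_not_solvable_of_det {κ τ : Type} [Fintype κ] [DecidableEq κ] [Fintype τ]
    (hcard : Fintype.card τ < Fintype.card κ)
    (Λ : κ → MvPolynomial (Fin m) ℂ →ₗ[ℂ] MvPolynomial τ ℂ) (e : κ ↪ MonIdx m d) :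
    GenericForm d (fun F => ∀ θ : τ → ℂ,
      (Matrix.of fun r r' => eval θ (Λ r (monomial (e r').1 1))).det ≠ 0 →
      ¬ ∀ r, eval θ (Λ r F) = 0) := by
  classical
  let ρ : Type := {i : MonIdx m d // i ∉ Set.range e}
  let T := MvPolynomial (τ ⊕ ρ) ℂ
  let M : Matrix κ κ T := Matrix.of fun r r' => rename Sum.inl (Λ r (monomial (e r').1 1))
  have hMeval : ∀ (θ : τ → ℂ) (v : ρ → ℂ),
      (eval (Sum.elim θ v)).mapMatrix M =
        Matrix.of fun r r' => eval θ (Λ r (monomial (e r').1 1)) := by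
    intro θ v
    ext r r'
    simp only [M, RingHom.mapMatrix_apply, Matrix.map_apply, Matrix.of_apply, eval_rename]
    rfl
  by_cases hdet : M.det = 0
  · refine genericForm_of_forall fun F _ θ hθ => ?_
    rw [← hMeval θ 0, ← RingHom.map_det, hdet, map_zero] at hθ
    exact absurd rfl hθ
  let S := Localization.Away M.det
  have hle : Submonoid.powers M.det ≤ nonZeroDivisors T :=
    powers_le_nonZeroDivisors_of_noZeroDivisors hdet
  have : IsDomain S := IsLocalization.isDomain_of_le_nonZeroDivisors S hle
  have : FaithfulSMul T S := (faithfulSMul_iff_algebraMap_injective T S).2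
    (IsLocalization.injective S hle)
  have : Algebra.IsAlgebraic T S := IsLocalization.isAlgebraic S (Submonoid.powers M.det)
  let b : κ → T := fun r => ∑ i : ρ, X (Sum.inr i) * rename Sum.inl (Λ r (monomial i.1.1 1))
  let u : S := IsLocalization.Away.invSelf M.det
  have hu : algebraMap T S M.det * u = 1 := IsLocalization.Away.mul_invSelf _
  let g : MonIdx m d → S := fun i =>
    if h : i ∈ Set.range e then - (u * algebraMap T S (M.cramer b h.choose))
    else algebraMap T S (X (Sum.inr ⟨i, h⟩))
  have hg1 : ∀ r, g (e r) = - (u * algebraMap T S (M.cramer b r)) := by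
    intro r
    have h : e r ∈ Set.range e := ⟨r, rfl⟩
    have : h.choose = r := e.injective h.choose_spec
    simp only [g, dif_pos h, this]
  have hg2 : ∀ i : ρ, g i.1 = algebraMap T S (X (Sum.inr i)) := by
    intro i
    simp only [g, dif_neg i.2]
    rfl
  have htr : Algebra.trdeg ℂ S = Fintype.card τ + Fintype.card ρ := by
    rw [← _root_.trdeg_add_eq ℂ T (A := S), trdeg_of_isDomain, trdeg_eq_zero]
    simp
  have hcard2 : Fintype.card κ + Fintype.card ρ = Fintype.card (MonIdx m d) := by
    have h1 : Fintype.card ρ = Fintype.card (MonIdx m d) - Fintype.card (Set.range e) :=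
      Fintype.card_compl_set (Set.range e)
    have h2 : Fintype.card (Set.range e) = Fintype.card κ :=
      Set.card_range_of_injective e.injective
    have := Fintype.card_le_of_embedding e
    omega
  have hdep : ¬ AlgebraicIndependent ℂ g := by
    intro h
    have := h.lift_cardinalMk_le_trdeg
    rw [htr] at this
    rw [Cardinal.mk_fintype, Cardinal.lift_id, Cardinal.lift_id, ← hcard2] at this
    generalize Fintype.card ρ = q at this
    have h2 : Fintype.card κ + q ≤ Fintype.card τ + q := by exact_mod_cast this
    omega
  rw [algebraicIndependent_iff] at hdep
  push Not at hdep
  obtain ⟨Φ, hΦ, hΦ0⟩ := hdep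
  refine (genericForm_of_ne_zero hΦ0).mono ?_
  intro F hF hne θ hθ hall
  apply hne
  let φ : T →+* ℂ := eval (Sum.elim θ (fun i : ρ => coeff i.1.1 F))
  have hφM : φ.mapMatrix M = _ := hMeval θ _
  have hφdet : IsUnit (φ M.det) := by
    rw [isUnit_iff_ne_zero, RingHom.map_det, hφM]
    exact hθ
  let χ : S →+* ℂ := IsLocalization.Away.lift M.det hφdet
  have hχ : ∀ t, χ (algebraMap T S t) = φ t := fun t => IsLocalization.Away.lift_eq _ hφdet t
  have hχg : ∀ i, χ (g i) = coeff i.1 F := by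
    intro i
    by_cases hi : i ∈ Set.range e
    · obtain ⟨r, rfl⟩ := hi
      have hsys : (φ.mapMatrix M).mulVec (fun r => coeff (e r).1 F) = fun r => - φ (b r) := by
        funext r
        have h1 := hall r
        rw [eq_sum_monIdx hF, map_sum, map_sum] at h1
        simp only [map_smul, smul_eval] at h1
        rw [← Fintype.sum_subtype_add_sum_subtype (fun i => i ∈ Set.range e)] at h1
        have h3 : ∑ x : {i // i ∈ Set.range e}, coeff x.1.1 F * eval θ (Λ r (monomial x.1.1 1))
            = ∑ x, coeff (e x).1 F * eval θ (Λ r (monomial (e x).1 1)) := by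
          symm
          exact Fintype.sum_equiv (Equiv.ofInjective e e.injective) _ _ (fun x => rfl)
        have h1' : (∑ x, coeff (e x).1 F * eval θ (Λ r (monomial (e x).1 1))) +
            ∑ x : ρ, coeff x.1.1 F * eval θ (Λ r (monomial x.1.1 1)) = 0 := by
          rw [← h3]
          convert h1
        have hA : (φ.mapMatrix M).mulVec (fun r => coeff (e r).1 F) r =
            ∑ x, coeff (e x).1 F * eval θ (Λ r (monomial (e x).1 1)) := by
          rw [hφM]
          simp only [Matrix.mulVec, dotProduct, Matrix.of_apply]
          exact Finset.sum_congr rfl fun _ _ => mul_comm _ _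
        have hB : φ (b r) = ∑ x : ρ, coeff x.1.1 F * eval θ (Λ r (monomial x.1.1 1)) := by
          simp only [b, map_sum, map_mul]
          refine Finset.sum_congr rfl fun x _ => ?_
          congr 1
          · exact eval_X _
          · exact eval_rename _ _ _
        rw [hA, hB]
        exact eq_neg_of_add_eq_zero_left h1'
      have hcr := Matrix.mulVec_mulVec (fun r => coeff (e r).1 F)
        (φ.mapMatrix M).adjugate (φ.mapMatrix M)
      rw [Matrix.adjugate_mul, hsys] at hcr
      have hcr2 := congrFun hcr r
      have h4 : φ (M.cramer b r) = ((φ.mapMatrix M).adjugate.mulVec (fun r => φ (b r))) r := by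
        rw [Matrix.cramer_eq_adjugate_mulVec, ← RingHom.map_adjugate]
        simp only [Matrix.mulVec, dotProduct, map_sum, map_mul, RingHom.mapMatrix_apply,
          Matrix.map_apply]
      have h5 : ((φ.mapMatrix M).adjugate.mulVec (fun r => -φ (b r))) r = - φ (M.cramer b r) := by
        rw [h4]
        have : (fun r => -φ (b r)) = -(fun r => φ (b r)) := rfl
        rw [this, Matrix.mulVec_neg]; rfl
      rw [h5] at hcr2
      rw [Matrix.smul_mulVec, Matrix.one_mulVec] at hcr2
      simp only [Pi.smul_apply, smul_eq_mul, ← RingHom.map_det] at hcr2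
      have h6 : φ M.det * χ u = 1 := by rw [← hχ, ← map_mul, hu, map_one]
      rw [hg1, map_neg, map_mul, hχ]
      linear_combination χ u * hcr2 + coeff (e r).1 F * h6
    · have := hg2 ⟨i, hi⟩
      simp only at this
      rw [this, hχ]
      exact eval_X _
  have h7 : χ (aeval g Φ) = eval (fun i : MonIdx m d => coeff i.1 F) Φ := by
    have : χ.comp (aeval g).toRingHom = eval (fun i : MonIdx m d => coeff i.1 F) := by
      apply MvPolynomial.ringHom_ext
      · intro r
        simp only [AlgHom.toRingHom_eq_coe, RingHom.coe_comp, RingHom.coe_coe,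
          Function.comp_apply, algHom_C, eval_C]
        rw [IsScalarTower.algebraMap_apply ℂ T S, hχ]
        simp [φ, T, MvPolynomial.algebraMap_eq]
      · intro i
        simp [hχg]
    exact congrArg (fun f => f Φ) this
  rw [← h7, hΦ, map_zero]

/-- Dimension count: a family of linear conditions on `F`, polynomially parametrized by fewer
parameters than conditions, fails for generic `F` at every parameter where the conditions are
independent on forms of degree `d`. -/
theorem genericForm_not_solvable {κ τ : Type} [Fintype κ] [DecidableEq κ] [Fintype τ]
    (hcard : Fintype.card τ < Fintype.card κ)
    (Λ : κ → MvPolynomial (Fin m) ℂ →ₗ[ℂ] MvPolynomial τ ℂ) :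
    GenericForm d (fun F => ∀ θ : τ → ℂ,
      (∀ r, ∃ G : MvPolynomial (Fin m) ℂ, G.IsHomogeneous d ∧
        eval θ (Λ r G) ≠ 0 ∧ ∀ r', r' ≠ r → eval θ (Λ r' G) = 0) →
      ¬ ∀ r, eval θ (Λ r F) = 0) := by
  classical
  refine (GenericForm.forall_finite
    (fun e : κ ↪ MonIdx m d => genericForm_not_solvable_of_det hcard Λ e)).mono ?_
  intro F _ hall θ hdual
  let col : MonIdx m d → κ → ℂ := fun i r => eval θ (Λ r (monomial i.1 1))
  have hcol : ∀ G : MvPolynomial (Fin m) ℂ, G.IsHomogeneous d →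
      (fun r => eval θ (Λ r G)) ∈ Submodule.span ℂ (Set.range col) := by
    intro G hG
    have : (fun r => eval θ (Λ r G)) = ∑ i : MonIdx m d, coeff i.1 G • col i := by
      funext r
      conv_lhs => rw [eq_sum_monIdx hG]
      simp [col, smul_eval]
    rw [this]
    exact Submodule.sum_mem _ fun i _ =>
      Submodule.smul_mem _ _ (Submodule.subset_span ⟨i, rfl⟩)
  have hspan : ⊤ ≤ Submodule.span ℂ (Set.range col) := by
    rw [← (Pi.basisFun ℂ κ).span_eq, Submodule.span_le]
    rintro _ ⟨r, rfl⟩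
    obtain ⟨G, hG, h1, h2⟩ := hdual r
    have : Pi.basisFun ℂ κ r = (eval θ (Λ r G))⁻¹ • fun r => eval θ (Λ r G) := by
      funext r'
      by_cases h : r' = r
      · subst h
        simp [h1]
      · simp [h2 r' h, h]
    rw [this]
    exact Submodule.smul_mem _ _ (hcol G hG)
  obtain ⟨ι', a, ha, hsp, hli⟩ := exists_linearIndependent' ℂ col
  let B : Module.Basis ι' ℂ (κ → ℂ) := Module.Basis.mk hli (by rw [hsp]; exact hspan)
  let eq : κ ≃ ι' := (Pi.basisFun ℂ κ).indexEquiv B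
  refine hall ⟨fun r => a (eq r), ha.comp eq.injective⟩ θ ?_
  have hli2 : LinearIndependent ℂ (fun r => col (a (eq r))) := hli.comp eq eq.injective
  have hu : IsUnit (Matrix.of fun r => col (a (eq r))) :=
    Matrix.linearIndependent_rows_iff_isUnit.1 hli2
  have hd := (Matrix.isUnit_iff_isUnit_det _).1 hu
  rw [isUnit_iff_ne_zero, ← Matrix.det_transpose] at hd
  exact hd

end GenericForms

section Lines

open MvPolynomial

variable {m : ℕ} {R : Type*} [CommRing R] [Algebra ℂ R]

/-- The restriction `F(x + tP)` of `F` to the line through `x` in direction `P`, as a polynomial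
in `t`. -/
noncomputable def line (x P : Fin m → R) : MvPolynomial (Fin m) ℂ →ₐ[ℂ] Polynomial R :=
  aeval fun i => Polynomial.C (x i) + Polynomial.C (P i) * Polynomial.X

lemma line_X (x P : Fin m → R) (i : Fin m) :
    line x P (X i) = Polynomial.C (x i) + Polynomial.C (P i) * Polynomial.X := aeval_X _ _

lemma line_map {S : Type*} [CommRing S] [Algebra ℂ S] (φ : R →ₐ[ℂ] S) (x P : Fin m → R)
    (F : MvPolynomial (Fin m) ℂ) :
    (line x P F).map φ.toRingHom = line (fun i => φ (x i)) (fun i => φ (P i)) F := by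
  have : (Polynomial.mapAlgHom φ).comp (line x P) = line (fun i => φ (x i)) (fun i => φ (P i)) := by
    apply MvPolynomial.algHom_ext
    intro i
    simp [line_X]
  exact congrArg (fun f => f F) this

lemma line_comp (x P : Fin m → R) (s : R) (F : MvPolynomial (Fin m) ℂ) :
    (line x P F).comp (Polynomial.X + Polynomial.C s) = line (fun i => x i + s * P i) P F := by
  have : ((Polynomial.aeval (Polynomial.X + Polynomial.C s)).restrictScalars ℂ).comp (line x P)
      = line (fun i => x i + s * P i) P := by
    apply MvPolynomial.algHom_ext
    intro i
    simp [line_X]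
    ring
  have h := congrArg (fun f => f F) this
  simpa [Polynomial.comp, Polynomial.aeval_def] using h

lemma line_eval (x P : Fin m → R) (s : R) (F : MvPolynomial (Fin m) ℂ) :
    (line x P F).eval s = aeval (fun i => x i + s * P i) F := by
  have : ((Polynomial.aeval s).restrictScalars ℂ).comp (line x P)
      = aeval (fun i => x i + s * P i) := by
    apply MvPolynomial.algHom_ext
    intro i
    simp [line_X]
    ring
  have h := congrArg (fun f => f F) this
  simpa [Polynomial.aeval_def] using h

lemma reflect_line_monomial (x P : Fin m → R) (s : Fin m →₀ ℕ) (c : ℂ) :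
    (line x P (monomial s c)).natDegree ≤ s.degree ∧
    Polynomial.reflect s.degree (line x P (monomial s c)) = line P x (monomial s c) := by
  induction s using Finsupp.induction_linear generalizing c with
  | zero =>
    have : ∀ x P : Fin m → R, line x P (monomial 0 c) = Polynomial.C (algebraMap ℂ R c) := by
      intro x P
      rw [← C_apply, ← MvPolynomial.algebraMap_eq, AlgHom.commutes]
      rfl
    rw [this, this]
    simp
  | add s t hs ht =>
    have : (monomial (s + t) c : MvPolynomial (Fin m) ℂ) = monomial s c * monomial t 1 := by
      rw [monomial_mul, mul_one]
    rw [this, map_mul, map_mul, map_add]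
    refine ⟨Polynomial.natDegree_mul_le_of_le (hs c).1 (ht 1).1, ?_⟩
    rw [Polynomial.reflect_mul _ _ (hs c).1 (ht 1).1, (hs c).2, (ht 1).2]
  | single i k =>
    have : ∀ x P : Fin m → R, line x P (monomial (Finsupp.single i k) c) =
        Polynomial.C (algebraMap ℂ R c) *
          (Polynomial.C (x i) + Polynomial.C (P i) * Polynomial.X) ^ k := by
      intro x P
      rw [monomial_eq, map_mul, ← MvPolynomial.algebraMap_eq, AlgHom.commutes]
      simp [line_X]
    rw [this, this, Finsupp.degree_single]
    have hdeg1 : (Polynomial.C (x i) + Polynomial.C (P i) * Polynomial.X).natDegree ≤ 1 := by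
      rw [add_comm]; exact Polynomial.natDegree_linear_le
    have hr1 : Polynomial.reflect 1 (Polynomial.C (x i) + Polynomial.C (P i) * Polynomial.X) =
        (Polynomial.C (P i) + Polynomial.C (x i) * Polynomial.X) := by
      rw [Polynomial.reflect_add, Polynomial.reflect_C]
      have := Polynomial.reflect_C_mul_X_pow 1 1 (c := P i)
      rw [pow_one] at this
      rw [this, Polynomial.revAt_le le_rfl]
      simp
      ring
    clear this
    have key : ((Polynomial.C (x i) + Polynomial.C (P i) * Polynomial.X) ^ k).natDegree ≤ k ∧
        Polynomial.reflect k ((Polynomial.C (x i) + Polynomial.C (P i) * Polynomial.X) ^ k) =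
        (Polynomial.C (P i) + Polynomial.C (x i) * Polynomial.X) ^ k := by
      induction k with
      | zero => simp
      | succ k ih =>
        rw [pow_succ, pow_succ]
        refine ⟨Polynomial.natDegree_mul_le_of_le ih.1 hdeg1, ?_⟩
        rw [Polynomial.reflect_mul _ _ ih.1 hdeg1, ih.2, hr1]
    refine ⟨(Polynomial.natDegree_C_mul_le _ _).trans key.1, ?_⟩
    rw [Polynomial.reflect_C_mul, key.2]

lemma line_isHomogeneous {d : ℕ} {F : MvPolynomial (Fin m) ℂ} (hF : F.IsHomogeneous d)
    (x P : Fin m → R) :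
    (line x P F).natDegree ≤ d ∧ Polynomial.reflect d (line x P F) = line P x F := by
  have hd : ∀ s ∈ F.support, s.degree = d := fun s hs => by
    have := hF (mem_support_iff.1 hs)
    rw [← this, Finsupp.degree_eq_weight_one]
    rfl
  rw [F.as_sum, map_sum, map_sum]
  refine ⟨Polynomial.natDegree_sum_le_of_forall_le _ _ fun s hs => ?_, ?_⟩
  · rw [← hd s hs]
    exact (reflect_line_monomial x P s _).1
  · have : ∀ (T : Finset (Fin m →₀ ℕ)) (f : (Fin m →₀ ℕ) → Polynomial R),
        Polynomial.reflect d (∑ s ∈ T, f s) = ∑ s ∈ T, Polynomial.reflect d (f s) := by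
      intro T f
      classical
      induction T using Finset.induction_on with
      | empty => simp
      | insert a T ha ih => rw [Finset.sum_insert ha, Polynomial.reflect_add, ih,
          Finset.sum_insert ha]
    rw [this]
    refine Finset.sum_congr rfl fun s hs => ?_
    rw [← hd s hs]
    exact (reflect_line_monomial x P s _).2

lemma line_natDegree_le {d : ℕ} {F : MvPolynomial (Fin m) ℂ} (hF : F.IsHomogeneous d)
    (x P : Fin m → R) : (line x P F).natDegree ≤ d := (line_isHomogeneous hF x P).1

lemma line_coeff_sub {d : ℕ} {F : MvPolynomial (Fin m) ℂ} (hF : F.IsHomogeneous d)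
    (x P : Fin m → R) {j : ℕ} (hj : j ≤ d) : (line x P F).coeff (d - j) = (line P x F).coeff j := by
  rw [← (line_isHomogeneous hF x P).2, Polynomial.coeff_reflect, Polynomial.revAt_le hj]

lemma line_coeff_zero (x P : Fin m → R) (F : MvPolynomial (Fin m) ℂ) :
    (line x P F).coeff 0 = aeval x F := by
  rw [Polynomial.coeff_zero_eq_eval_zero, line_eval]
  simp

lemma line_coeff_top {d : ℕ} {F : MvPolynomial (Fin m) ℂ} (hF : F.IsHomogeneous d)
    (x P : Fin m → R) : (line x P F).coeff d = aeval P F := by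
  have := line_coeff_sub hF x P (Nat.zero_le d)
  rwa [Nat.sub_zero, line_coeff_zero] at this

lemma line_derivative (x P : Fin m → R) (F : MvPolynomial (Fin m) ℂ) :
    Polynomial.derivative (line x P F) = ∑ i, Polynomial.C (P i) * line x P (pderiv i F) := by
  induction F using MvPolynomial.induction_on with
  | C a =>
    rw [← MvPolynomial.algebraMap_eq, AlgHom.commutes]
    have : algebraMap ℂ (Polynomial R) a = Polynomial.C (algebraMap ℂ R a) := rfl
    rw [this]
    simp [MvPolynomial.algebraMap_eq]
  | add p q hp hq =>
    simp only [map_add, hp, hq, mul_add, Finset.sum_add_distrib]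
  | mul_X p j hp =>
    have h1 : ∑ i, Polynomial.C (P i) * line x P (pderiv i (X j)) = Polynomial.C (P j) := by
      rw [Finset.sum_eq_single j]
      · simp
      · intro b _ hb
        rw [pderiv_X_of_ne (Ne.symm hb)]
        simp
      · simp
    have h2 : Polynomial.derivative (line x P (X j)) = Polynomial.C (P j) := by
      simp [line_X]
    rw [map_mul, Polynomial.derivative_mul, hp, h2]
    simp only [pderiv_mul, map_add, map_mul, mul_add, Finset.sum_add_distrib]
    rw [← h1, Finset.sum_mul, Finset.mul_sum]
    refine congrArg₂ _ ?_ ?_ <;> exact Finset.sum_congr rfl fun i _ => by ring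

lemma line_coeff_one (x P : Fin m → R) (F : MvPolynomial (Fin m) ℂ) :
    (line x P F).coeff 1 = ∑ i, P i * aeval x (pderiv i F) := by
  have h := congrArg (fun f => Polynomial.coeff f 0) (line_derivative x P F)
  simpa [Polynomial.coeff_derivative, Polynomial.finsetSum_coeff, line_coeff_zero] using h

end Lines

section Counting

open MvPolynomial

variable {m : ℕ}

/-- The linear form attached to a linear functional. -/
noncomputable def linForm (φ : Module.Dual ℂ (Fin m → ℂ)) : MvPolynomial (Fin m) ℂ :=
  ∑ i, C (φ (Pi.single i 1)) * X i

lemma linForm_isHomogeneous (φ : Module.Dual ℂ (Fin m → ℂ)) : (linForm φ).IsHomogeneous 1 := by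
  refine IsHomogeneous.sum _ _ _ fun i _ => ?_
  simpa using (isHomogeneous_C (Fin m) (φ (Pi.single i 1))).mul (isHomogeneous_X ℂ i)

lemma sum_dual_apply (φ : Module.Dual ℂ (Fin m → ℂ)) (x : Fin m → ℂ) :
    ∑ i, φ (Pi.single i 1) * x i = φ x := by
  conv_rhs => rw [pi_eq_sum_univ' x]
  simp [mul_comm]

lemma eval_linForm (φ : Module.Dual ℂ (Fin m → ℂ)) (x : Fin m → ℂ) :
    eval x (linForm φ) = φ x := by
  simp [linForm, sum_dual_apply]

lemma line_linForm (φ : Module.Dual ℂ (Fin m → ℂ)) (x P : Fin m → ℂ) :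
    line x P (linForm φ) = Polynomial.C (φ x) + Polynomial.C (φ P) * Polynomial.X := by
  rw [linForm, map_sum, ← sum_dual_apply φ x, ← sum_dual_apply φ P, map_sum, map_sum,
    Finset.sum_mul, ← Finset.sum_add_distrib]
  refine Finset.sum_congr rfl fun i _ => ?_
  rw [map_mul, line_X, ← MvPolynomial.algebraMap_eq, AlgHom.commutes]
  have : algebraMap ℂ (Polynomial ℂ) (φ (Pi.single i 1)) = Polynomial.C (φ (Pi.single i 1)) := rfl
  rw [this, map_mul, map_mul]
  ring

variable {k : ℕ} (b : Module.Basis (Option (Fin k)) ℂ (Fin m → ℂ))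

/-- The point `E + ∑ pⱼ eⱼ` in the affine chart given by the basis `E, e₀, e₁, …`. -/
noncomputable def chartPt (p : Fin k → ℂ) : Fin m → ℂ := b none + ∑ j, p j • b (some j)

/-- The point `eⱼ` recentred along the direction `P = chartPt b p`. -/
noncomputable def centredPt (p l : Fin k → ℂ) (j : Fin k) : Fin m → ℂ :=
  b (some j) - l j • chartPt b p

/-- A finite family of vectors is separated if each of them is singled out by a product of two
linear forms. -/
def SeparatedFamily {I : Type*} (w : I → Fin k → ℂ) : Prop :=
  ∀ i, ∃ a c : Fin k → ℂ, a ⬝ᵥ w i ≠ 0 ∧ c ⬝ᵥ w i ≠ 0 ∧ ∀ i', i' ≠ i → a ⬝ᵥ w i' = 0 ∨ c ⬝ᵥ w i' = 0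

lemma coeff_C_mul_X_pow_eq (a : ℂ) {i j : ℕ} :
    (Polynomial.C a * Polynomial.X ^ i).coeff j = if i = j then a else 0 := by
  rw [Polynomial.coeff_C_mul_X_pow]
  simp [eq_comm]

/-- Dual forms showing that the conditions in the counting lemma are independent. -/
lemma exists_dual_forms {d : ℕ} (hd : 2 ≤ d) {I : Type} [DecidableEq I] (p l : Fin k → ℂ)
    (w : I → Fin k → ℂ) (hw : SeparatedFamily w) :
    (∀ j, ∃ G : MvPolynomial (Fin m) ℂ, G.IsHomogeneous d ∧ eval (chartPt b p) G = 0 ∧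
      (∀ j', (line (centredPt b p l j') (chartPt b p) G).coeff (d - 1) = if j' = j then 1 else 0) ∧
      (∀ i, ∀ s : Fin (d - 1), (line (∑ j', w i j' • centredPt b p l j') (chartPt b p) G).coeff
        (d - 2 - s) = 0)) ∧
    (∀ i, ∀ s : Fin (d - 1), ∃ G : MvPolynomial (Fin m) ℂ, G.IsHomogeneous d ∧
      eval (chartPt b p) G = 0 ∧
      (∀ j', (line (centredPt b p l j') (chartPt b p) G).coeff (d - 1) = 0) ∧
      ∃ a : ℂ, a ≠ 0 ∧ ∀ i', ∀ s' : Fin (d - 1),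
      (line (∑ j', w i' j' • centredPt b p l j') (chartPt b p) G).coeff
        (d - 2 - s') = if i' = i ∧ s' = s then a else 0) := by
  let P := chartPt b p
  let L : Fin k → Module.Dual ℂ (Fin m → ℂ) := fun j => b.coord (some j) - p j • b.coord none
  have hLP : ∀ j, L j P = 0 := by
    intro j
    simp [L, P, chartPt, Finsupp.single_apply]
  have hLe : ∀ j j', L j (b (some j')) = if j' = j then 1 else 0 := by
    intro j j'
    simp [L, Finsupp.single_apply]
  let lam : Module.Dual ℂ (Fin m → ℂ) := b.coord none + ∑ j, l j • L j
  have hlP : lam P = 1 := by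
    simp [lam, hLP]
    simp [P, chartPt]
  have hle : ∀ j, lam (b (some j)) = l j := by
    intro j
    simp [lam, hLe]
  have hLc : ∀ j j', L j (centredPt b p l j') = if j' = j then 1 else 0 := by
    intro j j'
    have : L j (chartPt b p) = 0 := hLP j
    simp [centredPt, this, hLe]
  have hlc : ∀ j, lam (centredPt b p l j) = 0 := by
    intro j
    have : lam (chartPt b p) = 1 := hlP
    simp [centredPt, this, hle]
  have lineL : ∀ j x, line x P (linForm (L j)) = Polynomial.C (L j x) := by
    intro j x
    rw [line_linForm, hLP]; simp
  have linel : ∀ x, lam x = 0 → line x P (linForm lam) = Polynomial.X := by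
    intro x hx
    rw [line_linForm, hlP, hx]; simp
  constructor
  · intro j
    refine ⟨linForm (L j) * linForm lam ^ (d - 1), ?_, ?_, ?_, ?_⟩
    · have := (linForm_isHomogeneous (L j)).mul ((linForm_isHomogeneous lam).pow (d - 1))
      convert this using 1; omega
    · rw [map_mul, eval_linForm]
      have : L j (chartPt b p) = 0 := hLP j
      rw [this, zero_mul]
    · intro j'
      rw [map_mul, map_pow, lineL, linel _ (hlc j'), coeff_C_mul_X_pow_eq, if_pos rfl, hLc]
    · intro i s
      have : lam (∑ j', w i j' • centredPt b p l j') = 0 := by simp [hlc]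
      rw [map_mul, map_pow, lineL, linel _ this, coeff_C_mul_X_pow_eq, if_neg]
      omega
  · intro i s
    obtain ⟨a, c, ha, hc, hac⟩ := hw i
    let A : Module.Dual ℂ (Fin m → ℂ) := ∑ j, a j • L j
    let B : Module.Dual ℂ (Fin m → ℂ) := ∑ j, c j • L j
    have hAP : A P = 0 := by simp [A, hLP]
    have hBP : B P = 0 := by simp [B, hLP]
    have hAw : ∀ i', A (∑ j', w i' j' • centredPt b p l j') = a ⬝ᵥ w i' := by
      intro i'
      simp [A, hLc, dotProduct, mul_comm]
    have hBw : ∀ i', B (∑ j', w i' j' • centredPt b p l j') = c ⬝ᵥ w i' := by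
      intro i'
      simp [B, hLc, dotProduct, mul_comm]
    have hA : ∀ x, line x P (linForm A) = Polynomial.C (A x) := by
      intro x
      rw [line_linForm, hAP]; simp
    have hB : ∀ x, line x P (linForm B) = Polynomial.C (B x) := by
      intro x
      rw [line_linForm, hBP]; simp
    have hs := s.2
    refine ⟨linForm A ^ (s.1 + 1) * linForm B * linForm lam ^ (d - 2 - s), ?_, ?_, ?_,
      (a ⬝ᵥ w i) ^ (s.1 + 1) * (c ⬝ᵥ w i), mul_ne_zero (pow_ne_zero _ ha) hc, ?_⟩
    · have := (((linForm_isHomogeneous A).pow (s.1 + 1)).mul (linForm_isHomogeneous B)).mul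
        ((linForm_isHomogeneous lam).pow (d - 2 - s))
      convert this using 1; omega
    · rw [map_mul, map_mul, eval_linForm B]
      have : B (chartPt b p) = 0 := hBP
      rw [this, mul_zero, zero_mul]
    · intro j'
      rw [map_mul, map_mul, map_pow, map_pow, hA, hB, linel _ (hlc j'), ← map_pow, ← map_mul,
        coeff_C_mul_X_pow_eq, if_neg]
      omega
    · intro i' s'
      have hs' := s'.2
      have : lam (∑ j', w i' j' • centredPt b p l j') = 0 := by simp [hlc]
      rw [map_mul, map_mul, map_pow, map_pow, hA, hB, linel _ this, ← map_pow, ← map_mul,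
        coeff_C_mul_X_pow_eq, hAw, hBw]
      by_cases hi : i' = i
      · subst hi
        simp only [true_and]
        refine if_congr ?_ rfl rfl
        rw [Fin.ext_iff]
        omega
      · rw [if_neg (fun h : i' = i ∧ s' = s => hi h.1)]
        rcases hac i' hi with h | h <;> simp [h]

/-- Counting lemma: for generic `F` of degree `d` there are no point `P` and parameters `y` such
that the restrictions of `F` to lines through `P` and a separated family of points vary in a
family with too few parameters. -/
theorem genericForm_counting {d : ℕ} (hd : 2 ≤ d) {I Y : Type} [Fintype I] [Fintype Y]
    (ω : I → Fin k → MvPolynomial Y ℂ) (γ : I → Fin (d - 1) → MvPolynomial Y ℂ)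
    (hcount : Fintype.card Y + k < Fintype.card I * (d - 1)) :
    GenericForm d (fun F : MvPolynomial (Fin m) ℂ => ∀ (p l : Fin k → ℂ) (y : Y → ℂ),
      SeparatedFamily (fun i j => eval y (ω i j)) →
      (∀ j, (line (centredPt b p l j) (chartPt b p) F).coeff (d - 1) = 0) →
      ¬ ∀ i, ∀ s : Fin (d - 1),
        (line (∑ j, eval y (ω i j) • centredPt b p l j) (chartPt b p) F).coeff (d - 2 - s) =
          eval y (γ i s) * eval (chartPt b p) F) := by
  classical
  let τ := (Fin k ⊕ Fin k) ⊕ Y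
  let Pm : Fin m → MvPolynomial τ ℂ := fun i =>
    C (b none i) + ∑ j, X (Sum.inl (Sum.inl j)) * C (b (some j) i)
  let xm : Fin k → Fin m → MvPolynomial τ ℂ := fun j i =>
    C (b (some j) i) - X (Sum.inl (Sum.inr j)) * Pm i
  let wm : I → Fin m → MvPolynomial τ ℂ := fun i c =>
    ∑ j, rename Sum.inr (ω i j) * xm j c
  let Λ : Fin k ⊕ (I × Fin (d - 1)) → MvPolynomial (Fin m) ℂ →ₗ[ℂ] MvPolynomial τ ℂ :=
    Sum.elim
      (fun j => ((Polynomial.lcoeff (MvPolynomial τ ℂ) (d - 1)).restrictScalars ℂ).comp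
        (line (xm j) Pm).toLinearMap)
      (fun is => ((Polynomial.lcoeff (MvPolynomial τ ℂ) (d - 2 - is.2)).restrictScalars ℂ).comp
        (line (wm is.1) Pm).toLinearMap -
        (LinearMap.mulLeft ℂ (rename Sum.inr (γ is.1 is.2))).comp (aeval Pm).toLinearMap)
  have hcard : Fintype.card τ < Fintype.card (Fin k ⊕ (I × Fin (d - 1))) := by
    simp only [τ, Fintype.card_sum, Fintype.card_prod, Fintype.card_fin]
    omega
  refine (genericForm_not_solvable hcard Λ).mono ?_
  intro F hF hgen p l y hsep h1 h2
  let θ : τ → ℂ := Sum.elim (Sum.elim p l) y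
  have hP : (fun i => aeval θ (Pm i)) = chartPt b p := by
    funext i
    simp [Pm, chartPt, θ]
  have hx : ∀ j, (fun i => aeval θ (xm j i)) = centredPt b p l j := by
    intro j
    funext i
    have := congrFun hP i
    simp only [xm, centredPt, map_sub, map_mul, this, aeval_X]
    simp [θ]
  have hω : ∀ q : MvPolynomial Y ℂ, aeval θ (rename Sum.inr q : MvPolynomial τ ℂ) = eval y q := by
    intro q
    rw [aeval_rename]
    rfl
  have hwm : ∀ i, (fun c => aeval θ (wm i c)) = ∑ j, eval y (ω i j) • centredPt b p l j := by
    intro i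
    funext c
    simp only [wm, map_sum, map_mul, hω, Finset.sum_apply, Pi.smul_apply, smul_eq_mul, ← hx]
  have hline : ∀ (x : Fin m → MvPolynomial τ ℂ) (G) (a : ℕ), eval θ ((line x Pm G).coeff a) =
      (line (fun c => aeval θ (x c)) (chartPt b p) G).coeff a := by
    intro x G a
    rw [← hP, ← line_map, Polynomial.coeff_map]
    rfl
  have hΛ1 : ∀ j G, eval θ (Λ (Sum.inl j) G) =
      (line (centredPt b p l j) (chartPt b p) G).coeff (d - 1) := by
    intro j G
    rw [← hx, ← hline]
    rfl
  have hΛ2 : ∀ i s G, eval θ (Λ (Sum.inr (i, s)) G) =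
      (line (∑ j, eval y (ω i j) • centredPt b p l j) (chartPt b p) G).coeff (d - 2 - s) -
       eval y (γ i s) * eval (chartPt b p) G := by
    intro i s G
    have h3 : Λ (Sum.inr (i, s)) G = (line (wm i) Pm G).coeff (d - 2 - s) -
      rename Sum.inr (γ i s) * aeval Pm G := rfl
    have h4 : eval θ (aeval Pm G) = eval (chartPt b p) G := by
      rw [← hP]
      have : (aeval θ).comp (aeval Pm) = aeval (fun i => aeval θ (Pm i)) := by
        apply MvPolynomial.algHom_ext
        intro i; simp
      exact congrArg (fun f => f G) this
    have h5 := hω (γ i s)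
    rw [h3, map_sub, map_mul, hline, hwm, h4]
    congr 2
  refine hgen θ ?_ ?_
  · obtain ⟨d1, d2⟩ := exists_dual_forms b hd p l _ hsep
    rintro (j | ⟨i, s⟩)
    · obtain ⟨G, hG, e1, e2, e3⟩ := d1 j
      refine ⟨G, hG, ?_, ?_⟩
      · rw [hΛ1, e2, if_pos rfl]; exact one_ne_zero
      · rintro (j' | ⟨i', s'⟩) hne
        · rw [hΛ1, e2, if_neg]
          intro h; exact hne (by rw [h])
        · rw [hΛ2, e3, e1]; simp
    · obtain ⟨G, hG, e1, e2, a, ha, e3⟩ := d2 i s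
      refine ⟨G, hG, ?_, ?_⟩
      · rw [hΛ2, e3, e1]; simpa using ha
      · rintro (j' | ⟨i', s'⟩) hne
        · rw [hΛ1, e2]
        · rw [hΛ2, e3, e1, if_neg]
          · simp
          · rintro ⟨rfl, rfl⟩
            exact hne rfl
  · rintro (j | ⟨i, s⟩)
    · rw [hΛ1, h1]
    · rw [hΛ2, h2]; simp

end Counting

section CountingFamilies

open MvPolynomial

variable {m k : ℕ} (b : Module.Basis (Option (Fin k)) ℂ (Fin m → ℂ))

lemma line_coeff_pred {d : ℕ} (hd : 1 ≤ d) {F : MvPolynomial (Fin m) ℂ} (hF : F.IsHomogeneous d)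
    (x P : Fin m → ℂ) : (line x P F).coeff (d - 1) = ∑ i, x i * eval P (pderiv i F) := by
  rw [line_coeff_sub hF x P hd, line_coeff_one]
  rfl

/-- The weighted sum that is the subleading coefficient of `F(x + tP)`, linear in `x`. -/
noncomputable def polarForm (F : MvPolynomial (Fin m) ℂ) (P : Fin m → ℂ) :
    Module.Dual ℂ (Fin m → ℂ) :=
  ∑ i, eval P (pderiv i F) • LinearMap.proj i

lemma polarForm_apply (F : MvPolynomial (Fin m) ℂ) (P x : Fin m → ℂ) :
    polarForm F P x = ∑ i, x i * eval P (pderiv i F) := by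
  simp [polarForm, mul_comm]

lemma polarForm_self {d : ℕ} {F : MvPolynomial (Fin m) ℂ} (hF : F.IsHomogeneous d)
    (P : Fin m → ℂ) : polarForm F P P = d * eval P F := by
  rw [polarForm_apply]
  have := congrArg (eval P) hF.sum_X_mul_pderiv
  simpa using this

lemma line_sub_smul (x P : Fin m → ℂ) (s : ℂ) (F : MvPolynomial (Fin m) ℂ) :
    line (x - s • P) P F = (line x P F).comp (Polynomial.X - Polynomial.C s) := by
  have := line_comp x P (-s) F
  rw [map_neg, ← sub_eq_add_neg] at this
  rw [this]
  congr 1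
  congr 1
  funext i
  simp [sub_eq_add_neg]

theorem genericForm_counting_comp {d : ℕ} (hd : 2 ≤ d) {I Y : Type} [Fintype I] [Fintype Y]
    (ω : I → Fin k → MvPolynomial Y ℂ) (Γ : I → Polynomial (MvPolynomial Y ℂ))
    (hcount : Fintype.card Y + k < Fintype.card I * (d - 1)) :
    GenericForm d (fun F : MvPolynomial (Fin m) ℂ => ∀ (p : Fin k → ℂ) (y : Y → ℂ),
      eval (chartPt b p) F ≠ 0 →
      SeparatedFamily (fun i j => eval y (ω i j)) →
      ¬ ∀ i, ((Γ i).map (eval y)).coeff (d - 1) = 0 ∧ ∃ s : ℂ,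
        line (∑ j, eval y (ω i j) • b (some j)) (chartPt b p) F =
          Polynomial.C (eval (chartPt b p) F) *
            ((Γ i).map (eval y)).comp (Polynomial.X + Polynomial.C s)) := by
  refine (genericForm_counting b hd ω (fun i s => (Γ i).coeff (d - 2 - s)) hcount).mono ?_
  intro F hF hgen p y hFP hsep hall
  set P := chartPt b p with hP
  have hPP : polarForm F P P ≠ 0 := by
    rw [polarForm_self hF]
    refine mul_ne_zero ?_ hFP
    exact_mod_cast (by omega : d ≠ 0)
  let l : Fin k → ℂ := fun j => polarForm F P (b (some j)) / polarForm F P P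
  have hw : ∀ μ : Fin k → ℂ, ∑ j, μ j • centredPt b p l j =
      (∑ j, μ j • b (some j)) - (polarForm F P (∑ j, μ j • b (some j)) / polarForm F P P) • P := by
    intro μ
    simp only [centredPt, smul_sub, Finset.sum_sub_distrib, map_sum, map_smul]
    rw [Finset.sum_div, Finset.sum_smul]
    congr 1
    refine Finset.sum_congr rfl fun j _ => ?_
    rw [smul_smul, smul_eq_mul, mul_div_assoc]
  refine hgen p l y hsep ?_ ?_
  · intro j
    rw [line_coeff_pred (by omega) hF, ← polarForm_apply, centredPt, map_sub, map_smul, smul_eq_mul,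
      ← hP, div_mul_cancel₀ _ hPP, sub_self]
  · intro i s
    obtain ⟨h0, r, hr⟩ := hall i
    set w := ∑ j, eval y (ω i j) • b (some j) with hwdef
    have h1 : line (w - r • P) P F = Polynomial.C (eval P F) * (Γ i).map (eval y) := by
      rw [line_sub_smul, hr]
      simp [Polynomial.comp_assoc]
    have h2 : polarForm F P (w - r • P) = 0 := by
      rw [polarForm_apply, ← line_coeff_pred (by omega) hF, h1, Polynomial.coeff_C_mul, h0, mul_zero]
    have h3 : polarForm F P w / polarForm F P P = r := by
      rw [map_sub, map_smul, sub_eq_zero, smul_eq_mul] at h2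
      rw [h2, mul_div_cancel_right₀ _ hPP]
    rw [hw, ← hwdef, h3, ← hP, h1, Polynomial.coeff_C_mul, Polynomial.coeff_map, mul_comm]

/-- The roots-of-`F` version of the counting lemma: at the `i`-th point the restriction of `F`
has, after recentring, its vector of roots in the linear subspace `W i`. -/
theorem genericForm_counting_roots {d : ℕ} (hd : 2 ≤ d) {I σ : Type} [Fintype I] [Fintype σ]
    (ω : I → Fin k → MvPolynomial σ ℂ) (W : I → Submodule ℂ (Fin d → ℂ))
    (hW : ∀ i, ∀ ζ ∈ W i, ∑ a, ζ a = 0)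
    (hcount : Fintype.card σ + ∑ i, Module.finrank ℂ (W i) + k < Fintype.card I * (d - 1)) :
    GenericForm d (fun F : MvPolynomial (Fin m) ℂ => ∀ (p : Fin k → ℂ) (y : σ → ℂ),
      eval (chartPt b p) F ≠ 0 →
      SeparatedFamily (fun i j => eval y (ω i j)) →
      ¬ ∀ i, ∃ ζ ∈ W i, ∃ s : ℂ,
        line (∑ j, eval y (ω i j) • b (some j)) (chartPt b p) F =
          Polynomial.C (eval (chartPt b p) F) *
            (∏ a, (Polynomial.X - Polynomial.C (ζ a))).comp (Polynomial.X + Polynomial.C s)) := by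
  classical
  let Y : Type := σ ⊕ (Σ i, Fin (Module.finrank ℂ (W i)))
  let B := fun i => Module.finBasis ℂ (W i)
  let z : I → Fin d → MvPolynomial Y ℂ := fun i a =>
    ∑ j, X (Sum.inr ⟨i, j⟩) * C ((B i j : Fin d → ℂ) a)
  let Γ : I → Polynomial (MvPolynomial Y ℂ) := fun i => ∏ a, (Polynomial.X - Polynomial.C (z i a))
  have hcard : Fintype.card Y + k < Fintype.card I * (d - 1) := by
    simpa [Y] using hcount
  refine (genericForm_counting_comp b hd (fun i j => rename Sum.inl (ω i j)) Γ hcard).mono ?_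
  intro F hF hgen p y hFP hsep hall
  choose ζ hζ s hs using hall
  let y' : Y → ℂ := Sum.elim y (fun ij => (B ij.1).repr ⟨ζ ij.1, hζ ij.1⟩ ij.2)
  have hz : ∀ i a, eval y' (z i a) = ζ i a := by
    intro i a
    have h1 := congrArg (fun v : W i => (v : Fin d → ℂ) a) ((B i).sum_repr ⟨ζ i, hζ i⟩)
    simp only [z, map_sum, map_mul, eval_X, eval_C, y', Sum.elim_inr]
    simp only [Submodule.coe_sum, Submodule.coe_smul, Finset.sum_apply, Pi.smul_apply,
      smul_eq_mul] at h1
    exact h1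
  have hω : ∀ i j, eval y' (rename Sum.inl (ω i j) : MvPolynomial Y ℂ) = eval y (ω i j) := by
    intro i j
    rw [eval_rename]
    rfl
  have hΓ : ∀ i, (Γ i).map (eval y') = ∏ a, (Polynomial.X - Polynomial.C (ζ i a)) := by
    intro i
    simp [Γ, Polynomial.map_prod, hz]
  refine hgen p y' hFP (by simpa only [hω] using hsep) fun i => ⟨?_, s i, ?_⟩
  · rw [hΓ]
    have := Polynomial.prod_X_sub_C_coeff_card_pred Finset.univ (ζ i) (by simp; omega)
    rw [Finset.card_univ, Fintype.card_fin] at this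
    rw [this, hW i _ (hζ i), neg_zero]
  · simp only [hω, hΓ]
    exact hs i

/-- The points `ε₀, …, εₖ₋₁, ε₀ + ε₁`. -/
def frameCoord (h : 2 ≤ k) : Option (Fin k) → Fin k → ℂ
  | some j => Pi.single j 1
  | none => Pi.single ⟨0, by omega⟩ 1 + Pi.single ⟨1, by omega⟩ 1

lemma frameCoord_separated (h : 2 ≤ k) : SeparatedFamily (frameCoord h) := by
  classical
  have hne : (⟨0, by omega⟩ : Fin k) ≠ ⟨1, by omega⟩ := by simp
  generalize h0 : (⟨0, by omega⟩ : Fin k) = i0 at hne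
  generalize h1 : (⟨1, by omega⟩ : Fin k) = i1 at hne
  have hn : frameCoord h none = Pi.single i0 1 + Pi.single i1 1 := by
    rw [← h0, ← h1]; rfl
  have hs : ∀ j, frameCoord h (some j) = Pi.single j 1 := fun j => rfl
  have key : ∀ i j : Fin k, (Pi.single i 1 : Fin k → ℂ) ⬝ᵥ Pi.single j 1 =
      if i = j then 1 else 0 := by
    intro i j
    simp [Pi.single_apply, eq_comm]
  rintro (_ | j)
  · refine ⟨Pi.single i0 1, Pi.single i1 1, ?_, ?_, ?_⟩
    · rw [hn, dotProduct_add, key, key]; simp [hne]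
    · rw [hn, dotProduct_add, key, key]; simp [hne.symm]
    · rintro (_ | j) hj
      · exact absurd rfl hj
      · rw [hs, key, key]
        by_cases e : i0 = j
        · right; rw [if_neg]; rintro rfl; exact hne e
        · left; rw [if_neg e]
  · by_cases j0 : j = i0
    · subst j0
      refine ⟨Pi.single j 1, Pi.single j 1 - Pi.single i1 1, ?_, ?_, ?_⟩
      · rw [hs, key]; simp
      · rw [hs, sub_dotProduct, key, key]; simp [hne.symm]
      · rintro (_ | j') hj
        · right
          rw [hn, sub_dotProduct, dotProduct_add, dotProduct_add, key, key, key, key]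
          simp [hne, hne.symm]
        · left
          rw [hs, key, if_neg]
          rintro rfl; exact hj rfl
    · by_cases j1 : j = i1
      · subst j1
        refine ⟨Pi.single j 1, Pi.single j 1 - Pi.single i0 1, ?_, ?_, ?_⟩
        · rw [hs, key]; simp
        · rw [hs, sub_dotProduct, key, key]; simp [hne]
        · rintro (_ | j') hj
          · right
            rw [hn, sub_dotProduct, dotProduct_add, dotProduct_add, key, key, key, key]
            simp [hne, hne.symm]
          · left
            rw [hs, key, if_neg]
            rintro rfl; exact hj rfl
      · refine ⟨Pi.single j 1, Pi.single j 1, ?_, ?_, ?_⟩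
        · rw [hs, key]; simp
        · rw [hs, key]; simp
        · rintro (_ | j') hj
          · left
            rw [hn, dotProduct_add, key, key]
            simp [j0, j1]
          · left
            rw [hs, key, if_neg]
            rintro rfl; exact hj rfl

end CountingFamilies

section Families

open MvPolynomial

lemma comp_coeff_pred_eq_zero {R : Type*} [CommRing R] [IsDomain R] {g h : Polynomial R} {b k : ℕ}
    (hg : g.Monic) (hgb : g.natDegree = b) (hh : h.Monic) (hhk : h.natDegree = k)
    (hk : 2 ≤ k) (hb : 1 ≤ b) (h0 : h.coeff (k - 1) = 0) : (g.comp h).coeff (k * b - 1) = 0 := by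
  have hkb : 2 * b ≤ k * b := Nat.mul_le_mul_right _ hk
  rw [hg.as_sum, hgb]
  simp only [Polynomial.add_comp, Polynomial.sum_comp, Polynomial.mul_comp,
    Polynomial.C_comp, Polynomial.pow_comp, Polynomial.X_comp, Polynomial.coeff_add,
    Polynomial.finsetSum_coeff, Polynomial.coeff_C_mul]
  have h1 : (h ^ b).coeff (k * b - 1) = 0 := by
    have := hh.nextCoeff_pow b
    rw [Polynomial.nextCoeff_of_natDegree_pos (by rw [hh.natDegree_pow, hhk]; nlinarith),
      hh.natDegree_pow, hhk, Polynomial.nextCoeff_of_natDegree_pos (by omega), hhk, h0,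
      smul_zero, mul_comm] at this
    exact this
  rw [h1, zero_add]
  refine Finset.sum_eq_zero fun j hj => ?_
  rw [Finset.mem_range] at hj
  refine mul_eq_zero_of_right _ (Polynomial.coeff_eq_zero_of_natDegree_lt ?_)
  rw [hh.natDegree_pow, hhk]
  have : j * k ≤ (b - 1) * k := Nat.mul_le_mul_right _ (by omega)
  have h2 : (b - 1) * k + k = b * k := by
    rw [← Nat.succ_mul]; congr 1; omega
  rw [mul_comm k b]
  omega

variable {m k : ℕ} (b : Module.Basis (Option (Fin k)) ℂ (Fin m → ℂ))

/-- The coordinates of the points in the frame, relative to `b`. -/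
noncomputable def framePt (hk : 2 ≤ k) (i : Option (Fin k)) : Fin m → ℂ :=
  ∑ j, frameCoord hk i j • b (some j)

lemma exists_centred_comp {g h : Polynomial ℂ} {e l : ℕ} (hg : g.Monic) (hge : g.natDegree = e)
    (hh : h.Monic) (hhl : h.natDegree = l) (hl : 2 ≤ l) :
    ∃ (y : Fin (l - 2) ⊕ Fin e → ℂ) (s : ℂ), g.comp h =
      ((Polynomial.X ^ e + ∑ j : Fin e, Polynomial.C (y (Sum.inr j)) * Polynomial.X ^ (j : ℕ)).comp
      (Polynomial.X ^ l + ∑ j : Fin (l - 2),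
        Polynomial.C (y (Sum.inl j)) * Polynomial.X ^ ((j : ℕ) + 1))).comp
          (Polynomial.X + Polynomial.C s) := by
  have hl0 : (l : ℂ) ≠ 0 := by
    exact_mod_cast (by omega : l ≠ 0)
  set s : ℂ := h.coeff (l - 1) / l with hs
  set h' := h.comp (Polynomial.X - Polynomial.C s) with hh'
  have hm' : h'.Monic := by
    rw [hh', sub_eq_add_neg, ← Polynomial.C_neg]
    exact hh.comp_X_add_C _
  have hd' : h'.natDegree = l := by
    rw [hh', Polynomial.natDegree_comp, Polynomial.natDegree_X_sub_C, mul_one, hhl]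
  have hc' : h'.coeff (l - 1) = 0 := by
    have h1 := hh.as_sum
    rw [hhl] at h1
    rw [hh', h1]
    simp only [Polynomial.add_comp, Polynomial.sum_comp, Polynomial.mul_comp,
      Polynomial.C_comp, Polynomial.pow_comp, Polynomial.X_comp, Polynomial.coeff_add,
      Polynomial.finsetSum_coeff, Polynomial.coeff_C_mul]
    rw [Finset.sum_eq_single (l - 1)]
    · rw [sub_eq_add_neg, ← Polynomial.C_neg, Polynomial.coeff_X_add_C_pow,
        Polynomial.coeff_X_add_C_pow]
      have e1 : l - (l - 1) = 1 := by omega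
      have e2 : l.choose (l - 1) = l := by
        rw [← Nat.choose_symm_of_eq_add (show l = 1 + (l - 1) by omega), Nat.choose_one_right]
      rw [e1, e2]
      simp only [pow_one, Nat.sub_self, pow_zero, Nat.choose_self, Nat.cast_one, mul_one]
      rw [hs]
      field_simp
      ring
    · intro j hj hne
      rw [Finset.mem_range] at hj
      refine mul_eq_zero_of_right _ (Polynomial.coeff_eq_zero_of_natDegree_lt ?_)
      rw [Polynomial.natDegree_pow, Polynomial.natDegree_X_sub_C]
      omega
    · intro hj
      simp at hj
      omega
  set c := h'.coeff 0 with hc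
  set g' := g.comp (Polynomial.X + Polynomial.C c) with hg'
  have hgm : g'.Monic := hg.comp_X_add_C _
  have hgd : g'.natDegree = e := by
    rw [hg', Polynomial.natDegree_comp, Polynomial.natDegree_X_add_C, mul_one, hge]
  refine ⟨Sum.elim (fun j => h'.coeff (j + 1)) (fun j => g'.coeff j), s, ?_⟩
  have e1 : Polynomial.X ^ e + ∑ j : Fin e, Polynomial.C (g'.coeff j) * Polynomial.X ^ (j : ℕ) =
      g' := by
    conv_rhs => rw [hgm.as_sum, hgd]
    rw [Finset.sum_range]
  have e2 : Polynomial.X ^ l + ∑ j : Fin (l - 2),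
      Polynomial.C (h'.coeff (j + 1)) * Polynomial.X ^ ((j : ℕ) + 1) = h' - Polynomial.C c := by
    conv_rhs => rw [hm'.as_sum, hd']
    have : l = (l - 2 + 1) + 1 := by omega
    rw [Finset.sum_range]
    conv_rhs => rw [← Finset.sum_range (fun i => Polynomial.C (h'.coeff i) * Polynomial.X ^ i)]
    have e3 : ∑ i ∈ Finset.range l, Polynomial.C (h'.coeff i) * Polynomial.X ^ i =
        ∑ j : Fin (l - 2), Polynomial.C (h'.coeff (j + 1)) * Polynomial.X ^ ((j : ℕ) + 1)
          + Polynomial.C c := by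
      have : Finset.range l = Finset.range ((l - 2 + 1) + 1) := by congr 1
      rw [this, Finset.sum_range_succ, Finset.sum_range_succ', ← Finset.sum_range
        (fun i => Polynomial.C (h'.coeff (i + 1)) * Polynomial.X ^ (i + 1))]
      have e4 : l - 2 + 1 = l - 1 := by omega
      rw [e4, hc']
      simp [hc]
    rw [e3]
    ring
  simp only [Sum.elim_inl, Sum.elim_inr]
  rw [e1, e2, hg', hh', Polynomial.comp_assoc, Polynomial.comp_assoc]
  congr 1
  simp [Polynomial.comp_assoc]

/-- For generic `F` and every `P` off `F = 0`, the restriction of `F` to some line joining `P` to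
a point of the frame is not a composition of polynomials of given degrees. -/
theorem genericForm_not_composite (hk : 2 ≤ k) {l e : ℕ} (hl : 2 ≤ l) (he : 2 ≤ e) :
    GenericForm (l * e) (fun F : MvPolynomial (Fin m) ℂ => ∀ p : Fin k → ℂ,
      eval (chartPt b p) F ≠ 0 → ∃ i : Option (Fin k), ¬ ∃ g h : Polynomial ℂ,
        g.Monic ∧ g.natDegree = e ∧ h.Monic ∧ h.natDegree = l ∧
        line (framePt b hk i) (chartPt b p) F =
          Polynomial.C (eval (chartPt b p) F) * g.comp h) := by
  let Y : Type := Option (Fin k) × (Fin (l - 2) ⊕ Fin e)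
  have hle : 2 ≤ l * e := by nlinarith
  have hcount : Fintype.card Y + k < Fintype.card (Option (Fin k)) * (l * e - 1) := by
    simp only [Y, Fintype.card_prod, Fintype.card_option, Fintype.card_fin, Fintype.card_sum]
    obtain ⟨l, rfl⟩ := Nat.exists_eq_add_of_le hl
    obtain ⟨e, rfl⟩ := Nat.exists_eq_add_of_le he
    have : (2 + l) * (2 + e) - 1 = (2 + l - 2 + (2 + e)) + (1 + (l + e + l * e)) := by
      have : (2 + l) * (2 + e) = 4 + 2 * l + 2 * e + l * e := by ring
      omega
    rw [this]
    nlinarith [Nat.zero_le (k * (l + e + l * e)), Nat.zero_le (l * e)]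
  refine (genericForm_counting_comp b hle (fun i j => (C (frameCoord hk i j) : MvPolynomial Y ℂ))
    (fun i => (Polynomial.X ^ e + ∑ j : Fin e, Polynomial.C (X (i, Sum.inr j) :
      MvPolynomial Y ℂ) * Polynomial.X ^ (j : ℕ)).comp
      (Polynomial.X ^ l + ∑ j : Fin (l - 2),
        Polynomial.C (X (i, Sum.inl j)) * Polynomial.X ^ ((j : ℕ) + 1))) hcount).mono ?_
  intro F hF hgen p hFP
  by_contra! hall
  choose g h hg hge hh hhl hline using hall
  choose y s hy using fun i => exists_centred_comp (hg i) (hge i) (hh i) (hhl i) hl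
  refine hgen p (fun q => y q.1 q.2) hFP (by simpa using frameCoord_separated hk)
    fun i => ⟨?_, s i, ?_⟩
  · simp only [Polynomial.map_comp, Polynomial.map_add, Polynomial.map_pow, Polynomial.map_X,
      Polynomial.map_sum, Polynomial.map_mul, Polynomial.map_C, eval_X]
    have hdeg1 : (∑ j : Fin e, Polynomial.C (y i (Sum.inr j)) *
        Polynomial.X ^ (j : ℕ)).degree < ((e : ℕ) : WithBot ℕ) :=
      Polynomial.degree_sum_fin_lt _
    have hdeg2 : (∑ j : Fin (l - 2), Polynomial.C (y i (Sum.inl j)) *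
        Polynomial.X ^ ((j : ℕ) + 1)).degree < ((l - 1 : ℕ) : WithBot ℕ) := by
      refine lt_of_le_of_lt (Polynomial.degree_sum_le _ _) ?_
      rw [Finset.sup_lt_iff (WithBot.bot_lt_coe _)]
      intro j _
      refine lt_of_le_of_lt (Polynomial.degree_C_mul_X_pow_le _ _) ?_
      exact_mod_cast (by omega : (j : ℕ) + 1 < l - 1)
    have hdeg3 := hdeg2.trans (show ((l - 1 : ℕ) : WithBot ℕ) < ((l : ℕ) : WithBot ℕ) by
      exact_mod_cast (by omega : l - 1 < l))
    refine comp_coeff_pred_eq_zero (Polynomial.monic_X_pow_add hdeg1) ?_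
      (Polynomial.monic_X_pow_add hdeg3) ?_ hl (by omega) ?_
    · rw [Polynomial.natDegree_add_eq_left_of_degree_lt, Polynomial.natDegree_X_pow]
      rwa [Polynomial.degree_X_pow]
    · rw [Polynomial.natDegree_add_eq_left_of_degree_lt, Polynomial.natDegree_X_pow]
      rwa [Polynomial.degree_X_pow]
    · rw [Polynomial.coeff_add, Polynomial.coeff_eq_zero_of_degree_lt hdeg2,
        Polynomial.coeff_X_pow, if_neg (by omega), add_zero]
  · simp only [eval_C, Polynomial.map_comp, Polynomial.map_add, Polynomial.map_pow,
      Polynomial.map_X, Polynomial.map_sum, Polynomial.map_mul, Polynomial.map_C, eval_X]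
    rw [← hy i]
    exact hline i

end Families

section RootFamilies

open MvPolynomial

lemma exists_roots_of_natDegree_le {f : Polynomial ℂ} {d : ℕ} (hf : f.natDegree ≤ d)
    (hd : f.coeff d ≠ 0) : ∃ ζ : Fin d → ℂ,
      f = Polynomial.C (f.coeff d) * ∏ a, (Polynomial.X - Polynomial.C (ζ a)) := by
  have hdeg : f.natDegree = d := le_antisymm hf (Polynomial.le_natDegree_of_ne_zero hd)
  have hsp := IsAlgClosed.splits f
  have hcard : f.roots.toList.length = d := by
    rw [Multiset.length_toList, ← hdeg]
    exact hsp.natDegree_eq_card_roots.symm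
  refine ⟨fun a => f.roots.toList.get (a.cast hcard.symm), ?_⟩
  have h1 := hsp.eq_prod_roots
  have hlead : f.leadingCoeff = f.coeff d := by rw [← hdeg]; rfl
  rw [hlead] at h1
  conv_lhs => rw [h1]
  congr 1
  have h2 : ∏ a : Fin d, (Polynomial.X - Polynomial.C (f.roots.toList.get (a.cast hcard.symm))) =
      ∏ a : Fin f.roots.toList.length, (Polynomial.X - Polynomial.C (f.roots.toList.get a)) :=
    Equiv.prod_comp (finCongr hcard.symm)
      (fun a => Polynomial.X - Polynomial.C (f.roots.toList.get a))
  rw [h2]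
  conv_lhs => rw [← Multiset.coe_toList f.roots]
  rw [Multiset.map_coe, Multiset.prod_coe, ← List.prod_ofFn]
  congr 1
  conv_lhs => rw [← List.ofFn_get f.roots.toList, List.map_ofFn]
  rfl

lemma exists_centred_roots {d : ℕ} (hd : 1 ≤ d) (ζ : Fin d → ℂ) : ∃ s : ℂ,
    ∑ a, (ζ a - s) = 0 ∧ ∏ a, (Polynomial.X - Polynomial.C (ζ a)) =
      (∏ a, (Polynomial.X - Polynomial.C (ζ a - s))).comp (Polynomial.X + Polynomial.C (-s)) := by
  have : (d : ℂ) ≠ 0 := by exact_mod_cast (by omega : d ≠ 0)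
  refine ⟨(∑ a, ζ a) / d, ?_, ?_⟩
  · rw [Finset.sum_sub_distrib]
    simp
    field_simp
    ring
  · rw [Polynomial.prod_comp]
    refine Finset.prod_congr rfl fun a _ => ?_
    simp
    ring

/-- The sum of the coordinates. -/
def sumForm (d : ℕ) : (Fin d → ℂ) →ₗ[ℂ] ℂ := ∑ i, LinearMap.proj (R := ℂ) (φ := fun _ => ℂ) i

/-- The difference of two coordinates. -/
def diffForm {d : ℕ} (a b : Fin d) : (Fin d → ℂ) →ₗ[ℂ] ℂ :=
  LinearMap.proj (R := ℂ) (φ := fun _ => ℂ) a - LinearMap.proj (R := ℂ) (φ := fun _ => ℂ) b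

lemma sumForm_apply {d : ℕ} (ζ : Fin d → ℂ) : sumForm d ζ = ∑ i, ζ i := by simp [sumForm]

lemma diffForm_apply {d : ℕ} (a b : Fin d) (ζ : Fin d → ℂ) : diffForm a b ζ = ζ a - ζ b := rfl

/-- Centred root vectors with a coincidence. -/
def doubleRootSpace (d : ℕ) (a b : Fin d) : Submodule ℂ (Fin d → ℂ) :=
  LinearMap.ker ((sumForm d).prod (diffForm a b))

/-- Centred root vectors with two coincidences. -/
def badRootSpace (d : ℕ) (a b c e : Fin d) : Submodule ℂ (Fin d → ℂ) :=
  LinearMap.ker ((sumForm d).prod ((diffForm a b).prod (diffForm c e)))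

lemma mem_doubleRootSpace {d : ℕ} {a b : Fin d} {ζ : Fin d → ℂ} :
    ζ ∈ doubleRootSpace d a b ↔ ∑ i, ζ i = 0 ∧ ζ a = ζ b := by
  simp [doubleRootSpace, sumForm_apply, diffForm_apply, sub_eq_zero]

lemma mem_badRootSpace {d : ℕ} {a b c e : Fin d} {ζ : Fin d → ℂ} :
    ζ ∈ badRootSpace d a b c e ↔ ∑ i, ζ i = 0 ∧ ζ a = ζ b ∧ ζ c = ζ e := by
  simp [badRootSpace, sumForm_apply, diffForm_apply, sub_eq_zero]

lemma exists_recentred {d : ℕ} (hd : 1 ≤ d) (ζ : Fin d → ℂ) (x : ℂ) :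
    ∃ r : ℂ, ∑ i, (ζ i + r) = x := by
  have : (d : ℂ) ≠ 0 := by exact_mod_cast (by omega : d ≠ 0)
  refine ⟨(x - ∑ i, ζ i) / d, ?_⟩
  rw [Finset.sum_add_distrib]
  simp
  field_simp
  ring

lemma finrank_doubleRootSpace {d : ℕ} {a b : Fin d} (hab : a ≠ b) :
    Module.finrank ℂ (doubleRootSpace d a b) + 2 = d := by
  set φ := (sumForm d).prod (diffForm a b) with hφ
  have hsurj : Function.Surjective φ := by
    rintro ⟨x, y⟩
    have h1 : 1 ≤ d := by have := a.2; omega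
    obtain ⟨r, hr⟩ := exists_recentred h1 (Pi.single a y) x
    refine ⟨fun i => Pi.single (M := fun _ => ℂ) a y i + r, ?_⟩
    simp only [hφ, LinearMap.prod_apply, Function.prod_apply, sumForm_apply, diffForm_apply,
      Prod.mk.injEq]
    refine ⟨hr, ?_⟩
    simp [hab.symm]
  have := φ.finrank_range_add_finrank_ker
  rw [LinearMap.range_eq_top.2 hsurj, finrank_top] at this
  simp at this
  rw [doubleRootSpace, ← hφ]
  omega

lemma finrank_badRootSpace {d : ℕ} {a b c e : Fin d} (hab : a ≠ b) (hce : c ≠ e)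
    (hne : s(a, b) ≠ s(c, e)) : Module.finrank ℂ (badRootSpace d a b c e) + 3 = d := by
  set φ := (sumForm d).prod ((diffForm a b).prod (diffForm c e)) with hφ
  have hsurj : Function.Surjective φ := by
    rintro ⟨x, y, z⟩
    obtain ⟨ζ, h2, h3⟩ : ∃ ζ : Fin d → ℂ, ζ a - ζ b = y ∧ ζ c - ζ e = z := by
      by_cases hc : c = a ∨ c = b
      · have he : e ≠ a ∧ e ≠ b := by
          constructor
          · rintro rfl
            rcases hc with rfl | rfl
            · exact hce rfl
            · exact hne Sym2.eq_swap
          · rintro rfl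
            rcases hc with rfl | rfl
            · exact hne rfl
            · exact hce rfl
        refine ⟨Pi.single a y + Pi.single e ((if c = a then y else 0) - z), ?_, ?_⟩
        · simp [hab.symm, he.1.symm, he.2.symm]
        · simp [Pi.single_apply, hce, he.1]
      · push Not at hc
        refine ⟨Pi.single a y + Pi.single c (z + (if e = a then y else 0)), ?_, ?_⟩
        · simp [hab.symm, hc.1.symm, hc.2.symm]
        · simp [Pi.single_apply, hce.symm, hc.1]
    have h1 : 1 ≤ d := by have := a.2; omega
    obtain ⟨r, hr⟩ := exists_recentred h1 ζ x
    refine ⟨fun i => ζ i + r, ?_⟩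
    simp only [hφ, LinearMap.prod_apply, Function.prod_apply, sumForm_apply, diffForm_apply,
      Prod.mk.injEq]
    exact ⟨hr, by rw [← h2]; ring, by rw [← h3]; ring⟩
  have := φ.finrank_range_add_finrank_ker
  rw [LinearMap.range_eq_top.2 hsurj, finrank_top] at this
  simp at this
  rw [badRootSpace, ← hφ]
  omega

/-- The polynomial `f` of degree `d` has at least two coincidences among its roots. -/
def BadRoots (d : ℕ) (f : Polynomial ℂ) : Prop :=
  ∃ ζ : Fin d → ℂ, f = Polynomial.C (f.coeff d) * ∏ a, (Polynomial.X - Polynomial.C (ζ a)) ∧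
    ∃ a b c e, a ≠ b ∧ c ≠ e ∧ s(a, b) ≠ s(c, e) ∧ ζ a = ζ b ∧ ζ c = ζ e

variable {m k : ℕ} (b : Module.Basis (Option (Fin k)) ℂ (Fin m → ℂ))

lemma line_coeff_top_complex {d : ℕ} {F : MvPolynomial (Fin m) ℂ} (hF : F.IsHomogeneous d)
    (x P : Fin m → ℂ) : (line x P F).coeff d = eval P F := by
  rw [line_coeff_top hF]; rfl

theorem genericForm_tangent {d : ℕ} (hd : 2 ≤ d) {I σ : Type} [Fintype I] [Fintype σ]
    (ω : I → Fin k → MvPolynomial σ ℂ) (hcount : Fintype.card σ + k < 2 * Fintype.card I) :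
    GenericForm d (fun F : MvPolynomial (Fin m) ℂ => ∀ (p : Fin k → ℂ) (y : σ → ℂ),
      eval (chartPt b p) F ≠ 0 → SeparatedFamily (fun i j => eval y (ω i j)) →
      ∃ i, ¬ BadRoots d (line (∑ j, eval y (ω i j) • b (some j)) (chartPt b p) F)) := by
  let T := {t : Fin d × Fin d × Fin d × Fin d //
    t.1 ≠ t.2.1 ∧ t.2.2.1 ≠ t.2.2.2 ∧ s(t.1, t.2.1) ≠ s(t.2.2.1, t.2.2.2)}
  let W : T → Submodule ℂ (Fin d → ℂ) := fun t => badRootSpace d t.1.1 t.1.2.1 t.1.2.2.1 t.1.2.2.2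
  have hW : ∀ t, Module.finrank ℂ (W t) + 3 = d := fun t =>
    finrank_badRootSpace t.2.1 t.2.2.1 t.2.2.2
  have key : ∀ τ : I → T, GenericForm d (fun F : MvPolynomial (Fin m) ℂ =>
      ∀ (p : Fin k → ℂ) (y : σ → ℂ),
      eval (chartPt b p) F ≠ 0 →
      SeparatedFamily (fun i j => eval y (ω i j)) →
      ¬ ∀ i, ∃ ζ ∈ W (τ i), ∃ s : ℂ,
        line (∑ j, eval y (ω i j) • b (some j)) (chartPt b p) F =
          Polynomial.C (eval (chartPt b p) F) *
            (∏ a, (Polynomial.X - Polynomial.C (ζ a))).comp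
              (Polynomial.X + Polynomial.C s)) := by
    intro τ
    refine genericForm_counting_roots b hd ω (fun i => W (τ i)) ?_ ?_
    · intro i ζ hζ
      exact (mem_badRootSpace.1 hζ).1
    · have h1 : ∀ i, Module.finrank ℂ (W (τ i)) = d - 3 := fun i => by
        have := hW (τ i); omega
      simp only [h1, Finset.sum_const, Finset.card_univ, smul_eq_mul]
      obtain ⟨i⟩ : Nonempty I := Fintype.card_pos_iff.1 (by omega)
      have h3 : d - 1 = (d - 3) + 2 := by have := hW (τ i); omega
      rw [h3, Nat.mul_add]
      omega
  refine (GenericForm.forall_finite key).mono ?_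
  intro F hF hgen p y hFP hsep
  by_contra! hall
  choose ζ hζ a b' c e h1 h2 h3 h4 h5 using hall
  have hd1 : 1 ≤ d := by omega
  choose s hs0 hs using fun i => exists_centred_roots hd1 (ζ i)
  refine hgen (fun i => ⟨(a i, b' i, c i, e i), h1 i, h2 i, h3 i⟩) p y hFP hsep fun i =>
    ⟨fun j => ζ i j - s i, mem_badRootSpace.2 ⟨hs0 i, ?_, ?_⟩, -s i, ?_⟩
  · simp [h4]
  · simp [h5]
  · rw [← hs i]
    have := hζ i
    rwa [line_coeff_top_complex hF] at this

theorem genericForm_squarefree (hk : 2 ≤ k) {d : ℕ} (hd : 2 ≤ d) :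
    GenericForm d (fun F : MvPolynomial (Fin m) ℂ => ∀ p : Fin k → ℂ,
      eval (chartPt b p) F ≠ 0 → ∃ i : Option (Fin k),
        (line (framePt b hk i) (chartPt b p) F).Separable) := by
  let T := {t : Fin d × Fin d // t.1 ≠ t.2}
  let W : T → Submodule ℂ (Fin d → ℂ) := fun t => doubleRootSpace d t.1.1 t.1.2
  have hW : ∀ t, Module.finrank ℂ (W t) + 2 = d := fun t => finrank_doubleRootSpace t.2
  have key : ∀ τ : Option (Fin k) → T, GenericForm d (fun F : MvPolynomial (Fin m) ℂ =>
      ∀ (p : Fin k → ℂ) (y : Empty → ℂ),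
      eval (chartPt b p) F ≠ 0 →
      SeparatedFamily (fun i j => eval y (C (frameCoord hk i j) : MvPolynomial Empty ℂ)) →
      ¬ ∀ i, ∃ ζ ∈ W (τ i), ∃ s : ℂ,
        line (∑ j, eval y (C (frameCoord hk i j) : MvPolynomial Empty ℂ) • b (some j))
          (chartPt b p) F =
          Polynomial.C (eval (chartPt b p) F) *
            (∏ a, (Polynomial.X - Polynomial.C (ζ a))).comp
              (Polynomial.X + Polynomial.C s)) := by
    intro τ
    refine genericForm_counting_roots b hd (fun i j => C (frameCoord hk i j))
      (fun i => W (τ i)) ?_ ?_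
    · intro i ζ hζ
      exact (mem_doubleRootSpace.1 hζ).1
    · have h1 : ∀ i, Module.finrank ℂ (W (τ i)) = d - 2 := fun i => by
        have := hW (τ i); omega
      simp only [h1, Finset.sum_const, Finset.card_univ, smul_eq_mul, Fintype.card_option,
        Fintype.card_fin, Fintype.card_empty]
      have h3 : d - 1 = (d - 2) + 1 := by omega
      rw [h3, Nat.mul_add]
      omega
  refine (GenericForm.forall_finite key).mono ?_
  intro F hF hgen p hFP
  by_contra! hall
  have hd1 : 1 ≤ d := by omega
  have hroots : ∀ i, ∃ ζ : Fin d → ℂ, line (framePt b hk i) (chartPt b p) F =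
      Polynomial.C (eval (chartPt b p) F) * ∏ a, (Polynomial.X - Polynomial.C (ζ a)) := by
    intro i
    have h := exists_roots_of_natDegree_le (line_natDegree_le hF (framePt b hk i) (chartPt b p))
      (by rwa [line_coeff_top_complex hF])
    rwa [line_coeff_top_complex hF] at h
  choose ζ hζ using hroots
  have hdouble : ∀ i, ∃ a b', a ≠ b' ∧ ζ i a = ζ i b' := by
    intro i
    by_contra! hinj
    refine hall i ?_
    rw [hζ i]
    refine Polynomial.Separable.unit_mul (Polynomial.isUnit_C.2 (isUnit_iff_ne_zero.2 hFP)) ?_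
    rw [Polynomial.separable_prod_X_sub_C_iff]
    intro a b' h
    by_contra hne
    exact hinj a b' hne h
  choose a b' h1 h4 using hdouble
  choose s hs0 hs using fun i => exists_centred_roots hd1 (ζ i)
  refine hgen (fun i => ⟨(a i, b' i), h1 i⟩) p (fun e => e.elim) hFP
    (by simpa using frameCoord_separated hk) fun i =>
    ⟨fun j => ζ i j - s i, mem_doubleRootSpace.2 ⟨hs0 i, ?_⟩, -s i, ?_⟩
  · simp [h4]
  · rw [← hs i]
    simp only [eval_C]
    exact hζ i

end RootFamilies

section Pencils

open MvPolynomial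

lemma separatedFamily_pencil {y : Fin 3 → ℂ} (hy : Function.Injective y) :
    SeparatedFamily (fun i : Fin 3 => ![y i, 1]) := by
  have key : ∀ i i1 i2 : Fin 3, i ≠ i1 → i ≠ i2 → (∀ j, j ≠ i → j = i1 ∨ j = i2) →
      ∃ a c : Fin 2 → ℂ, a ⬝ᵥ ![y i, 1] ≠ 0 ∧ c ⬝ᵥ ![y i, 1] ≠ 0 ∧ ∀ i', i' ≠ i →
        a ⬝ᵥ ![y i', 1] = 0 ∨ c ⬝ᵥ ![y i', 1] = 0 := by
    intro i i1 i2 h1 h2 h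
    refine ⟨![1, -y i1], ![1, -y i2], ?_, ?_, ?_⟩
    · simp only [Matrix.cons_dotProduct_cons, Matrix.dotProduct_of_isEmpty, one_mul, mul_one,
        add_zero, ← sub_eq_add_neg, sub_ne_zero]
      exact fun e => h1 (hy e)
    · simp only [Matrix.cons_dotProduct_cons, Matrix.dotProduct_of_isEmpty, one_mul, mul_one,
        add_zero, ← sub_eq_add_neg, sub_ne_zero]
      exact fun e => h2 (hy e)
    · intro j hj
      rcases h j hj with rfl | rfl
      · left; simp
      · right; simp
  intro i
  fin_cases i
  · exact key 0 1 2 (by decide) (by decide) (by decide)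
  · exact key 1 0 2 (by decide) (by decide) (by decide)
  · exact key 2 0 1 (by decide) (by decide) (by decide)

lemma append_dotProduct_append {a b : ℕ} (u u' : Fin a → ℂ) (v v' : Fin b → ℂ) :
    Fin.append u v ⬝ᵥ Fin.append u' v' = u ⬝ᵥ u' + v ⬝ᵥ v' := by
  simp [dotProduct, Fin.sum_univ_add]

/-- Adding points `εⱼ + sⱼ ε₀` with independent new directions `εⱼ` to a family. -/
def extendFamily {I : Type} {r : ℕ} {R : Type*} [CommRing R] (w : I → Fin 3 → R) (s : Fin r → R) :
    I ⊕ Fin r → Fin (3 + r) → R :=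
  Sum.elim (fun i => Fin.append (w i) 0) (fun j => Fin.append ![s j, 0, 0] (Pi.single j 1))

lemma SeparatedFamily.extend {I : Type} {r : ℕ} {w : I → Fin 3 → ℂ} (hw : SeparatedFamily w)
    (s : Fin r → ℂ) : SeparatedFamily (extendFamily w s) := by
  rintro (i | j)
  · obtain ⟨a, c, ha, hc, h⟩ := hw i
    refine ⟨Fin.append a (fun j => -(a 0 * s j)), Fin.append c (fun j => -(c 0 * s j)), ?_, ?_, ?_⟩
    · simpa [extendFamily, append_dotProduct_append] using ha
    · simpa [extendFamily, append_dotProduct_append] using hc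
    · rintro (i' | j) hi
      · have := h i' (fun e => hi (by rw [e]))
        simpa [extendFamily, append_dotProduct_append] using this
      · left
        simp only [extendFamily, Sum.elim_inr, append_dotProduct_append, dotProduct_single]
        simp [dotProduct, Fin.sum_univ_three]
  · refine ⟨Fin.append 0 (Pi.single j 1), Fin.append 0 (Pi.single j 1), ?_, ?_, ?_⟩
    · simp [extendFamily, append_dotProduct_append]
    · simp [extendFamily, append_dotProduct_append]
    · rintro (i | j') hj
      · left; simp [extendFamily, append_dotProduct_append]
      · left
        have : j ≠ j' := fun e => hj (by rw [e])
        simp [extendFamily, append_dotProduct_append, this]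

/-- Four points above `ε₁, ε₂, ε₁ + ε₂, ε₁ - ε₂`. -/
def quadFamily {R : Type*} [CommRing R] (s : Fin 4 → R) : Fin 4 → Fin 3 → R :=
  ![![s 0, 1, 0], ![s 1, 0, 1], ![s 2, 1, 1], ![s 3, 1, -1]]

/-- Three collinear points above `ε₁, ε₂, ε₁ + ε₂`. -/
def tripleFamily {R : Type*} [CommRing R] (s : Fin 2 → R) : Fin 3 → Fin 3 → R :=
  ![![s 0, 1, 0], ![s 1, 0, 1], ![s 0 + s 1, 1, 1]]

lemma quadFamily_separated {s : Fin 4 → ℂ} (hs : s 2 ≠ s 0 + s 1) :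
    SeparatedFamily (quadFamily s) := by
  have hκ : s 2 - s 0 - s 1 ≠ 0 := by
    intro h; apply hs; linear_combination h
  intro i
  fin_cases i
  · refine ⟨![1, -(s 2 - s 1), -s 1], ![0, 1, 1], ?_, ?_, ?_⟩
    · simp [quadFamily, dotProduct, Fin.sum_univ_three]
      intro h; apply hκ; linear_combination -h
    · simp [quadFamily, dotProduct, Fin.sum_univ_three]
    · intro j hj
      fin_cases j
      · exact absurd rfl hj
      · left; simp [quadFamily, dotProduct, Fin.sum_univ_three]
      · left; simp [quadFamily, dotProduct, Fin.sum_univ_three]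
      · right; simp [quadFamily, dotProduct, Fin.sum_univ_three]
  · refine ⟨![1, -s 0, -(s 2 - s 0)], ![0, 1, 1], ?_, ?_, ?_⟩
    · simp [quadFamily, dotProduct, Fin.sum_univ_three]
      intro h; apply hκ; linear_combination -h
    · simp [quadFamily, dotProduct, Fin.sum_univ_three]
    · intro j hj
      fin_cases j
      · left; simp [quadFamily, dotProduct, Fin.sum_univ_three]
      · exact absurd rfl hj
      · left
        simp [quadFamily, dotProduct, Fin.sum_univ_three]
        ring
      · right; simp [quadFamily, dotProduct, Fin.sum_univ_three]
  · refine ⟨![1, -s 0, -s 1], ![0, 1, 1], ?_, ?_, ?_⟩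
    · simp [quadFamily, dotProduct, Fin.sum_univ_three]
      intro h; apply hκ; linear_combination h
    · simp [quadFamily, dotProduct, Fin.sum_univ_three]
    · intro j hj
      fin_cases j
      · left; simp [quadFamily, dotProduct, Fin.sum_univ_three]
      · left; simp [quadFamily, dotProduct, Fin.sum_univ_three]
      · exact absurd rfl hj
      · right; simp [quadFamily, dotProduct, Fin.sum_univ_three]
  · by_cases hν : s 3 - s 0 + s 1 = 0
    · refine ⟨![1, -s 0, -(s 2 - s 0)], ![0, 1, 0], ?_, ?_, ?_⟩
      · simp [quadFamily, dotProduct, Fin.sum_univ_three]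
        intro h; apply hκ; linear_combination h - hν
      · simp [quadFamily, dotProduct, Fin.sum_univ_three]
      · intro j hj
        fin_cases j
        · left; simp [quadFamily, dotProduct, Fin.sum_univ_three]
        · right; simp [quadFamily, dotProduct, Fin.sum_univ_three]
        · left
          simp [quadFamily, dotProduct, Fin.sum_univ_three]
          ring
        · exact absurd rfl hj
    · refine ⟨![1, -s 0, -s 1], ![0, 1, -1], ?_, ?_, ?_⟩
      · simp [quadFamily, dotProduct, Fin.sum_univ_three]
        intro h; apply hν; linear_combination h
      · simp [quadFamily, dotProduct, Fin.sum_univ_three]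
      · intro j hj
        fin_cases j
        · left; simp [quadFamily, dotProduct, Fin.sum_univ_three]
        · left; simp [quadFamily, dotProduct, Fin.sum_univ_three]
        · right; simp [quadFamily, dotProduct, Fin.sum_univ_three]
        · exact absurd rfl hj

lemma tripleFamily_separated (s : Fin 2 → ℂ) : SeparatedFamily (tripleFamily s) := by
  intro i
  fin_cases i
  · refine ⟨![0, 1, 0], ![0, 1, -1], ?_, ?_, ?_⟩
    · simp [tripleFamily, dotProduct, Fin.sum_univ_three]
    · simp [tripleFamily, dotProduct, Fin.sum_univ_three]
    · intro j hj
      fin_cases j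
      · exact absurd rfl hj
      · left; simp [tripleFamily, dotProduct, Fin.sum_univ_three]
      · right; simp [tripleFamily, dotProduct, Fin.sum_univ_three]
  · refine ⟨![0, 0, 1], ![0, 1, -1], ?_, ?_, ?_⟩
    · simp [tripleFamily, dotProduct, Fin.sum_univ_three]
    · simp [tripleFamily, dotProduct, Fin.sum_univ_three]
    · intro j hj
      fin_cases j
      · left; simp [tripleFamily, dotProduct, Fin.sum_univ_three]
      · exact absurd rfl hj
      · right; simp [tripleFamily, dotProduct, Fin.sum_univ_three]
  · refine ⟨![0, 0, 1], ![0, 1, 0], ?_, ?_, ?_⟩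
    · simp [tripleFamily, dotProduct, Fin.sum_univ_three]
    · simp [tripleFamily, dotProduct, Fin.sum_univ_three]
    · intro j hj
      fin_cases j
      · left; simp [tripleFamily, dotProduct, Fin.sum_univ_three]
      · right; simp [tripleFamily, dotProduct, Fin.sum_univ_three]
      · exact absurd rfl hj

lemma quadFamily_apply_ne_zero (s s' : Fin 4 → ℂ) (i : Fin 4) {j : Fin 3} (hj : j ≠ 0) :
    quadFamily s i j = quadFamily s' i j := by
  fin_cases j
  · exact absurd rfl hj
  · fin_cases i <;> simp [quadFamily]
  · fin_cases i <;> simp [quadFamily]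

lemma tripleFamily_apply_ne_zero (s : Fin 2 → ℂ) (s' : Fin 4 → ℂ) (i : Fin 3) {j : Fin 3}
    (hj : j ≠ 0) : tripleFamily s i j = quadFamily s' i.castSucc j := by
  fin_cases j
  · exact absurd rfl hj
  · fin_cases i <;> simp [quadFamily, tripleFamily]
  · fin_cases i <;> simp [quadFamily, tripleFamily]

lemma vec_apply_ne_zero (x y : ℂ) {j : Fin 3} (hj : j ≠ 0) :
    ![x, 0, 0] j = ![y, 0, 0] j := by
  fin_cases j
  · exact absurd rfl hj
  · simp
  · simp

variable {m : ℕ}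

/-- Plane curves: among any three lines through `P` one is not badly tangent. -/
theorem genericForm_pencil_two (b : Module.Basis (Option (Fin 2)) ℂ (Fin m → ℂ)) {d : ℕ}
    (hd : 2 ≤ d) :
    GenericForm d (fun F : MvPolynomial (Fin m) ℂ => ∀ p : Fin 2 → ℂ,
      eval (chartPt b p) F ≠ 0 → ∀ y : Fin 3 → ℂ, Function.Injective y →
      ∃ i, ¬ BadRoots d (line (b (some 1) + y i • b (some 0)) (chartPt b p) F)) := by
  refine (genericForm_tangent b hd (I := Fin 3) (σ := Fin 3) (fun i => ![X i, 1])
    (by simp)).mono ?_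
  intro F hF hgen p hFP y hy
  have h1 : ∀ i, (fun j => eval y ((![X i, 1] : Fin 2 → MvPolynomial (Fin 3) ℂ) j)) =
      ![y i, 1] := by
    intro i; funext j; fin_cases j <;> simp
  obtain ⟨i, hi⟩ := hgen p y hFP (Eq.mpr (congrArg SeparatedFamily (funext h1))
    (separatedFamily_pencil hy))
  refine ⟨i, ?_⟩
  have h2 : ∑ j, eval y ((![X i, 1] : Fin 2 → MvPolynomial (Fin 3) ℂ) j) • b (some j) =
      b (some 1) + y i • b (some 0) := by
    rw [Fin.sum_univ_two]
    simp [add_comm]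
  rwa [h2] at hi

lemma sum_pencil {k : ℕ} (b : Module.Basis (Option (Fin k)) ℂ (Fin m → ℂ)) (o : Fin k)
    (w : Fin k → ℂ) : ∑ j, w j • b (some j) =
      ∑ j, (Function.update w o 0) j • b (some j) + w o • b (some o) := by
  have : w = Function.update w o 0 + Pi.single o (w o) := by
    funext j
    by_cases h : j = o
    · subst h; simp
    · simp [h]
  conv_lhs => rw [this]
  simp only [Pi.add_apply, add_smul, Finset.sum_add_distrib]
  congr 1
  rw [Finset.sum_eq_single o]
  · simp
  · intro j _ hj; simp [hj]
  · simp

/-- In higher dimension: in some pencil no line is badly tangent. -/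
theorem genericForm_pencil {r : ℕ} (b : Module.Basis (Option (Fin (3 + r))) ℂ (Fin m → ℂ)) {d : ℕ}
    (hd : 2 ≤ d) :
    GenericForm d (fun F : MvPolynomial (Fin m) ℂ => ∀ p : Fin (3 + r) → ℂ,
      eval (chartPt b p) F ≠ 0 → ∃ v : Fin (3 + r) → ℂ, v ≠ 0 ∧ v 0 = 0 ∧ ∀ s : ℂ,
        ¬ BadRoots d (line ((∑ j, v j • b (some j)) + s • b (some 0)) (chartPt b p) F)) := by
  have hB := genericForm_tangent b hd (I := Fin 4 ⊕ Fin r) (σ := Fin 4 ⊕ Fin r)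
    (extendFamily (quadFamily (fun i => X (Sum.inl i))) (fun i => X (Sum.inr i)))
    (by simp only [Fintype.card_sum, Fintype.card_fin]; omega)
  have hC := genericForm_tangent b hd (I := Fin 3 ⊕ Fin r) (σ := Fin 2 ⊕ Fin r)
    (extendFamily (tripleFamily (fun i => X (Sum.inl i))) (fun i => X (Sum.inr i)))
    (by simp only [Fintype.card_sum, Fintype.card_fin]; omega)
  refine (hB.and hC).mono ?_
  clear hB hC
  rintro F hF ⟨hB, hC⟩ p hFP
  by_contra! hall
  have evB : ∀ (y : Fin 4 ⊕ Fin r → ℂ) i, (fun j => eval y (extendFamily (quadFamily (fun i =>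
      (X (Sum.inl i) : MvPolynomial (Fin 4 ⊕ Fin r) ℂ))) (fun i => X (Sum.inr i)) i j)) =
      extendFamily (quadFamily (fun i => y (Sum.inl i))) (fun i => y (Sum.inr i)) i := by
    rintro y (i | i) <;> funext j <;> refine Fin.addCases (fun j => ?_) (fun j => ?_) j
    · fin_cases i <;> fin_cases j <;> simp [extendFamily, quadFamily]
    · simp [extendFamily]
    · fin_cases j <;> simp [extendFamily]
    · by_cases h : j = i
      · subst h; simp [extendFamily]
      · simp [extendFamily, h]
  have evC : ∀ (y : Fin 2 ⊕ Fin r → ℂ) i, (fun j => eval y (extendFamily (tripleFamily (fun i =>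
      (X (Sum.inl i) : MvPolynomial (Fin 2 ⊕ Fin r) ℂ))) (fun i => X (Sum.inr i)) i j)) =
      extendFamily (tripleFamily (fun i => y (Sum.inl i))) (fun i => y (Sum.inr i)) i := by
    rintro y (i | i) <;> funext j <;> refine Fin.addCases (fun j => ?_) (fun j => ?_) j
    · fin_cases i <;> fin_cases j <;> simp [extendFamily, tripleFamily]
    · simp [extendFamily]
    · fin_cases j <;> simp [extendFamily]
    · by_cases h : j = i
      · subst h; simp [extendFamily]
      · simp [extendFamily, h]
  let V : Fin 4 ⊕ Fin r → Fin (3 + r) → ℂ := extendFamily (quadFamily 0) 0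
  have hV0 : ∀ i, V i 0 = 0 := by
    have h0 : (0 : Fin (3 + r)) = Fin.castAdd r 0 := rfl
    rintro (i | i)
    · rw [h0]; fin_cases i <;> simp [V, extendFamily, quadFamily]
    · rw [h0]; simp [V, extendFamily]
  have hV : ∀ i, V i ≠ 0 := by
    have e1 : ∀ i, quadFamily (0 : Fin 4 → ℂ) i ≠ 0 := by
      intro i h
      have h1 := congrFun h 1
      have h2 := congrFun h 2
      fin_cases i <;> simp [quadFamily] at h1 h2
    rintro (i | i) h
    · refine e1 i ?_
      funext j
      simpa [V, extendFamily] using congrFun h (Fin.castAdd r j)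
    · simpa [V, extendFamily] using congrFun h (Fin.natAdd 3 i)
  choose s hs using fun i => hall (V i) (hV i) (hV0 i)
  have hupd : ∀ (w : Fin (3 + r) → ℂ) i, (∀ j, j ≠ 0 → w j = V i j) → w 0 = s i →
      BadRoots d (line (∑ j, w j • b (some j)) (chartPt b p) F) := by
    intro w i h1 h2
    rw [sum_pencil b 0 w, h2]
    have : Function.update w 0 0 = V i := by
      funext j
      by_cases hj : j = 0
      · subst hj; simp [hV0]
      · simp [hj, h1]
    rw [this]
    exact hs i
  have h0 : (0 : Fin (3 + r)) = Fin.castAdd r 0 := rfl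
  have hcast : ∀ j : Fin 3, Fin.castAdd r j ≠ 0 → j ≠ 0 := by
    rintro j h rfl; exact h rfl
  by_cases hκ : s (Sum.inl 2) = s (Sum.inl 0) + s (Sum.inl 1)
  · let y : Fin 2 ⊕ Fin r → ℂ := Sum.elim ![s (Sum.inl 0), s (Sum.inl 1)] (fun i => s (Sum.inr i))
    obtain ⟨i, hi⟩ := hC p y hFP (Eq.mpr (congrArg SeparatedFamily (funext (evC y)))
      ((tripleFamily_separated _).extend _))
    refine hi ?_
    have e := evC y i
    let i' : Fin 4 ⊕ Fin r := Sum.map Fin.castSucc id i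
    refine hupd _ i' ?_ ?_
    · intro j hj
      rw [congrFun e j]
      revert hj
      refine Fin.addCases (fun j hj => ?_) (fun j hj => ?_) j
      · have := hcast j hj
        rcases i with i | i
        · simpa [i', V, extendFamily] using tripleFamily_apply_ne_zero _ _ i this
        · simpa [i', V, extendFamily] using vec_apply_ne_zero _ _ this
      · rcases i with i | i <;> simp [i', V, extendFamily]
    · rw [congrFun e 0, h0]
      rcases i with i | i
      · fin_cases i
        · simp [i', extendFamily, tripleFamily, y]
        · simp [i', extendFamily, tripleFamily, y]
        · simpa [i', extendFamily, tripleFamily, y] using hκ.symm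
      · simp [i', extendFamily, y]
  · obtain ⟨i, hi⟩ := hB p s hFP (Eq.mpr (congrArg SeparatedFamily (funext (evB s)))
      ((quadFamily_separated (s := fun i => s (Sum.inl i)) hκ).extend _))
    refine hi ?_
    have e := evB s i
    refine hupd _ i ?_ ?_
    · intro j hj
      rw [congrFun e j]
      revert hj
      refine Fin.addCases (fun j hj => ?_) (fun j hj => ?_) j
      · have := hcast j hj
        rcases i with i | i
        · simpa [V, extendFamily] using quadFamily_apply_ne_zero _ _ i this
        · simpa [V, extendFamily] using vec_apply_ne_zero _ _ this
      · rcases i with i | i <;> simp [V, extendFamily]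
    · rw [congrFun e 0, h0]
      rcases i with i | i
      · fin_cases i <;> simp [extendFamily, quadFamily]
      · simp [extendFamily]

end Pencils

section Smoothness

open MvPolynomial

variable {m : ℕ}

lemma aeval_mul_of_isHomogeneous {R : Type*} [CommRing R] [Algebra ℂ R] {e : ℕ}
    {p : MvPolynomial (Fin m) ℂ} (hp : p.IsHomogeneous e) (a : R) (x : Fin m → R) :
    aeval (fun i => a * x i) p = a ^ e * aeval x p := by
  rw [aeval_def, aeval_def, eval₂_eq', eval₂_eq', Finset.mul_sum]
  refine Finset.sum_congr rfl fun s hs => ?_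
  have hs' : ∑ i, s i = e := by
    rw [← hp (mem_support_iff.1 hs), ← Finsupp.degree_eq_sum, Finsupp.degree_eq_weight_one]
    rfl
  simp only [mul_pow, Finset.prod_mul_distrib, Finset.prod_pow_eq_pow_sum, hs']
  ring

lemma genericForm_smooth_chart {d : ℕ} (hd : 1 ≤ d) (c : Fin m) :
    GenericForm d (fun F : MvPolynomial (Fin m) ℂ =>
      ∀ x : Fin m → ℂ, x c = 1 → ∃ i, eval x (pderiv i F) ≠ 0) := by
  classical
  let τ : Type := {i : Fin m // i ≠ c}
  let xm : Fin m → MvPolynomial τ ℂ := fun j => if h : j = c then 1 else X ⟨j, h⟩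
  let Λ : Fin m → MvPolynomial (Fin m) ℂ →ₗ[ℂ] MvPolynomial τ ℂ := fun i =>
    (aeval xm).toLinearMap.comp (pderiv i).toLinearMap
  have hcard : Fintype.card τ < Fintype.card (Fin m) := Fintype.card_subtype_lt (x := c) (by simp)
  refine (genericForm_not_solvable (d := d) hcard Λ).mono ?_
  intro F hF hgen x hx
  let θ : τ → ℂ := fun i => x i
  have hev : ∀ i G, eval θ (Λ i G) = eval x (pderiv i G) := by
    intro i G
    have h1 : Λ i G = aeval xm (pderiv i G) := rfl
    have h2 : (aeval θ).comp (aeval xm) = aeval x := by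
      apply MvPolynomial.algHom_ext
      intro j
      by_cases h : j = c
      · subst h; simp [xm, hx]
      · simp [xm, h, θ]
    rw [h1]
    exact congrArg (fun f => f (pderiv i G)) h2
  by_contra! hall
  refine hgen θ ?_ fun i => by rw [hev, hall]
  intro r
  have hd0 : (d : ℂ) ≠ 0 := by exact_mod_cast (by omega : d ≠ 0)
  have hpow : ∀ i, eval x (pderiv i (X c ^ d : MvPolynomial (Fin m) ℂ)) =
      if i = c then (d : ℂ) else 0 := by
    intro i
    rw [pderiv_pow, pderiv_X]
    by_cases h : i = c
    · subst h; simp [hx]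
    · simp [h]
  by_cases hr : r = c
  · subst hr
    refine ⟨X r ^ d, isHomogeneous_X_pow r d, ?_, ?_⟩
    · rw [hev, hpow, if_pos rfl]; exact hd0
    · intro r' h; rw [hev, hpow, if_neg h]
  · have hG : ∀ i, eval x (pderiv i (X r * X c ^ (d - 1) : MvPolynomial (Fin m) ℂ)) =
        if i = r then 1 else if i = c then (d - 1 : ℂ) * x r else 0 := by
      intro i
      rw [pderiv_mul, pderiv_pow, pderiv_X, pderiv_X]
      by_cases h1 : i = r
      · subst h1
        simp [hr, hx]
      · by_cases h2 : i = c
        · subst h2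
          rw [Pi.single_eq_of_ne (Ne.symm h1), Pi.single_eq_same]
          simp [h1, hx, Nat.cast_sub hd, mul_comm]
        · simp [h1, h2]
    refine ⟨X r * X c ^ (d - 1) - C ((d - 1 : ℂ) * x r / d) * X c ^ d, ?_, ?_, ?_⟩
    · refine IsHomogeneous.sub ?_ ?_
      · have := (isHomogeneous_X ℂ r).mul (isHomogeneous_X_pow (R := ℂ) c (d - 1))
        rwa [show 1 + (d - 1) = d by omega] at this
      · have := (isHomogeneous_C (Fin m) ((d - 1 : ℂ) * x r / d)).mul
          (isHomogeneous_X_pow (R := ℂ) c d)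
        rwa [zero_add] at this
    · rw [hev, map_sub, map_sub, hG, pderiv_C_mul, map_mul, eval_C, hpow, if_pos rfl, if_neg hr]
      simp
    · intro r' h
      rw [hev, map_sub, map_sub, hG, pderiv_C_mul, map_mul, eval_C, hpow, if_neg h]
      by_cases h2 : r' = c
      · simp [h2]
        field_simp
        ring
      · simp [h2]

/-- A generic form has no singular points. -/
theorem genericForm_smooth {d : ℕ} (hd : 1 ≤ d) :
    GenericForm d (fun F : MvPolynomial (Fin m) ℂ =>
      ∀ x : Fin m → ℂ, x ≠ 0 → ∃ i, eval x (pderiv i F) ≠ 0) := by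
  refine (GenericForm.forall_finite fun c => genericForm_smooth_chart hd c).mono ?_
  intro F hF h x hx
  obtain ⟨c, hc⟩ : ∃ c, x c ≠ 0 := by
    by_contra! h0; exact hx (funext h0)
  obtain ⟨i, hi⟩ := h c ((x c)⁻¹ • x) (by simp [hc])
  refine ⟨i, fun h0 => hi ?_⟩
  have hp := aeval_mul_of_isHomogeneous (hF.pderiv (i := i)) (x c)⁻¹ x
  rw [aeval_eq_eval, aeval_eq_eval] at hp
  exact hp.trans (by rw [h0, mul_zero])

end Smoothness

section GenericLine

open MvPolynomial

variable {m : ℕ}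

/-- The polynomial `G(Q + tP)` in `t`, with coefficients in `ℂ[Q]`. -/
noncomputable def genericLine (P : Fin m → ℂ) :
    MvPolynomial (Fin m) ℂ →ₐ[ℂ] Polynomial (MvPolynomial (Fin m) ℂ) :=
  line (fun i => X i) (fun i => C (P i))

lemma genericLine_X (P : Fin m → ℂ) (i : Fin m) :
    genericLine P (X i) = Polynomial.C (X i) + Polynomial.C (C (P i)) * Polynomial.X :=
  line_X _ _ _

/-- The ideal generated by the partial derivatives of a form. -/
noncomputable def jacobianIdeal (F : MvPolynomial (Fin m) ℂ) : Ideal (MvPolynomial (Fin m) ℂ) :=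
  Ideal.span (Set.range fun i => pderiv i F)

lemma exists_X_pow_mem_jacobianIdeal {F : MvPolynomial (Fin m) ℂ}
    (hF : ∀ x : Fin m → ℂ, x ≠ 0 → ∃ i, eval x (pderiv i F) ≠ 0) (i : Fin m) :
    ∃ N, (X i : MvPolynomial (Fin m) ℂ) ^ N ∈ jacobianIdeal F := by
  have h : (X i : MvPolynomial (Fin m) ℂ) ∈ (jacobianIdeal F).radical := by
    rw [← vanishingIdeal_zeroLocus_eq_radical (K := ℂ), mem_vanishingIdeal_iff]
    intro x hx
    have hx0 : x = 0 := by
      by_contra h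
      obtain ⟨j, hj⟩ := hF x h
      exact hj (hx _ (Ideal.subset_span ⟨j, rfl⟩))
    simp [hx0]
  exact h

/-- The linear forms `Pⱼ Qᵢ - Pᵢ Qⱼ` vanishing at `P`. -/
noncomputable def minorForm (P : Fin m → ℂ) (i j : Fin m) : MvPolynomial (Fin m) ℂ :=
  C (P j) * X i - C (P i) * X j

lemma exists_minorForm_pow_mem {F : MvPolynomial (Fin m) ℂ}
    (hF : ∀ x : Fin m → ℂ, x ≠ 0 → ∃ i, eval x (pderiv i F) ≠ 0) (P : Fin m → ℂ) (i j : Fin m) :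
    ∃ N, Polynomial.C (minorForm P i j ^ N) ∈ (jacobianIdeal F).map (genericLine P) := by
  have key : ∀ l, genericLine P (X l) ∈ ((jacobianIdeal F).map (genericLine P)).radical := by
    intro l
    obtain ⟨N, hN⟩ := exists_X_pow_mem_jacobianIdeal hF l
    refine ⟨N, ?_⟩
    rw [← map_pow]
    exact Ideal.mem_map_of_mem _ hN
  have h1 : Polynomial.C (minorForm P i j) =
      Polynomial.C (C (P j)) * genericLine P (X i) -
        Polynomial.C (C (P i)) * genericLine P (X j) := by
    rw [genericLine_X, genericLine_X, minorForm]
    simp only [Polynomial.C_sub, Polynomial.C_mul]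
    ring
  have h2 : Polynomial.C (minorForm P i j) ∈
      ((jacobianIdeal F).map (genericLine P)).radical := by
    rw [h1]
    exact sub_mem (Ideal.mul_mem_left _ _ (key i)) (Ideal.mul_mem_left _ _ (key j))
  obtain ⟨N, hN⟩ := h2
  refine ⟨N, ?_⟩
  rw [Polynomial.C_pow]
  exact hN

lemma prime_minorForm {P : Fin m → ℂ} {i j : Fin m} (hij : i ≠ j) (hj : P j ≠ 0) :
    Prime (minorForm P i j) := by
  classical
  let φ : MvPolynomial (Fin m) ℂ →ₐ[ℂ] MvPolynomial (Fin m) ℂ :=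
    aeval fun l => if l = i then minorForm P i j else X l
  let ψ : MvPolynomial (Fin m) ℂ →ₐ[ℂ] MvPolynomial (Fin m) ℂ :=
    aeval fun l => if l = i then C (P j)⁻¹ * (X i + C (P i) * X j) else X l
  have h1 : (C (P j) * C (P j)⁻¹ : MvPolynomial (Fin m) ℂ) = 1 := by
    rw [← C_mul, mul_inv_cancel₀ hj, C_1]
  have hC : ∀ (χ : MvPolynomial (Fin m) ℂ →ₐ[ℂ] MvPolynomial (Fin m) ℂ) a, χ (C a) = C a := by
    intro χ a
    rw [← MvPolynomial.algebraMap_eq, AlgHom.commutes]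
  have e1 : φ.comp ψ = AlgHom.id ℂ _ := by
    apply MvPolynomial.algHom_ext
    intro l
    by_cases hl : l = i
    · subst hl
      have : ψ (X l) = C (P j)⁻¹ * (X l + C (P l) * X j) := by simp [ψ]
      rw [AlgHom.comp_apply, this, map_mul, map_add, map_mul, hC, hC]
      have h2 : φ (X l) = minorForm P l j := by simp [φ]
      have h3 : φ (X j) = X j := by simp [φ, Ne.symm hij]
      rw [h2, h3, minorForm, AlgHom.id_apply]
      linear_combination X l * h1
    · simp [φ, ψ, hl]
  have e2 : ψ.comp φ = AlgHom.id ℂ _ := by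
    apply MvPolynomial.algHom_ext
    intro l
    by_cases hl : l = i
    · subst hl
      have : φ (X l) = minorForm P l j := by simp [φ]
      rw [AlgHom.comp_apply, this, minorForm, map_sub, map_mul, map_mul, hC, hC]
      have h2 : ψ (X l) = C (P j)⁻¹ * (X l + C (P l) * X j) := by simp [ψ]
      have h3 : ψ (X j) = X j := by simp [ψ, Ne.symm hij]
      rw [h2, h3, AlgHom.id_apply]
      linear_combination (X l + C (P l) * X j) * h1
    · simp [φ, ψ, hl]
  have h := (MulEquiv.prime_iff (AlgEquiv.ofAlgHom φ ψ e1 e2).toMulEquiv).2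
    (X_prime (R := ℂ) (i := i))
  have h2 : φ (X i) = minorForm P i j := by simp [φ]
  rw [← h2]
  exact h

/-- For a smooth form in at least three variables, the ideal generated by the partial derivatives
along a generic line contains two coprime constants. -/
lemma exists_isRelPrime_mem {F : MvPolynomial (Fin m) ℂ}
    (hF : ∀ x : Fin m → ℂ, x ≠ 0 → ∃ i, eval x (pderiv i F) ≠ 0) (hm : 3 ≤ m) {P : Fin m → ℂ}
    (hP : P ≠ 0) :
    ∃ a b : MvPolynomial (Fin m) ℂ, a ≠ 0 ∧ IsRelPrime a b ∧
      Polynomial.C a ∈ (jacobianIdeal F).map (genericLine P) ∧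
      Polynomial.C b ∈ (jacobianIdeal F).map (genericLine P) := by
  classical
  obtain ⟨c, hc⟩ : ∃ c, P c ≠ 0 := by
    by_contra! h; exact hP (funext h)
  obtain ⟨i, hi⟩ : ∃ i, i ∉ ({c} : Finset (Fin m)) := by
    by_contra! h
    have := Finset.card_le_card (fun x _ => h x : Finset.univ ⊆ _)
    simp at this
    omega
  obtain ⟨j, hj⟩ : ∃ j, j ∉ ({c, i} : Finset (Fin m)) := by
    by_contra! h
    have := (Finset.card_le_card (fun x _ => h x : Finset.univ ⊆ _)).trans Finset.card_le_two
    simp at this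
    omega
  simp only [Finset.mem_singleton, Finset.mem_insert, not_or] at hi hj
  obtain ⟨M, hM⟩ := exists_minorForm_pow_mem hF P i c
  obtain ⟨N, hN⟩ := exists_minorForm_pow_mem hF P j c
  have hp := prime_minorForm hi hc
  refine ⟨_, _, pow_ne_zero _ hp.ne_zero, ?_, hM, hN⟩
  refine IsRelPrime.pow ?_
  refine (hp.irreducible.isRelPrime_iff_not_dvd).2 ?_
  rintro ⟨u, hu⟩
  have := congrArg (eval (Pi.single j 1)) hu
  simp [minorForm, Ne.symm hj.1, Ne.symm hj.2, hc] at this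

/-- If the generic line polynomial factors, the derivatives lie in the ideal of the factors. -/
lemma map_jacobianIdeal_le {F : MvPolynomial (Fin m) ℂ} {P : Fin m → ℂ}
    {G H : Polynomial (MvPolynomial (Fin m) ℂ)} (h : genericLine P F = G * H) :
    (jacobianIdeal F).map (genericLine P) ≤ Ideal.span {G, H} := by
  classical
  rw [jacobianIdeal, Ideal.map_span, Ideal.span_le]
  rintro _ ⟨_, ⟨i, rfl⟩, rfl⟩
  let e : Fin m → MvPolynomial (Fin m) ℂ := Pi.single i 1
  let τ₀ : MvPolynomial (Fin m) ℂ →ₐ[ℂ] Polynomial (Polynomial (MvPolynomial (Fin m) ℂ)) :=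
    line (fun j => Polynomial.C (X j)) (fun j => Polynomial.C (e j))
  let τ : Polynomial (MvPolynomial (Fin m) ℂ) →+* Polynomial (Polynomial (MvPolynomial (Fin m) ℂ)) :=
    Polynomial.eval₂RingHom (R := MvPolynomial (Fin m) ℂ)
      (S := Polynomial (Polynomial (MvPolynomial (Fin m) ℂ))) τ₀.toRingHom (Polynomial.C Polynomial.X)
  let κ : MvPolynomial (Fin m) ℂ →ₐ[ℂ] Polynomial (Polynomial (MvPolynomial (Fin m) ℂ)) :=
    line (fun j => genericLine P (X j)) (fun j => Polynomial.C (e j))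
  have hC : ∀ c : ℂ, τ₀ (C c) = Polynomial.C (Polynomial.C (C c)) := by
    intro c
    rw [← MvPolynomial.algebraMap_eq, AlgHom.commutes]
    rfl
  have hκ : ∀ G, κ G = τ (genericLine P G) := by
    have : κ.toRingHom = τ.comp (genericLine P).toRingHom := by
      apply MvPolynomial.ringHom_ext
      · intro c
        have h1 : genericLine P (C c) = Polynomial.C (C c) := by
          rw [← MvPolynomial.algebraMap_eq, AlgHom.commutes]; rfl
        have h2 : κ (C c) = Polynomial.C (Polynomial.C (C c)) := by
          rw [← MvPolynomial.algebraMap_eq, AlgHom.commutes]; rfl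
        have h3 : τ (genericLine P (C c)) = τ₀ (C c) := by
          rw [h1]; exact Polynomial.eval₂_C _ _
        exact h2.trans (h3.trans (hC c)).symm
      · intro j
        have h1 : κ (X j) = Polynomial.C (genericLine P (X j)) +
          Polynomial.C (Polynomial.C (e j)) * Polynomial.X := line_X _ _ _
        have h2 : τ (genericLine P (X j)) =
            τ₀ (X j) + τ₀ (C (P j)) * Polynomial.C Polynomial.X := by
          rw [genericLine_X, map_add, map_mul]
          congr 1
          · exact Polynomial.eval₂_C _ _
          · congr 1
            · exact Polynomial.eval₂_C _ _
            · exact Polynomial.eval₂_X _ _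
        have h3 : τ₀ (X j) = Polynomial.C (Polynomial.C (X j)) +
          Polynomial.C (Polynomial.C (e j)) * Polynomial.X := line_X _ _ _
        refine h1.trans (Eq.trans ?_ h2.symm)
        rw [h3, hC, genericLine_X]
        simp only [map_add, map_mul]
        ring
    intro G
    exact congrArg (fun f => f G) this
  have h0 : ∀ G, (τ G).coeff 0 = G := by
    intro G
    have : (Polynomial.evalRingHom 0).comp τ = RingHom.id (Polynomial (MvPolynomial (Fin m) ℂ)) := by
      apply Polynomial.ringHom_ext
      · intro a
        have h1 : τ (Polynomial.C a) = τ₀ a := Polynomial.eval₂_C _ _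
        rw [RingHom.comp_apply, h1, RingHom.id_apply, Polynomial.coe_evalRingHom]
        have h2 : (τ₀ a).eval 0 = aeval (fun i => Polynomial.C (X i) + 0 * Polynomial.C (e i)) a :=
          line_eval _ _ _ _
        rw [h2]
        simp only [zero_mul, add_zero]
        have h3 : (aeval fun i => Polynomial.C (X i : MvPolynomial (Fin m) ℂ)) =
            (IsScalarTower.toAlgHom ℂ (MvPolynomial (Fin m) ℂ) (Polynomial (MvPolynomial (Fin m) ℂ))) := by
          apply MvPolynomial.algHom_ext
          intro j
          simp
        rw [h3]
        rfl
      · have h1 : τ Polynomial.X = Polynomial.C Polynomial.X := Polynomial.eval₂_X _ _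
        rw [RingHom.comp_apply, h1, Polynomial.coe_evalRingHom, Polynomial.eval_C]
        rfl
    rw [Polynomial.coeff_zero_eq_eval_zero]
    exact congrArg (fun f => f G) this
  have h1 : (κ F).coeff 1 = genericLine P (pderiv i F) := by
    have h2 : (κ F).coeff 1 = ∑ j, Polynomial.C (e j) *
      aeval (fun j => genericLine P (X j)) (pderiv j F) := line_coeff_one _ _ _
    have h3 : aeval (fun j => genericLine P (X j)) = genericLine P := by
      apply MvPolynomial.algHom_ext
      intro j
      simp
    rw [h2, Finset.sum_eq_single i, h3]
    · simp [e]
    · intro j _ hj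
      simp [e, hj]
    · simp
  rw [← h1, hκ, h, map_mul, Polynomial.mul_coeff_one, h0, h0]
  refine add_mem ?_ ?_
  · exact Ideal.mul_mem_right _ _ (Ideal.subset_span (by simp))
  · exact Ideal.mul_mem_left _ _ (Ideal.subset_span (by simp))

end GenericLine

section Irreducibility

open Polynomial

lemma Polynomial.C_dvd_of_C_dvd_mul_monic {A : Type*} [CommRing A] {G p : A[X]} (hG : G.Monic)
    {a : A} (h : C a ∣ p * G) : C a ∣ p := by
  have key : ∀ r : A[X], C a ∣ r ↔ r.map (Ideal.Quotient.mk (Ideal.span {a})) = 0 := by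
    intro r
    rw [C_dvd_iff_dvd_coeff, Polynomial.ext_iff]
    refine forall_congr' fun i => ?_
    rw [coeff_map, coeff_zero, Ideal.Quotient.eq_zero_iff_mem, Ideal.mem_span_singleton]
  rw [key] at h ⊢
  rw [Polynomial.map_mul] at h
  exact ((hG.map _).mul_left_eq_zero_iff).1 h

/-- Multiplication by coprime constants is a regular sequence modulo a monic polynomial. -/
lemma Polynomial.C_dvd_modByMonic {A : Type*} [CommRing A] [IsDomain A]
    [UniqueFactorizationMonoid A] {G p q : A[X]} (hG : G.Monic) {a b : A} (hab : IsRelPrime a b)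
    (h : G ∣ C b * p - C a * q) : C a ∣ p %ₘ G := by
  have h1 : C b * (p %ₘ G) = C a * (q %ₘ G) := by
    have h2 := (modByMonic_eq_zero_iff_dvd hG).2 h
    rw [sub_modByMonic, ← smul_eq_C_mul, ← smul_eq_C_mul, smul_modByMonic, smul_modByMonic,
      sub_eq_zero] at h2
    rw [← smul_eq_C_mul, ← smul_eq_C_mul, h2]
  rw [C_dvd_iff_dvd_coeff]
  intro i
  have h3 := congrArg (fun r => r.coeff i) h1
  simp only [coeff_C_mul] at h3
  exact hab.dvd_of_dvd_mul_left ⟨_, h3⟩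

/-- If the ideal generated by two monic polynomials contains two coprime constants, then it is the
unit ideal. -/
lemma Polynomial.isCoprime_of_isRelPrime_mem {A : Type*} [CommRing A] [IsDomain A]
    [UniqueFactorizationMonoid A] {G H : A[X]} (hG : G.Monic) {a b : A}
    (ha : a ≠ 0) (hab : IsRelPrime a b) (hGa : C a ∈ Ideal.span {G, H})
    (hGb : C b ∈ Ideal.span {G, H}) : IsCoprime G H := by
  obtain ⟨u, v, h1⟩ := Ideal.mem_span_pair.1 hGa
  obtain ⟨u', v', h2⟩ := Ideal.mem_span_pair.1 hGb
  have h3 : G ∣ (C b * v - C a * v') * H :=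
    ⟨C a * u' - C b * u, by linear_combination (-C a) * h2 + C b * h1⟩
  have h4 : G ∣ C b * v - C a * v' := by
    have hinj := IsFractionRing.injective A (FractionRing A)
    rw [← map_dvd_map (algebraMap A (FractionRing A)) hinj hG] at h3 ⊢
    rw [Polynomial.map_mul] at h3
    refine IsCoprime.dvd_of_dvd_mul_right ?_ h3
    have h5 := congrArg (Polynomial.map (algebraMap A (FractionRing A))) h1
    rw [Polynomial.map_add, Polynomial.map_mul, Polynomial.map_mul, map_C] at h5
    have h6 : algebraMap A (FractionRing A) a ≠ 0 := by
      rwa [Ne, IsFractionRing.to_map_eq_zero_iff]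
    refine ⟨C (algebraMap A (FractionRing A) a)⁻¹ * u.map (algebraMap A (FractionRing A)),
      C (algebraMap A (FractionRing A) a)⁻¹ * v.map (algebraMap A (FractionRing A)), ?_⟩
    rw [mul_assoc, mul_assoc, ← mul_add, h5, ← C_mul, inv_mul_cancel₀ h6, C_1]
  obtain ⟨w, hw⟩ := C_dvd_modByMonic hG hab h4
  have h5 := modByMonic_add_div v G
  have h6 : C a ∣ (u + (v /ₘ G) * H) * G :=
    ⟨1 - w * H, by linear_combination h1 + H * h5 - H * hw⟩
  obtain ⟨z, hz⟩ := C_dvd_of_C_dvd_mul_monic hG h6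
  refine ⟨z, w, ?_⟩
  have h7 : C a ≠ 0 := by rwa [Ne, C_eq_zero]
  refine mul_left_cancel₀ h7 ?_
  linear_combination (-G) * hz + h1 + H * h5 - H * hw

variable {m : ℕ}

lemma genericLine_monic {d : ℕ} {F : MvPolynomial (Fin m) ℂ} (hF : F.IsHomogeneous d)
    {P : Fin m → ℂ} (hP : MvPolynomial.eval P F = 1) :
    (genericLine P F).Monic ∧ (genericLine P F).natDegree = d := by
  have h1 : (genericLine P F).coeff d = 1 := by
    refine (line_coeff_top hF _ _).trans ?_
    have : MvPolynomial.aeval (fun i => (MvPolynomial.C (P i) : MvPolynomial (Fin m) ℂ)) =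
        (Algebra.ofId ℂ _).comp (MvPolynomial.aeval P) := by
      apply MvPolynomial.algHom_ext
      intro i
      simp [Algebra.ofId_apply, MvPolynomial.algebraMap_eq]
    rw [this, AlgHom.comp_apply, MvPolynomial.aeval_eq_eval, hP, map_one]
  have h2 : (genericLine P F).natDegree = d :=
    le_antisymm (line_natDegree_le hF _ _)
      (le_natDegree_of_ne_zero (by rw [h1]; exact one_ne_zero))
  exact ⟨by rw [Monic, leadingCoeff, h2, h1], h2⟩

/-- Specialization of the generic line polynomial at a point. -/
lemma genericLine_map (P x : Fin m → ℂ) (F : MvPolynomial (Fin m) ℂ) :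
    (genericLine P F).map (MvPolynomial.aeval x : _ →ₐ[ℂ] ℂ).toRingHom = line x P F := by
  refine (line_map _ _ _ _).trans ?_
  have h1 : (fun i => (MvPolynomial.aeval x : _ →ₐ[ℂ] ℂ) (MvPolynomial.X i)) = x := by
    funext i; simp
  have h2 : (fun i => (MvPolynomial.aeval x : _ →ₐ[ℂ] ℂ) (MvPolynomial.C (P i))) = P := by
    funext i; simp
  rw [h1, h2]

lemma line_zero_left {d : ℕ} {F : MvPolynomial (Fin m) ℂ} (hF : F.IsHomogeneous d)
    (P : Fin m → ℂ) : line 0 P F = C (MvPolynomial.eval P F) * X ^ d := by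
  have h : line P 0 F = C (MvPolynomial.eval P F) := by
    have : line P (0 : Fin m → ℂ) = (CAlgHom).comp (MvPolynomial.aeval P) := by
      apply MvPolynomial.algHom_ext
      intro i
      simp [line_X]
    rw [this, AlgHom.comp_apply, MvPolynomial.aeval_eq_eval]
    rfl
  ext j
  rw [coeff_C_mul_X_pow]
  by_cases hj : j ≤ d
  · have h1 := line_coeff_sub hF (0 : Fin m → ℂ) P (Nat.sub_le d j)
    rw [Nat.sub_sub_self hj, h, coeff_C] at h1
    rw [h1]
    split_ifs <;> first | rfl | omega
  · rw [if_neg (by omega)]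
    exact coeff_eq_zero_of_natDegree_lt (lt_of_le_of_lt (line_natDegree_le hF _ _) (by omega))

/-- The generic line polynomial of a smooth form in at least three variables is irreducible. -/
theorem genericLine_irreducible {d : ℕ} (hd : 1 ≤ d) {F : MvPolynomial (Fin m) ℂ}
    (hF : F.IsHomogeneous d)
    (hsm : ∀ x : Fin m → ℂ, x ≠ 0 → ∃ i, MvPolynomial.eval x (MvPolynomial.pderiv i F) ≠ 0)
    (hm : 3 ≤ m) {P : Fin m → ℂ} (hP : MvPolynomial.eval P F = 1) :
    Irreducible (genericLine P F) := by
  obtain ⟨hmon, hdeg⟩ := genericLine_monic hF hP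
  have hP0 : P ≠ 0 := by
    rintro rfl
    have h0 := aeval_mul_of_isHomogeneous hF (0 : ℂ) 0
    rw [zero_pow (by omega), zero_mul, MvPolynomial.aeval_eq_eval] at h0
    have : (fun i => (0 : ℂ) * (0 : Fin m → ℂ) i) = 0 := by funext i; simp
    rw [this, hP] at h0
    exact one_ne_zero h0
  obtain ⟨a, b, ha, hab, hJa, hJb⟩ := exists_isRelPrime_mem hsm hm hP0
  have hne : genericLine P F ≠ 1 := by
    intro h
    rw [h, natDegree_one] at hdeg
    omega
  refine (hmon.irreducible_iff_natDegree').2 ⟨hne, ?_⟩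
  intro G H hG hH hGH hmem
  rw [Finset.mem_Ioc] at hmem
  have hle := map_jacobianIdeal_le hGH.symm
  have hcop := isCoprime_of_isRelPrime_mem hG ha hab (hle hJa) (hle hJb)
  have hGH' := congrArg (Polynomial.map (MvPolynomial.aeval (0 : Fin m → ℂ) : _ →ₐ[ℂ] ℂ).toRingHom)
    hGH
  rw [Polynomial.map_mul, genericLine_map, line_zero_left hF, hP, C_1, one_mul] at hGH'
  have hcop' := hcop.map (Polynomial.mapRingHom
    (MvPolynomial.aeval (0 : Fin m → ℂ) : _ →ₐ[ℂ] ℂ).toRingHom)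
  rw [coe_mapRingHom] at hcop'
  have hX : ∀ G : (MvPolynomial (Fin m) ℂ)[X], G.Monic → 0 < G.natDegree →
      G.map (MvPolynomial.aeval (0 : Fin m → ℂ) : _ →ₐ[ℂ] ℂ).toRingHom ∣ X ^ d →
      X ∣ G.map (MvPolynomial.aeval (0 : Fin m → ℂ) : _ →ₐ[ℂ] ℂ).toRingHom := by
    intro G hG hpos hdvd
    obtain ⟨i, -, hi⟩ := (dvd_prime_pow prime_X d).1 hdvd
    have h1 := natDegree_eq_of_degree_eq (degree_eq_degree_of_associated hi)
    rw [hG.natDegree_map, natDegree_X_pow] at h1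
    exact (dvd_pow_self X (by omega)).trans hi.symm.dvd
  have hGdeg : G.natDegree + H.natDegree = d := by
    rw [← hG.natDegree_mul hH, hGH, hdeg]
  have h1 := hX G hG (by omega) ⟨_, hGH'.symm⟩
  have h2 := hX H hH (by omega) ⟨_, by rw [mul_comm]; exact hGH'.symm⟩
  exact not_isUnit_X (hcop'.isUnit_of_dvd' h1 h2)

end Irreducibility

section Derivative

open Polynomial

lemma dvd_of_aeval_eq_zero_of_irreducible {A L : Type*} [CommRing A] [IsDomain A]
    [IsIntegrallyClosed A] [Field L] [Algebra A L] [FaithfulSMul A L] {f : A[X]}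
    (hf : f.Monic) (hirr : Irreducible f) {α : L} (hα : aeval α f = 0) {p : A[X]}
    (hp : aeval α p = 0) : f ∣ p := by
  have hαA : IsIntegral A α := ⟨f, hf, hα⟩
  obtain ⟨w, hw⟩ := minpoly.isIntegrallyClosed_dvd hαA hα
  have hw' := (hirr.isUnit_or_isUnit hw).resolve_left (minpoly.not_isUnit A α)
  have h1 : f ∣ minpoly A α := by
    rw [hw]
    exact (associated_mul_unit_right _ _ hw').symm.dvd
  exact h1.trans (minpoly.isIntegrallyClosed_dvd hαA hp)

/-- The derivative of the minimal polynomial lies in the conductor of the order it generates. -/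
lemma exists_aeval_derivative_mul {A L : Type*} [CommRing A] [IsDomain A] [CharZero A]
    [IsIntegrallyClosed A] [Field L] [Algebra A L] [FaithfulSMul A L] {f : A[X]}
    (hf : f.Monic) (hirr : Irreducible f) {α : L} (hα : aeval α f = 0) {c : L}
    (hc : IsIntegral A c) {s t : A[X]} (ht : aeval α t ≠ 0) (hst : c * aeval α t = aeval α s) :
    ∃ p : A[X], aeval α (derivative f) * c = aeval α p := by
  let K := FractionRing A
  let _ : Algebra K L := FractionRing.liftAlgebra A L
  have hαA : IsIntegral A α := ⟨f, hf, hα⟩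
  have hαK : IsIntegral K α := hαA.tower_top
  let M := IntermediateField.adjoin K {α}
  have hfin : FiniteDimensional K M := IntermediateField.adjoin.finiteDimensional hαK
  have htower : IsScalarTower A M L := IsScalarTower.to₁₃₄ A K M L
  let x : M := IntermediateField.AdjoinSimple.gen K α
  have hx : Algebra.adjoin K {x} = ⊤ :=
    (IntermediateField.adjoin.powerBasis hαK).adjoin_gen_eq_top
  have hxα : algebraMap M L x = α := IntermediateField.AdjoinSimple.algebraMap_gen K α
  have hmapL : ∀ r : A[X], aeval α r = algebraMap M L (aeval x r) := by
    intro r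
    rw [← hxα, aeval_algebraMap_apply]
  have hcM : c ∈ M := by
    have h1 : c = aeval α s / aeval α t := by rw [eq_div_iff ht, hst]
    rw [h1]
    have h2 : ∀ r : A[X], aeval α r ∈ M := fun r => by rw [hmapL]; exact (aeval x r).2
    exact div_mem (h2 s) (h2 t)
  let c' : M := ⟨c, hcM⟩
  have hinj : Function.Injective (algebraMap M L) := (algebraMap M L).injective
  have hc' : IsIntegral A c' := (isIntegral_algebraMap_iff hinj).1 hc
  have hxA : IsIntegral A x := (isIntegral_algebraMap_iff hinj).1 (by rw [hxα]; exact hαA)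
  have hmin : minpoly K x = f.map (algebraMap A K) := by
    refine (minpoly.eq_of_irreducible_of_monic
      (hf.irreducible_iff_irreducible_map_fraction_map.1 hirr) ?_ (hf.map _)).symm
    rw [aeval_map_algebraMap]
    apply hinj
    rw [← hmapL, hα, map_zero]
  have hmem : c' ∈ (Algebra.traceForm K M).dualSubmodule
      (Subalgebra.toSubmodule (Algebra.adjoin A {x})) := by
    rw [LinearMap.BilinForm.mem_dualSubmodule]
    intro y hy
    have hyint : IsIntegral A y := by
      have := Algebra.IsIntegral.adjoin (R := A) (S := {x})
        (by rintro z hz; rw [Set.mem_singleton_iff.1 hz]; exact hxA)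
      have h2 := this.isIntegral ⟨y, hy⟩
      exact h2.map (Algebra.adjoin A {x}).val
    rw [Submodule.mem_one, Algebra.traceForm_apply]
    exact IsIntegrallyClosed.isIntegral_iff.1 (Algebra.isIntegral_trace (hc'.mul hyint))
  rw [traceForm_dualSubmodule_adjoin A K hx hxA, hmin] at hmem
  obtain ⟨y, hy, hyc⟩ := hmem
  have hy' : y ∈ Algebra.adjoin A {x} := hy
  rw [Algebra.adjoin_singleton_eq_range_aeval] at hy'
  obtain ⟨p, rfl⟩ := hy'
  refine ⟨p, ?_⟩
  have hne : aeval x (derivative (f.map (algebraMap A K))) ≠ 0 := by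
    rw [← hmin]
    exact (Algebra.IsSeparable.isSeparable K x).aeval_derivative_ne_zero (minpoly.aeval _ _)
  have h3 : aeval x (derivative f) * c' = aeval x p := by
    have h4 : (aeval x (derivative (f.map (algebraMap A K))))⁻¹ * aeval x p = c' := hyc
    rw [← h4, derivative_map, aeval_map_algebraMap, mul_inv_cancel_left₀]
    rwa [derivative_map, aeval_map_algebraMap] at hne
  have h5 := congrArg (algebraMap M L) h3
  rw [map_mul, ← hmapL, ← hmapL] at h5
  exact h5

end Derivative

section Normality

open Polynomial

variable {m : ℕ} {L : Type*} [Field L] [Algebra ℂ L]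

/-- Evaluation of a polynomial over `ℂ[Q]` at `Q = q`, `t = α`. -/
noncomputable def coordEval (q : Fin m → L) (α : L) : (MvPolynomial (Fin m) ℂ)[X] →+* L :=
  eval₂RingHom (MvPolynomial.aeval q : MvPolynomial (Fin m) ℂ →ₐ[ℂ] L).toRingHom α

lemma coordEval_C (q : Fin m → L) (α : L) (G : MvPolynomial (Fin m) ℂ) :
    coordEval q α (C G) = MvPolynomial.aeval q G := eval₂_C _ _

lemma coordEval_X (q : Fin m → L) (α : L) : coordEval q α X = α := eval₂_X _ _

lemma coordEval_genericLine (q : Fin m → L) (α : L) (P : Fin m → ℂ)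
    (G : MvPolynomial (Fin m) ℂ) :
    coordEval q α (genericLine P G) =
      MvPolynomial.aeval (fun i => q i + algebraMap ℂ L (P i) * α) G := by
  have : (coordEval q α).comp (genericLine P).toRingHom =
      (MvPolynomial.aeval fun i => q i + algebraMap ℂ L (P i) * α :
        MvPolynomial (Fin m) ℂ →ₐ[ℂ] L).toRingHom := by
    apply MvPolynomial.ringHom_ext
    · intro a
      have h1 : genericLine P (MvPolynomial.C a) = C (MvPolynomial.C a) := by
        rw [← MvPolynomial.algebraMap_eq, AlgHom.commutes]; rfl
      have h2 : coordEval q α (genericLine P (MvPolynomial.C a)) = algebraMap ℂ L a := by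
        rw [h1, coordEval_C, ← MvPolynomial.algebraMap_eq, AlgHom.commutes]
      refine h2.trans ?_
      have := (MvPolynomial.aeval fun i => q i + algebraMap ℂ L (P i) * α :
        MvPolynomial (Fin m) ℂ →ₐ[ℂ] L).commutes a
      exact this.symm
    · intro i
      have h2 : coordEval q α (genericLine P (MvPolynomial.X i)) =
          q i + algebraMap ℂ L (P i) * α := by
        rw [genericLine_X, map_add, map_mul, coordEval_C, coordEval_C, coordEval_X,
          MvPolynomial.aeval_X, ← MvPolynomial.algebraMap_eq, AlgHom.commutes]
      refine h2.trans ?_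
      exact (MvPolynomial.aeval_X (R := ℂ) (fun i => q i + algebraMap ℂ L (P i) * α) i).symm
  exact congrArg (fun f => f G) this

/-- The substitution `Q ↦ Q + t v` on `ℂ[Q][t]`. -/
noncomputable def shear (v : Fin m → ℂ) :
    (MvPolynomial (Fin m) ℂ)[X] →+* (MvPolynomial (Fin m) ℂ)[X] :=
  eval₂RingHom (R := MvPolynomial (Fin m) ℂ) (S := (MvPolynomial (Fin m) ℂ)[X])
    (genericLine v).toRingHom X

lemma shear_C (v : Fin m → ℂ) (G : MvPolynomial (Fin m) ℂ) : shear v (C G) = genericLine v G :=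
  eval₂_C _ _

lemma shear_X (v : Fin m → ℂ) : shear v (X : (MvPolynomial (Fin m) ℂ)[X]) = X := eval₂_X _ _

lemma shear_genericLine (v P : Fin m → ℂ) (G : MvPolynomial (Fin m) ℂ) :
    shear v (genericLine P G) = genericLine (v + P) G := by
  have hC : ∀ (v : Fin m → ℂ) a, genericLine v (MvPolynomial.C a) = C (MvPolynomial.C a) := by
    intro v a
    rw [← MvPolynomial.algebraMap_eq, AlgHom.commutes]; rfl
  have : (shear v).comp (genericLine P).toRingHom = (genericLine (v + P)).toRingHom := by
    apply MvPolynomial.ringHom_ext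
    · intro a
      have h2 : shear v (genericLine P (MvPolynomial.C a)) = C (MvPolynomial.C a) := by
        rw [hC, shear_C, hC]
      exact h2.trans (hC _ a).symm
    · intro i
      have h2 : shear v (genericLine P (MvPolynomial.X i)) =
          genericLine (v + P) (MvPolynomial.X i) := by
        rw [genericLine_X, map_add, map_mul, shear_C, shear_C, shear_X, genericLine_X,
          genericLine_X, hC, Pi.add_apply, map_add, map_add]
        ring
      exact h2
  exact congrArg (fun f => f G) this

lemma coordEval_shear (q : Fin m → L) (α : L) (v : Fin m → ℂ) (p : (MvPolynomial (Fin m) ℂ)[X]) :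
    coordEval q α (shear v p) = coordEval (fun i => q i + algebraMap ℂ L (v i) * α) α p := by
  have : (coordEval q α).comp (shear v) =
      coordEval (fun i => q i + algebraMap ℂ L (v i) * α) α := by
    apply Polynomial.ringHom_ext
    · intro G
      rw [RingHom.comp_apply, shear_C, coordEval_genericLine, coordEval_C]
    · rw [RingHom.comp_apply, shear_X, coordEval_X, coordEval_X]
  exact congrArg (fun f => f p) this

lemma shear_shear (v : Fin m → ℂ) (p : (MvPolynomial (Fin m) ℂ)[X]) :
    shear v (shear (-v) p) = p := by
  have : (shear v).comp (shear (-v)) = RingHom.id (MvPolynomial (Fin m) ℂ)[X] := by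
    apply Polynomial.ringHom_ext
    · intro G
      rw [RingHom.comp_apply, shear_C, shear_genericLine, add_neg_cancel, RingHom.id_apply]
      have h : (genericLine (0 : Fin m → ℂ)).toRingHom = C := by
        apply MvPolynomial.ringHom_ext
        · intro a
          have h1 : genericLine (0 : Fin m → ℂ) (MvPolynomial.C a) = C (MvPolynomial.C a) := by
            rw [← MvPolynomial.algebraMap_eq, AlgHom.commutes]; rfl
          exact h1
        · intro i
          have h1 : genericLine (0 : Fin m → ℂ) (MvPolynomial.X i) = C (MvPolynomial.X i) := by
            rw [genericLine_X]; simp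
          exact h1
      exact congrArg (fun f => f G) h
    · rw [RingHom.comp_apply, shear_X, shear_X, RingHom.id_apply]
  exact congrArg (fun f => f p) this

/-- Elements killed by evaluation at a point of the hypersurface are multiples of the equation. -/
lemma genericLine_dvd_of_coordEval_eq_zero {d : ℕ} (hd : 1 ≤ d) {F : MvPolynomial (Fin m) ℂ}
    (hF : F.IsHomogeneous d)
    (hsm : ∀ x : Fin m → ℂ, x ≠ 0 → ∃ i, MvPolynomial.eval x (MvPolynomial.pderiv i F) ≠ 0)
    (hm : 3 ≤ m) {P : Fin m → ℂ} (hP : MvPolynomial.eval P F = 1) {q : Fin m → L}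
    (hq : Function.Injective (MvPolynomial.aeval q : MvPolynomial (Fin m) ℂ →ₐ[ℂ] L)) {α : L}
    (hα : coordEval q α (genericLine P F) = 0) {p : (MvPolynomial (Fin m) ℂ)[X]}
    (hp : coordEval q α p = 0) : genericLine P F ∣ p := by
  have hirr := genericLine_irreducible hd hF hsm hm hP
  have hmon := (genericLine_monic hF hP).1
  let _ : Algebra (MvPolynomial (Fin m) ℂ) L :=
    (MvPolynomial.aeval q : MvPolynomial (Fin m) ℂ →ₐ[ℂ] L).toRingHom.toAlgebra
  have hfs : FaithfulSMul (MvPolynomial (Fin m) ℂ) L :=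
    (faithfulSMul_iff_algebraMap_injective _ _).2 hq
  exact dvd_of_aeval_eq_zero_of_irreducible hmon hirr hα hp

lemma aeval_injective_shear {d : ℕ} (hd : 1 ≤ d) {F : MvPolynomial (Fin m) ℂ}
    (hF : F.IsHomogeneous d)
    (hsm : ∀ x : Fin m → ℂ, x ≠ 0 → ∃ i, MvPolynomial.eval x (MvPolynomial.pderiv i F) ≠ 0)
    (hm : 3 ≤ m) {v P : Fin m → ℂ} (hP : MvPolynomial.eval P F = 1)
    (hvP : MvPolynomial.eval (v + P) F = 1) {q : Fin m → L}
    (hq : Function.Injective (MvPolynomial.aeval q : MvPolynomial (Fin m) ℂ →ₐ[ℂ] L)) {α : L}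
    (hα : coordEval q α (genericLine (v + P) F) = 0) :
    Function.Injective (MvPolynomial.aeval (fun i => q i + algebraMap ℂ L (v i) * α) :
      MvPolynomial (Fin m) ℂ →ₐ[ℂ] L) := by
  rw [injective_iff_map_eq_zero]
  intro G hG
  rw [← coordEval_C _ α, ← coordEval_shear] at hG
  have h1 := map_dvd (shear (-v))
    (genericLine_dvd_of_coordEval_eq_zero hd hF hsm hm hvP hq hα hG)
  have h2 := shear_shear (-v) (C G)
  rw [neg_neg] at h2
  rw [h2, shear_genericLine, neg_add_cancel_left] at h1
  obtain ⟨hmon, hdeg⟩ := genericLine_monic hF hP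
  by_contra hG0
  have h3 := natDegree_le_of_dvd h1 (C_ne_zero.2 hG0)
  rw [natDegree_C, hdeg] at h3
  omega

lemma exists_coordEval_derivative_mul {d : ℕ} (hd : 1 ≤ d) {F : MvPolynomial (Fin m) ℂ}
    (hF : F.IsHomogeneous d)
    (hsm : ∀ x : Fin m → ℂ, x ≠ 0 → ∃ i, MvPolynomial.eval x (MvPolynomial.pderiv i F) ≠ 0)
    (hm : 3 ≤ m) {P : Fin m → ℂ} (hP : MvPolynomial.eval P F = 1) {q : Fin m → L}
    (hq : Function.Injective (MvPolynomial.aeval q : MvPolynomial (Fin m) ℂ →ₐ[ℂ] L)) {α : L}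
    (hα : coordEval q α (genericLine P F) = 0) {c : L}
    (hc : IsIntegral (coordEval q α).range c) {s t : (MvPolynomial (Fin m) ℂ)[X]}
    (ht : coordEval q α t ≠ 0) (hst : c * coordEval q α t = coordEval q α s) :
    ∃ p, coordEval q α (derivative (genericLine P F)) * c = coordEval q α p := by
  have hirr := genericLine_irreducible hd hF hsm hm hP
  have hmon := (genericLine_monic hF hP).1
  let _ : Algebra (MvPolynomial (Fin m) ℂ) L :=
    (MvPolynomial.aeval q : MvPolynomial (Fin m) ℂ →ₐ[ℂ] L).toRingHom.toAlgebra
  have hfs : FaithfulSMul (MvPolynomial (Fin m) ℂ) L :=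
    (faithfulSMul_iff_algebraMap_injective _ _).2 hq
  have hαA : IsIntegral (MvPolynomial (Fin m) ℂ) α := ⟨_, hmon, hα⟩
  have hadj : Algebra.IsIntegral (MvPolynomial (Fin m) ℂ)
      (Algebra.adjoin (MvPolynomial (Fin m) ℂ) {α}) :=
    Algebra.IsIntegral.adjoin
      (by rintro z hz; rw [Set.mem_singleton_iff.1 hz]; exact hαA)
  have hcA : IsIntegral (MvPolynomial (Fin m) ℂ) c := by
    obtain ⟨r, hr, hrc⟩ := hc
    have hle : ∀ x : (coordEval q α).range,
        (coordEval q α).range.subtype x ∈ Algebra.adjoin (MvPolynomial (Fin m) ℂ) {α} := by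
      rintro ⟨x, p, rfl⟩
      rw [Algebra.adjoin_singleton_eq_range_aeval]
      exact ⟨p, rfl⟩
    have h1 : IsIntegral (Algebra.adjoin (MvPolynomial (Fin m) ℂ) {α}) c :=
      ⟨r.map ((coordEval q α).range.subtype.codRestrict _ hle), hr.map _, by
        rw [eval₂_map]; exact hrc⟩
    exact isIntegral_trans c h1
  exact exists_aeval_derivative_mul hmon hirr hα hcA ht hst

/-- The coordinate ring of the cone over a smooth hypersurface, in the form `ℂ[Q][α]`, is
integrally closed. -/
theorem exists_coordEval_eq_of_isIntegral {d : ℕ} (hd : 1 ≤ d) {F : MvPolynomial (Fin m) ℂ}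
    (hF : F.IsHomogeneous d)
    (hsm : ∀ x : Fin m → ℂ, x ≠ 0 → ∃ i, MvPolynomial.eval x (MvPolynomial.pderiv i F) ≠ 0)
    (hm : 3 ≤ m) {P : Fin m → ℂ} (hP : MvPolynomial.eval P F = 1) {q : Fin m → L}
    (hq : Function.Injective (MvPolynomial.aeval q : MvPolynomial (Fin m) ℂ →ₐ[ℂ] L)) {α : L}
    (hα : coordEval q α (genericLine P F) = 0) {c : L}
    (hc : IsIntegral (coordEval q α).range c) {s t : (MvPolynomial (Fin m) ℂ)[X]}
    (ht : coordEval q α t ≠ 0) (hst : c * coordEval q α t = coordEval q α s) :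
    ∃ p, c = coordEval q α p := by
  classical
  let x : Fin m → L := fun i => q i + algebraMap ℂ L (P i) * α
  have hx : ∀ G, coordEval q α (genericLine P G) = MvPolynomial.aeval x G :=
    fun G => coordEval_genericLine _ _ _ _
  -- The directional derivatives lie in the conductor.
  have hdir : ∀ P' : Fin m → ℂ, MvPolynomial.eval P' F = 1 →
      (∑ i, algebraMap ℂ L (P' i) * MvPolynomial.aeval x (MvPolynomial.pderiv i F)) * c ∈
        (coordEval q α).range := by
    intro P' hP'
    let v := P - P'
    have hv : v + P' = P := sub_add_cancel _ _
    let q' : Fin m → L := fun i => q i + algebraMap ℂ L (v i) * α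
    have hq' : Function.Injective (MvPolynomial.aeval q' : MvPolynomial (Fin m) ℂ →ₐ[ℂ] L) :=
      aeval_injective_shear hd hF hsm hm hP' (by rw [hv]; exact hP) hq (by rw [hv]; exact hα)
    have hsh : ∀ p, coordEval q α (shear v p) = coordEval q' α p := coordEval_shear q α v
    have hsh' : ∀ p, coordEval q α p = coordEval q' α (shear (-v) p) := by
      intro p
      rw [← hsh, shear_shear]
    have hrange : (coordEval q' α).range = (coordEval q α).range := by
      apply le_antisymm
      · rintro _ ⟨p, rfl⟩; exact ⟨_, hsh p⟩
      · rintro _ ⟨p, rfl⟩; exact ⟨_, (hsh' p).symm⟩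
    have hx' : ∀ G, coordEval q' α (genericLine P' G) = MvPolynomial.aeval x G := by
      intro G
      rw [← hsh, shear_genericLine, hv, hx]
    obtain ⟨p, hp⟩ := exists_coordEval_derivative_mul hd hF hsm hm hP' hq'
      (by rw [hx', ← hx, hα]) (hrange ▸ hc) (t := shear (-v) t) (s := shear (-v) s)
      (by rwa [← hsh']) (by rw [← hsh', ← hsh', hst])
    rw [← hrange]
    refine ⟨p, ?_⟩
    have hder : derivative (genericLine P' F) =
        ∑ i, C (MvPolynomial.C (P' i)) * genericLine P' (MvPolynomial.pderiv i F) :=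
      line_derivative _ _ _
    rw [← hp, hder, map_sum]
    congr 1
    refine Finset.sum_congr rfl fun i _ => ?_
    rw [map_mul, coordEval_C, hx', ← MvPolynomial.algebraMap_eq, AlgHom.commutes]
  have hcst : ∀ a : ℂ, algebraMap ℂ L a ∈ (coordEval q α).range := fun a =>
    ⟨C (MvPolynomial.C a), by
      rw [coordEval_C, ← MvPolynomial.algebraMap_eq, AlgHom.commutes]⟩
  have hdir' : ∀ P' : Fin m → ℂ, MvPolynomial.eval P' F ≠ 0 →
      (∑ i, algebraMap ℂ L (P' i) * MvPolynomial.aeval x (MvPolynomial.pderiv i F)) * c ∈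
        (coordEval q α).range := by
    intro P' hP'
    obtain ⟨r, hr⟩ := IsAlgClosed.exists_pow_nat_eq (MvPolynomial.eval P' F) (by omega : 0 < d)
    have hr0 : r ≠ 0 := by rintro rfl; rw [zero_pow (by omega)] at hr; exact hP' hr.symm
    have h1 := hdir (fun i => r⁻¹ * P' i) (by
      have := aeval_mul_of_isHomogeneous hF r⁻¹ P'
      rw [MvPolynomial.aeval_eq_eval, MvPolynomial.aeval_eq_eval] at this
      rw [this, ← hr, inv_pow, inv_mul_cancel₀ (pow_ne_zero _ hr0)])
    have h2 := mul_mem (hcst r) h1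
    have h3 : algebraMap ℂ L r * algebraMap ℂ L r⁻¹ = 1 := by
      rw [← map_mul, mul_inv_cancel₀ hr0, map_one]
    convert h2 using 1
    rw [← mul_assoc, Finset.mul_sum]
    congr 1
    refine Finset.sum_congr rfl fun i _ => ?_
    rw [map_mul]
    linear_combination (-algebraMap ℂ L (P' i) *
      MvPolynomial.aeval x (MvPolynomial.pderiv i F)) * h3
  have hpar : ∀ i, MvPolynomial.aeval x (MvPolynomial.pderiv i F) * c ∈
      (coordEval q α).range := by
    intro i
    let e : Fin m → ℂ := Pi.single i 1
    obtain ⟨ε, hε0, hε⟩ : ∃ ε : ℂ, ε ≠ 0 ∧ MvPolynomial.eval (fun j => P j + ε * e j) F ≠ 0 := by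
      have hne : line P e F * X ≠ 0 := by
        refine mul_ne_zero ?_ X_ne_zero
        intro h0
        have := line_coeff_zero P e F
        rw [h0, coeff_zero, MvPolynomial.aeval_eq_eval, hP] at this
        exact zero_ne_one this
      obtain ⟨ε, hε⟩ := Polynomial.exists_eval_ne_zero_of_natDegree_lt_card _ hne
        (by simpa using Cardinal.natCast_lt_aleph0.trans_le (Cardinal.aleph0_le_mk ℂ))
      rw [eval_mul, eval_X, line_eval, MvPolynomial.aeval_eq_eval] at hε
      exact ⟨ε, right_ne_zero_of_mul hε, left_ne_zero_of_mul hε⟩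
    have h1 := sub_mem (hdir' _ hε) (hdir' P (by rw [hP]; exact one_ne_zero))
    have h2 := mul_mem (hcst ε⁻¹) h1
    have h3 : algebraMap ℂ L ε⁻¹ * algebraMap ℂ L ε = 1 := by
      rw [← map_mul, inv_mul_cancel₀ hε0, map_one]
    convert h2 using 1
    rw [← sub_mul, ← Finset.sum_sub_distrib, Finset.sum_eq_single i]
    · simp only [e, Pi.single_eq_same, mul_one, map_add]
      linear_combination (-MvPolynomial.aeval x (MvPolynomial.pderiv i F) * c) * h3
    · intro j _ hj
      simp [e, hj]
    · simp
  have hJ : ∀ p ∈ (jacobianIdeal F).map (genericLine P),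
      coordEval q α p * c ∈ (coordEval q α).range := by
    intro p hp
    rw [jacobianIdeal, Ideal.map_span] at hp
    induction hp using Submodule.span_induction with
    | mem p hp =>
      obtain ⟨_, ⟨i, rfl⟩, rfl⟩ := hp
      have : coordEval q α (genericLine P (MvPolynomial.pderiv i F)) * c ∈
        (coordEval q α).range := by rw [hx]; exact hpar i
      exact this
    | zero => rw [map_zero, zero_mul]; exact zero_mem _
    | add p r _ _ hp hr => rw [map_add, add_mul]; exact add_mem hp hr
    | smul a p _ hp =>
      rw [smul_eq_mul, map_mul, mul_assoc]
      exact mul_mem ⟨a, rfl⟩ hp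
  have hP0 : P ≠ 0 := by
    rintro rfl
    have h0 := aeval_mul_of_isHomogeneous hF (0 : ℂ) 0
    rw [zero_pow (by omega), zero_mul, MvPolynomial.aeval_eq_eval] at h0
    have : (fun i => (0 : ℂ) * (0 : Fin m → ℂ) i) = 0 := by funext i; simp
    rw [this, hP] at h0
    exact one_ne_zero h0
  obtain ⟨a, b, ha, hab, hJa, hJb⟩ := exists_isRelPrime_mem hsm hm hP0
  obtain ⟨pa, hpa⟩ := hJ _ hJa
  obtain ⟨pb, hpb⟩ := hJ _ hJb
  have hmon := (genericLine_monic hF hP).1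
  have hdvd : genericLine P F ∣ C b * pa - C a * pb := by
    refine genericLine_dvd_of_coordEval_eq_zero hd hF hsm hm hP hq hα ?_
    rw [map_sub, map_mul, map_mul, hpa, hpb]
    ring
  obtain ⟨w, hw⟩ := C_dvd_modByMonic hmon hab hdvd
  refine ⟨w, ?_⟩
  have h1 := congrArg (coordEval q α) (modByMonic_add_div pa (genericLine P F))
  rw [map_add, map_mul, hα, zero_mul, add_zero, hw, map_mul, hpa] at h1
  refine (mul_left_cancel₀ ?_ h1).symm
  rw [coordEval_C]
  exact (map_ne_zero_iff _ hq).2 ha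

end Normality

section Grading

open Polynomial

variable {m : ℕ} {E : Type*} [Field E] [Algebra ℂ E]

/-- The part of a polynomial in `ℂ[Q][t]` of total degree `N`. -/
noncomputable def totalComponent (N : ℕ) (p : (MvPolynomial (Fin m) ℂ)[X]) :
    (MvPolynomial (Fin m) ℂ)[X] :=
  ∑ i ∈ Finset.range (N + 1), monomial i (MvPolynomial.homogeneousComponent (N - i) (p.coeff i))

lemma totalComponent_coeff (N i : ℕ) (p : (MvPolynomial (Fin m) ℂ)[X]) (hi : i ≤ N) :
    (totalComponent N p).coeff i = MvPolynomial.homogeneousComponent (N - i) (p.coeff i) := by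
  rw [totalComponent, finsetSum_coeff]
  rw [Finset.sum_eq_single i]
  · rw [coeff_monomial, if_pos rfl]
  · intro j _ hj
    rw [coeff_monomial, if_neg hj]
  · intro h
    exact absurd (Finset.mem_range.2 (by omega)) h

lemma totalComponent_natDegree_lt {N d : ℕ} {p : (MvPolynomial (Fin m) ℂ)[X]}
    (hp : p.natDegree < d) : (totalComponent N p).natDegree < d := by
  refine lt_of_le_of_lt (natDegree_sum_le_of_forall_le _ _ (n := p.natDegree) ?_) hp
  intro i _
  rcases le_or_gt i p.natDegree with h | h
  · exact (natDegree_monomial_le _).trans h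
  · rw [coeff_eq_zero_of_natDegree_lt h, map_zero, monomial_zero_right]
    exact Nat.zero_le _

lemma coeff_aeval_X_mul_C (q : Fin m → E) (a : MvPolynomial (Fin m) ℂ) (N : ℕ) :
    (MvPolynomial.aeval (fun i => (X : E[X]) * C (q i)) a).coeff N =
      MvPolynomial.aeval q (MvPolynomial.homogeneousComponent N a) := by
  have hC : ∀ b : MvPolynomial (Fin m) ℂ,
      MvPolynomial.aeval (fun i => (C (q i) : E[X])) b = C (MvPolynomial.aeval q b) := by
    intro b
    have : (MvPolynomial.aeval (fun i => (C (q i) : E[X])) : MvPolynomial (Fin m) ℂ →ₐ[ℂ] E[X]) =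
        (CAlgHom : E →ₐ[ℂ] E[X]).comp (MvPolynomial.aeval q) := by
      apply MvPolynomial.algHom_ext
      intro i
      simp
    rw [this]; rfl
  have h1 : MvPolynomial.aeval (fun i => (X : E[X]) * C (q i)) a =
      ∑ s ∈ Finset.range (a.totalDegree + 1),
        X ^ s * C (MvPolynomial.aeval q (MvPolynomial.homogeneousComponent s a)) := by
    conv_lhs => rw [← MvPolynomial.sum_homogeneousComponent a, map_sum]
    refine Finset.sum_congr rfl fun s _ => ?_
    rw [aeval_mul_of_isHomogeneous (MvPolynomial.homogeneousComponent_isHomogeneous s a), hC]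
  rw [h1, finsetSum_coeff]
  have h2 : ∀ s, ((X : E[X]) ^ s *
      C (MvPolynomial.aeval q (MvPolynomial.homogeneousComponent s a))).coeff N =
      if N = s then MvPolynomial.aeval q (MvPolynomial.homogeneousComponent N a) else 0 := by
    intro s
    rw [X_pow_mul_C, coeff_C_mul_X_pow]
    split_ifs with h
    · rw [h]
    · rfl
  rw [Finset.sum_congr rfl fun s _ => h2 s, Finset.sum_ite_eq]
  split_ifs with h
  · rfl
  · rw [MvPolynomial.homogeneousComponent_eq_zero, map_zero]
    simp only [Finset.mem_range] at h
    omega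

/-- Evaluation at the generic multiple `(λ q, λ α)` of `(q, α)`. -/
noncomputable def scaledEval (q : Fin m → E) (α : E) : (MvPolynomial (Fin m) ℂ)[X] →+* E[X] :=
  eval₂RingHom (R := MvPolynomial (Fin m) ℂ) (S := E[X])
    (MvPolynomial.aeval (fun i => (X : E[X]) * C (q i)) :
      MvPolynomial (Fin m) ℂ →ₐ[ℂ] E[X]).toRingHom (X * C α)

lemma scaledEval_C (q : Fin m → E) (α : E) (G : MvPolynomial (Fin m) ℂ) :
    scaledEval q α (C G) = MvPolynomial.aeval (fun i => (X : E[X]) * C (q i)) G := eval₂_C _ _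

lemma scaledEval_X (q : Fin m → E) (α : E) : scaledEval q α X = X * C α := eval₂_X _ _

lemma scaledEval_genericLine (q : Fin m → E) (α : E) (P : Fin m → ℂ) {d : ℕ}
    {G : MvPolynomial (Fin m) ℂ} (hG : G.IsHomogeneous d) :
    scaledEval q α (genericLine P G) = X ^ d * C (coordEval q α (genericLine P G)) := by
  have h1 : scaledEval q α (genericLine P G) =
      MvPolynomial.aeval (fun i => (X : E[X]) * C (q i + algebraMap ℂ E (P i) * α)) G := by
    have : (scaledEval q α).comp (genericLine P).toRingHom =
        (MvPolynomial.aeval fun i => (X : E[X]) * C (q i + algebraMap ℂ E (P i) * α) :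
          MvPolynomial (Fin m) ℂ →ₐ[ℂ] E[X]).toRingHom := by
      apply MvPolynomial.ringHom_ext
      · intro a
        have h1 : genericLine P (MvPolynomial.C a) = C (MvPolynomial.C a) := by
          rw [← MvPolynomial.algebraMap_eq, AlgHom.commutes]; rfl
        have h2 : scaledEval q α (genericLine P (MvPolynomial.C a)) = algebraMap ℂ E[X] a := by
          rw [h1, scaledEval_C, ← MvPolynomial.algebraMap_eq, AlgHom.commutes]
        refine h2.trans ?_
        exact ((MvPolynomial.aeval fun i => (X : E[X]) * C (q i + algebraMap ℂ E (P i) * α) :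
          MvPolynomial (Fin m) ℂ →ₐ[ℂ] E[X]).commutes a).symm
      · intro i
        have h2 : scaledEval q α (genericLine P (MvPolynomial.X i)) =
            X * C (q i + algebraMap ℂ E (P i) * α) := by
          rw [genericLine_X, map_add, map_mul, scaledEval_C, scaledEval_C, scaledEval_X,
            MvPolynomial.aeval_X, ← MvPolynomial.algebraMap_eq, AlgHom.commutes,
            IsScalarTower.algebraMap_apply ℂ E E[X], algebraMap_eq, C_add, C_mul]
          ring
        refine h2.trans ?_
        exact (MvPolynomial.aeval_X (R := ℂ)
          (fun i => (X : E[X]) * C (q i + algebraMap ℂ E (P i) * α)) i).symm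
    exact congrArg (fun f => f G) this
  rw [h1, aeval_mul_of_isHomogeneous hG, coordEval_genericLine]
  congr 1
  exact MvPolynomial.aeval_algebraMap_apply E[X] (fun i => q i + algebraMap ℂ E (P i) * α) G

lemma scaledEval_coeff (q : Fin m → E) (α : E) (p : (MvPolynomial (Fin m) ℂ)[X]) (N : ℕ) :
    (scaledEval q α p).coeff N = coordEval q α (totalComponent N p) := by
  have h1 : scaledEval q α p = ∑ i ∈ Finset.range (p.natDegree + 1),
      MvPolynomial.aeval (fun i => (X : E[X]) * C (q i)) (p.coeff i) * (X * C α) ^ i := by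
    conv_lhs => rw [p.as_sum_range_C_mul_X_pow, map_sum]
    refine Finset.sum_congr rfl fun i _ => ?_
    rw [map_mul, map_pow, scaledEval_C, scaledEval_X]
  have h2 : ∀ i, (MvPolynomial.aeval (fun i => (X : E[X]) * C (q i)) (p.coeff i) *
      (X * C α) ^ i).coeff N = if i ≤ N then MvPolynomial.aeval q
        (MvPolynomial.homogeneousComponent (N - i) (p.coeff i)) * α ^ i else 0 := by
    intro i
    rw [mul_pow, ← C_pow, ← mul_assoc, coeff_mul_C, coeff_mul_X_pow']
    split_ifs with h
    · rw [coeff_aeval_X_mul_C]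
    · rw [zero_mul]
  have h3 : coordEval q α (totalComponent N p) = ∑ i ∈ Finset.range (N + 1),
      MvPolynomial.aeval q (MvPolynomial.homogeneousComponent (N - i) (p.coeff i)) * α ^ i := by
    rw [totalComponent, map_sum]
    refine Finset.sum_congr rfl fun i _ => ?_
    rw [← C_mul_X_pow_eq_monomial, map_mul, map_pow, coordEval_C, coordEval_X]
  rw [h1, h3, finsetSum_coeff, Finset.sum_congr rfl fun i _ => h2 i, ← Finset.sum_filter]
  apply Finset.sum_subset_zero_on_sdiff
  · intro i hi
    simp only [Finset.mem_filter, Finset.mem_range] at hi ⊢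
    omega
  · intro i hi
    simp only [Finset.mem_sdiff, Finset.mem_filter, Finset.mem_range] at hi
    rw [coeff_eq_zero_of_natDegree_lt (by omega), map_zero, map_zero, zero_mul]
  · intro i _
    rfl

/-- An element of `ℂ[Q][α]` that is homogeneous of degree `j` is a polynomial of degree at most
`j` in `α`. -/
lemma natDegree_le_of_scaledEval_eq {d : ℕ} (hd : 1 ≤ d) {F : MvPolynomial (Fin m) ℂ}
    (hF : F.IsHomogeneous d)
    (hsm : ∀ x : Fin m → ℂ, x ≠ 0 → ∃ i, MvPolynomial.eval x (MvPolynomial.pderiv i F) ≠ 0)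
    (hm : 3 ≤ m) {P : Fin m → ℂ} (hP : MvPolynomial.eval P F = 1) {q : Fin m → E}
    (hq : Function.Injective (MvPolynomial.aeval q : MvPolynomial (Fin m) ℂ →ₐ[ℂ] E)) {α : E}
    (hα : coordEval q α (genericLine P F) = 0) {p : (MvPolynomial (Fin m) ℂ)[X]}
    (hp : p.natDegree < d) {j : ℕ} {c : E} (h : scaledEval q α p = C c * X ^ j) :
    p.natDegree ≤ j := by
  rw [natDegree_le_iff_coeff_eq_zero]
  intro i hi
  have key : ∀ s, MvPolynomial.homogeneousComponent s (p.coeff i) = 0 := by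
    intro s
    have h1 : coordEval q α (totalComponent (s + i) p) = 0 := by
      rw [← scaledEval_coeff, h, coeff_C_mul_X_pow, if_neg (by omega)]
    have h2 := genericLine_dvd_of_coordEval_eq_zero hd hF hsm hm hP hq hα h1
    have hmon := genericLine_monic hF hP
    have h3 : totalComponent (s + i) p = 0 := by
      apply eq_zero_of_dvd_of_natDegree_lt h2
      rw [hmon.2]
      exact totalComponent_natDegree_lt hp
    have h4 := totalComponent_coeff (s + i) i p (by omega)
    rw [h3, coeff_zero, Nat.add_sub_cancel] at h4
    exact h4.symm
  rw [← MvPolynomial.sum_homogeneousComponent (p.coeff i)]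
  exact Finset.sum_eq_zero fun s _ => key s

end Grading

section GradedFactors

open Polynomial

lemma coeff_eval₂_mapRingHom_algebraMap {E : Type*} [Field E] (w : E[X][X]) (N : ℕ) :
    (eval₂ (mapRingHom (algebraMap E (FractionRing E[X])))
      (X * C (algebraMap E[X] (FractionRing E[X]) X)) w).coeff N =
      algebraMap E[X] (FractionRing E[X])
        (∑ j ∈ Finset.range (N + 1), monomial j ((w.coeff j).coeff (N - j))) := by
  rw [eval₂_eq_sum_range, finsetSum_coeff, map_sum]
  have h2 : ∀ j, (mapRingHom (algebraMap E (FractionRing E[X])) (w.coeff j) *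
      (X * C (algebraMap E[X] (FractionRing E[X]) X)) ^ j).coeff N =
      if j ≤ N then algebraMap E[X] (FractionRing E[X])
        (monomial j ((w.coeff j).coeff (N - j))) else 0 := by
    intro j
    rw [mul_pow, ← C_pow, ← mul_assoc, coeff_mul_C, coeff_mul_X_pow']
    split_ifs with h
    · rw [coe_mapRingHom, coeff_map, ← C_mul_X_pow_eq_monomial, map_mul, map_pow,
        IsScalarTower.algebraMap_apply E E[X] (FractionRing E[X]), algebraMap_eq]
    · rw [zero_mul]
  rw [Finset.sum_congr rfl fun j _ => h2 j, ← Finset.sum_filter]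
  apply Finset.sum_subset_zero_on_sdiff
  · intro i hi
    simp only [Finset.mem_filter, Finset.mem_range] at hi ⊢
    omega
  · intro i hi
    simp only [Finset.mem_sdiff, Finset.mem_filter, Finset.mem_range] at hi
    rw [coeff_eq_zero_of_natDegree_lt (p := w) (by omega), coeff_zero, monomial_zero_right,
      map_zero]
  · intro i _
    rfl

variable {m : ℕ} {E : Type*} [Field E] [Algebra ℂ E]

/-- Monic factors of the generic restriction of `F` over `ℂ[Q][α]` are homogeneous. -/
lemma scaledEval_coeff_of_mul_eq {d k : ℕ} {F : MvPolynomial (Fin m) ℂ}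
    (hF : F.IsHomogeneous d) {P : Fin m → ℂ} {q : Fin m → E} {α : E}
    (hα : coordEval q α (genericLine P F) = 0) (hne : genericLine P F ≠ 0)
    (hker : ∀ p, coordEval q α p = 0 → genericLine P F ∣ p)
    (hq : Function.Injective (MvPolynomial.aeval q : MvPolynomial (Fin m) ℂ →ₐ[ℂ] E))
    {u v : (MvPolynomial (Fin m) ℂ)[X][X]} (hu : u.coeff k = 1)
    (huv : (u * v).map (coordEval q α) = (genericLine P F).map
      (MvPolynomial.aeval q : MvPolynomial (Fin m) ℂ →ₐ[ℂ] E).toRingHom)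
    {j : ℕ} (hj : j ≤ k) : ∃ c, scaledEval q α (u.coeff j) = C c * X ^ (k - j) := by
  let L := FractionRing E[X]
  let T : L := algebraMap E[X] L X
  let Γ₀ : E[X][X] →+* L[X] := eval₂RingHom (R := E[X]) (S := L[X])
    (mapRingHom (algebraMap E L)) (X * C T)
  let Γ : (MvPolynomial (Fin m) ℂ)[X][X] →+* L[X] := Γ₀.comp (mapRingHom (scaledEval q α))
  have hΓ₀C : ∀ r, Γ₀ (C r) = r.map (algebraMap E L) := fun r => eval₂_C _ _
  have hΓ₀X : Γ₀ X = X * C T := eval₂_X _ _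
  let q' : Fin m → L := fun i => algebraMap E L (q i)
  have hΓf : ∀ r : (MvPolynomial (Fin m) ℂ)[X], Γ (r.map C) = scaledEval q' T r := by
    intro r
    have : Γ.comp (mapRingHom C) = scaledEval q' T := by
      apply Polynomial.ringHom_ext
      · intro a
        have h1 : Γ ((C a : (MvPolynomial (Fin m) ℂ)[X]).map C) =
            (MvPolynomial.aeval (fun i => (X : E[X]) * C (q i)) a).map (algebraMap E L) := by
          have : Γ (C (C a)) = Γ₀ ((C (C a)).map (scaledEval q α)) := rfl
          rw [map_C, this, map_C, hΓ₀C, scaledEval_C]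
        refine h1.trans ?_
        rw [scaledEval_C]
        have h2 : (mapAlgHom (Algebra.ofId E L |>.restrictScalars ℂ)).comp
            (MvPolynomial.aeval (fun i => (X : E[X]) * C (q i)) :
              MvPolynomial (Fin m) ℂ →ₐ[ℂ] E[X]) =
            MvPolynomial.aeval (fun i => (X : L[X]) * C (q' i)) := by
          apply MvPolynomial.algHom_ext
          intro i
          rw [AlgHom.comp_apply, MvPolynomial.aeval_X, MvPolynomial.aeval_X]
          simp [q']
        exact congrArg (fun f => f a) h2
      · have h1 : Γ (X.map C) = X * C T := by
          have : Γ X = Γ₀ (X.map (scaledEval q α)) := rfl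
          rw [map_X, this, map_X, hΓ₀X]
        refine h1.trans ?_
        rw [scaledEval_X]
    exact congrArg (fun f => f r) this
  have hq' : Function.Injective (algebraMap E L) := (algebraMap E L).injective
  have hTf : coordEval q' T (genericLine P F) ≠ 0 := by
    have : coordEval q' T (genericLine P F) = algebraMap E[X] L ((genericLine P F).map
        (MvPolynomial.aeval q : MvPolynomial (Fin m) ℂ →ₐ[ℂ] E).toRingHom) := by
      have h : coordEval q' T = (algebraMap E[X] L).comp (mapRingHom
          (MvPolynomial.aeval q : MvPolynomial (Fin m) ℂ →ₐ[ℂ] E).toRingHom) := by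
        apply Polynomial.ringHom_ext
        · intro a
          rw [coordEval_C, RingHom.comp_apply, coe_mapRingHom, map_C, ← algebraMap_eq,
            ← IsScalarTower.algebraMap_apply]
          exact MvPolynomial.aeval_algebraMap_apply L q a
        · rw [coordEval_X, RingHom.comp_apply, coe_mapRingHom, map_X]
      rw [h]; rfl
    rw [this]
    intro h0
    have h1 := (IsFractionRing.injective E[X] L) (h0.trans (map_zero _).symm)
    exact hne ((map_injective _ hq) (h1.trans (Polynomial.map_zero _).symm))
  have hprod : Γ u * Γ v = X ^ d * C (coordEval q' T (genericLine P F)) := by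
    rw [← scaledEval_genericLine q' T P hF, ← hΓf, ← map_mul, ← sub_eq_zero, ← map_sub]
    have h0 : (u * v - (genericLine P F).map C).map (scaledEval q α) = 0 := by
      ext1 n
      rw [coeff_map, coeff_zero]
      have h1 : ((u * v - (genericLine P F).map C).map (coordEval q α)).coeff n = 0 := by
        rw [Polynomial.map_sub, huv, Polynomial.map_map, sub_eq_zero.2, coeff_zero]
        congr 1
        refine RingHom.ext fun a => ?_
        rw [RingHom.comp_apply, coordEval_C]; rfl
      rw [coeff_map] at h1
      obtain ⟨r, hr⟩ := hker _ h1
      rw [hr, map_mul, scaledEval_genericLine q α P hF, hα, C_0, mul_zero, zero_mul]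
    have : Γ (u * v - (genericLine P F).map C) =
      Γ₀ ((u * v - (genericLine P F).map C).map (scaledEval q α)) := rfl
    rw [this, h0, map_zero]
  have hdvd : Γ u ∣ X ^ d := by
    have h1 : IsUnit (C (coordEval q' T (genericLine P F))) := isUnit_C.2 hTf.isUnit
    exact h1.dvd_mul_right.1 ⟨Γ v, hprod.symm⟩
  obtain ⟨i, -, hi⟩ := (dvd_prime_pow prime_X d).1 hdvd
  obtain ⟨w, hw⟩ := hi.symm
  obtain ⟨w', -, hw'⟩ := isUnit_iff.1 w.isUnit
  have hzero : ∀ j s, j + s ≠ i → (scaledEval q α (u.coeff j)).coeff s = 0 := by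
    intro j s hjs
    have h1 : (Γ u).coeff (j + s) = 0 := by
      rw [← hw, ← hw', coeff_mul_C, coeff_X_pow, if_neg hjs, zero_mul]
    have h2 := (coeff_eval₂_mapRingHom_algebraMap (u.map (scaledEval q α)) (j + s)).symm.trans h1
    have h3 := (IsFractionRing.injective E[X] L) (h2.trans (map_zero _).symm)
    have h4 := congrArg (fun p => p.coeff j) h3
    simp only [coeff_zero, finsetSum_coeff, coeff_monomial] at h4
    rw [Finset.sum_ite_eq' , if_pos (Finset.mem_range.2 (by omega)), coeff_map,
      Nat.add_sub_cancel_left] at h4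
    exact h4
  have hik : k = i := by
    by_contra h
    have h1 := hzero k 0 h
    rw [hu, map_one, coeff_one_zero] at h1
    exact one_ne_zero h1
  refine ⟨(scaledEval q α (u.coeff j)).coeff (k - j), ?_⟩
  ext1 s
  rw [coeff_C_mul_X_pow]
  split_ifs with h
  · rw [h]
  · exact hzero j s (by omega)

end GradedFactors

section PrimitiveElements

open Polynomial

variable {m : ℕ} {E : Type*} [Field E] [Algebra (MvPolynomial (Fin m) ℂ) E]
  [Algebra (RatFuncField m) E] [IsScalarTower (MvPolynomial (Fin m) ℂ) (RatFuncField m) E]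

lemma algebraMap_injective_of_ratFuncField :
    Function.Injective (algebraMap (MvPolynomial (Fin m) ℂ) E) := by
  rw [IsScalarTower.algebraMap_eq _ (RatFuncField m) E, RingHom.coe_comp]
  exact (algebraMap (RatFuncField m) E).injective.comp
    (IsFractionRing.injective (MvPolynomial (Fin m) ℂ) (RatFuncField m))

lemma exists_aeval_mul_eq_of_stabilizer [FiniteDimensional (RatFuncField m) E]
    [IsGalois (RatFuncField m) E] {α c : E}
    (hc : ∀ σ : E ≃ₐ[RatFuncField m] E, σ α = α → σ c = c) :
    ∃ s t : (MvPolynomial (Fin m) ℂ)[X], aeval α t ≠ 0 ∧ c * aeval α t = aeval α s := by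
  have hmem : c ∈ IntermediateField.adjoin (RatFuncField m) {α} := by
    rw [← IsGalois.fixedField_fixingSubgroup (IntermediateField.adjoin (RatFuncField m) {α}),
      IntermediateField.mem_fixedField_iff]
    intro σ hσ
    refine hc σ ?_
    rw [IntermediateField.mem_fixingSubgroup_iff] at hσ
    exact hσ α (IntermediateField.mem_adjoin_simple_self _ α)
  rw [← IntermediateField.mem_toSubalgebra,
    IntermediateField.adjoin_simple_toSubalgebra_of_isAlgebraic
      (Algebra.IsAlgebraic.isAlgebraic α), Algebra.adjoin_singleton_eq_range_aeval] at hmem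
  obtain ⟨p, hp⟩ := hmem
  obtain ⟨b, hb, hbp⟩ := IsLocalization.integerNormalization_spec
    (nonZeroDivisors (MvPolynomial (Fin m) ℂ)) p
  refine ⟨IsLocalization.integerNormalization (nonZeroDivisors (MvPolynomial (Fin m) ℂ)) p, C b,
    ?_, ?_⟩
  · rw [aeval_C, IsScalarTower.algebraMap_apply _ (RatFuncField m) E]
    intro h
    have h1 := (algebraMap (RatFuncField m) E).injective (h.trans (map_zero _).symm)
    have h2 := IsFractionRing.injective (MvPolynomial (Fin m) ℂ) (RatFuncField m)
      (h1.trans (map_zero _).symm)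
    exact nonZeroDivisors.ne_zero hb h2
  · have h1 : aeval α (b • p) = algebraMap (MvPolynomial (Fin m) ℂ) E b * c := by
      rw [← algebraMap_smul (RatFuncField m) b p, map_smul, Algebra.smul_def,
        ← IsScalarTower.algebraMap_apply]
      exact congrArg _ hp
    rw [aeval_C, mul_comm, ← h1, ← hbp, aeval_map_algebraMap]

end PrimitiveElements

section Decomposition

open Polynomial

variable {m : ℕ} {E : Type*} [Field E] [Algebra ℂ E] [Algebra (MvPolynomial (Fin m) ℂ) E]
  [IsScalarTower ℂ (MvPolynomial (Fin m) ℂ) E]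

lemma aeval_algebraMap_X (a : MvPolynomial (Fin m) ℂ) :
    MvPolynomial.aeval (fun i => algebraMap (MvPolynomial (Fin m) ℂ) E (MvPolynomial.X i)) a =
      algebraMap (MvPolynomial (Fin m) ℂ) E a := by
  have : (MvPolynomial.aeval fun i =>
      algebraMap (MvPolynomial (Fin m) ℂ) E (MvPolynomial.X i)) =
      IsScalarTower.toAlgHom ℂ (MvPolynomial (Fin m) ℂ) E := by
    apply MvPolynomial.algHom_ext
    intro i
    rw [MvPolynomial.aeval_X]
    rfl
  rw [this]; rfl

lemma coordEval_algebraMap_X (α : E) (p : (MvPolynomial (Fin m) ℂ)[X]) :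
    coordEval (fun i => algebraMap (MvPolynomial (Fin m) ℂ) E (MvPolynomial.X i)) α p =
      aeval α p := by
  have : coordEval (fun i => algebraMap (MvPolynomial (Fin m) ℂ) E (MvPolynomial.X i)) α =
      (aeval α : (MvPolynomial (Fin m) ℂ)[X] →ₐ[MvPolynomial (Fin m) ℂ] E).toRingHom := by
    apply Polynomial.ringHom_ext
    · intro a
      rw [coordEval_C, aeval_algebraMap_X]
      exact (aeval_C α a).symm
    · rw [coordEval_X]
      exact (aeval_X α).symm
  rw [this]; rfl

variable [Algebra (RatFuncField m) E] [IsScalarTower (MvPolynomial (Fin m) ℂ) (RatFuncField m) E]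

lemma exists_aeval_eq_of_stabilizer [FiniteDimensional (RatFuncField m) E]
    [IsGalois (RatFuncField m) E] {d : ℕ} (hd : 1 ≤ d) {F : MvPolynomial (Fin m) ℂ}
    (hF : F.IsHomogeneous d)
    (hsm : ∀ x : Fin m → ℂ, x ≠ 0 → ∃ i, MvPolynomial.eval x (MvPolynomial.pderiv i F) ≠ 0)
    (hm : 3 ≤ m) {P : Fin m → ℂ} (hP : MvPolynomial.eval P F = 1) {α c : E}
    (hα : aeval α (genericLine P F) = 0) (hcA : IsIntegral (MvPolynomial (Fin m) ℂ) c)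
    (hc : ∀ σ : E ≃ₐ[RatFuncField m] E, σ α = α → σ c = c) :
    ∃ p : (MvPolynomial (Fin m) ℂ)[X], p.natDegree < d ∧ c = aeval α p := by
  obtain ⟨s, t, ht, hst⟩ := exists_aeval_mul_eq_of_stabilizer hc
  let q : Fin m → E := fun i => algebraMap (MvPolynomial (Fin m) ℂ) E (MvPolynomial.X i)
  have hco : ∀ p, coordEval q α p = aeval α p := fun p => coordEval_algebraMap_X α p
  have hq : Function.Injective (MvPolynomial.aeval q : MvPolynomial (Fin m) ℂ →ₐ[ℂ] E) := by
    intro a b hab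
    rw [aeval_algebraMap_X, aeval_algebraMap_X] at hab
    exact algebraMap_injective_of_ratFuncField hab
  have hcint : IsIntegral (coordEval q α).range c := by
    obtain ⟨r, hr, hrc⟩ := hcA
    let ψ : MvPolynomial (Fin m) ℂ →+* (coordEval q α).range :=
      (coordEval q α).rangeRestrict.comp C
    refine ⟨r.map ψ, hr.map _, ?_⟩
    rw [eval₂_map]
    have : (algebraMap (coordEval q α).range E).comp ψ = algebraMap (MvPolynomial (Fin m) ℂ) E := by
      refine RingHom.ext fun a => ?_
      exact (hco (C a)).trans (aeval_C _ _)
    rw [this]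
    exact hrc
  obtain ⟨p, hp⟩ := exists_coordEval_eq_of_isIntegral hd hF hsm hm hP hq ((hco _).trans hα) hcint
    (s := s) (t := t) (by rw [hco]; exact ht) (by rw [hco, hco]; exact hst)
  obtain ⟨hmon, hdeg⟩ := genericLine_monic hF hP
  refine ⟨p %ₘ genericLine P F, ?_, ?_⟩
  · rw [← hdeg]
    refine natDegree_modByMonic_lt _ hmon fun h => ?_
    rw [h, natDegree_one] at hdeg
    omega
  · rw [hp, hco]
    conv_lhs => rw [← modByMonic_add_div p (genericLine P F)]
    rw [map_add, map_mul, hα, zero_mul, add_zero]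

/-- A block of the Galois action on the roots of the generic restriction of `F` comes from a
decomposition of this polynomial. -/
theorem exists_comp_of_block [FiniteDimensional (RatFuncField m) E]
    [IsGalois (RatFuncField m) E] [DecidableEq E] {d : ℕ} (hd : 1 ≤ d)
    {F : MvPolynomial (Fin m) ℂ} (hF : F.IsHomogeneous d)
    (hsm : ∀ x : Fin m → ℂ, x ≠ 0 → ∃ i, MvPolynomial.eval x (MvPolynomial.pderiv i F) ≠ 0)
    (hm : 3 ≤ m) {P : Fin m → ℂ} (hP : MvPolynomial.eval P F = 1) {R B : Finset E}
    (hR : (genericLine P F).map (algebraMap (MvPolynomial (Fin m) ℂ) E) =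
      ∏ ρ ∈ R, (X - C ρ)) (hBR : B ⊆ R) {α : E} (hαB : α ∈ B)
    (hblock : ∀ σ : E ≃ₐ[RatFuncField m] E, σ α ∈ B → B.image σ = B) :
    ∃ g h : (MvPolynomial (Fin m) ℂ)[X], g.Monic ∧ h.Monic ∧ h.natDegree = B.card ∧
      g.natDegree * B.card = d ∧ genericLine P F = g.comp h := by
  obtain ⟨hmon, hdeg⟩ := genericLine_monic hF hP
  have hirr := genericLine_irreducible hd hF hsm hm hP
  have hinj := algebraMap_injective_of_ratFuncField (m := m) (E := E)
  have hfs : FaithfulSMul (MvPolynomial (Fin m) ℂ) E :=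
    (faithfulSMul_iff_algebraMap_injective _ _).2 hinj
  let q : Fin m → E := fun i => algebraMap (MvPolynomial (Fin m) ℂ) E (MvPolynomial.X i)
  have hco : ∀ p, coordEval q α p = aeval α p := fun p => coordEval_algebraMap_X α p
  have hq : Function.Injective (MvPolynomial.aeval q : MvPolynomial (Fin m) ℂ →ₐ[ℂ] E) := by
    intro a b hab
    rw [aeval_algebraMap_X, aeval_algebraMap_X] at hab
    exact hinj hab
  have hroot : ∀ ρ, aeval ρ (genericLine P F) = 0 ↔ ρ ∈ R := by
    intro ρ
    rw [aeval_def, ← eval_map, hR, eval_prod, Finset.prod_eq_zero_iff]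
    constructor
    · rintro ⟨a, ha, h⟩
      rw [eval_sub, eval_X, eval_C, sub_eq_zero] at h
      rwa [h]
    · intro h
      exact ⟨ρ, h, by rw [eval_sub, eval_X, eval_C, sub_self]⟩
  have hσ : ∀ (σ : E ≃ₐ[RatFuncField m] E) (x : E) (p : (MvPolynomial (Fin m) ℂ)[X]),
      σ (aeval x p) = aeval (σ x) p := by
    intro σ x p
    exact (aeval_algHom_apply (σ.toAlgHom.restrictScalars (MvPolynomial (Fin m) ℂ)) x p).symm
  have hσR : ∀ (σ : E ≃ₐ[RatFuncField m] E) ρ, ρ ∈ R → σ ρ ∈ R := by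
    intro σ ρ h
    rw [← hroot] at h ⊢
    rw [← hσ, h, map_zero]
  have hα := (hroot α).2 (hBR hαB)
  have hcardR : R.card = d := by
    have := congrArg natDegree hR
    rw [natDegree_map_eq_of_injective hinj, hdeg, natDegree_finsetProd_X_sub_C_eq_card] at this
    exact this.symm
  -- transitivity
  have htrans : ∀ ρ ∈ R, ∃ σ : E ≃ₐ[RatFuncField m] E, σ α = ρ := by
    intro ρ hρ
    refine minpoly.exists_algEquiv_of_root' (Algebra.IsAlgebraic.isAlgebraic (R := RatFuncField m) α) ?_
    rw [← minpoly.eq_of_irreducible_of_monic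
      (hmon.irreducible_iff_irreducible_map_fraction_map.1 hirr) (x := α) ?_ (hmon.map _),
      aeval_map_algebraMap, (hroot ρ).2 hρ]
    rw [aeval_map_algebraMap, hα]
  let H : E[X] := ∏ ρ ∈ B, (X - C ρ)
  let H' : E[X] := ∏ ρ ∈ R \ B, (X - C ρ)
  have hHmon : H.Monic := monic_prod_X_sub_C _ _
  have hH'mon : H'.Monic := monic_prod_X_sub_C _ _
  have hHdeg : H.natDegree = B.card :=
    natDegree_finsetProd_X_sub_C_eq_card B fun ρ => ρ
  have hHH' : H * H' = (genericLine P F).map (algebraMap (MvPolynomial (Fin m) ℂ) E) := by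
    rw [hR, mul_comm]
    exact Finset.prod_sdiff hBR
  have hmapprod : ∀ (σ : E ≃ₐ[RatFuncField m] E) (S : Finset E), S.image σ = S →
      (∏ ρ ∈ S, (X - C ρ)).map (σ : E →+* E) = ∏ ρ ∈ S, (X - C ρ) := by
    intro σ S hS
    rw [Polynomial.map_prod]
    conv_rhs => rw [← hS, Finset.prod_image σ.injective.injOn]
    refine Finset.prod_congr rfl fun ρ _ => ?_
    simp
  have hHσ : ∀ σ : E ≃ₐ[RatFuncField m] E, σ α ∈ B → H.map (σ : E →+* E) = H :=
    fun σ h => hmapprod σ B (hblock σ h)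
  have hH'σ : ∀ σ : E ≃ₐ[RatFuncField m] E, σ α ∈ B → H'.map (σ : E →+* E) = H' := by
    intro σ h
    apply hmapprod
    rw [Finset.image_sdiff _ _ σ.injective, hblock σ h]
    congr 1
    exact Finset.eq_of_subset_of_card_le (Finset.image_subset_iff.2 (hσR σ))
      (Finset.card_image_of_injective _ σ.injective).ge
  -- lifting the coefficients
  have hlift : ∀ G : E[X], G.Monic →
      G ∣ (genericLine P F).map (algebraMap (MvPolynomial (Fin m) ℂ) E) →
      (∀ σ : E ≃ₐ[RatFuncField m] E, σ α ∈ B → G.map (σ : E →+* E) = G) → ∀ j,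
      ∃ p : (MvPolynomial (Fin m) ℂ)[X], p.natDegree < d ∧ G.coeff j = aeval α p := by
    intro G hG hGd hGσ j
    refine exists_aeval_eq_of_stabilizer hd hF hsm hm hP hα
      (isIntegral_coeff_of_dvd _ G hmon hG hGd j) fun σ h => ?_
    have h1 := congrArg (fun p => p.coeff j) (hGσ σ (by rw [h]; exact hαB))
    simp only [coeff_map] at h1
    exact h1
  choose D hDdeg hD using hlift H hHmon ⟨H', hHH'.symm⟩ hHσ
  choose D' hD'deg hD' using hlift H' hH'mon ⟨H, by rw [← hHH', mul_comm]⟩ hH'σ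
  let k := B.card
  let u : (MvPolynomial (Fin m) ℂ)[X][X] :=
    X ^ k + ∑ j ∈ Finset.range k, C (D j) * X ^ j
  let v : (MvPolynomial (Fin m) ℂ)[X][X] :=
    ∑ j ∈ Finset.range (H'.natDegree + 1), C (D' j) * X ^ j
  have huk : u.coeff k = 1 := by
    rw [coeff_add, coeff_X_pow_self, finsetSum_coeff, Finset.sum_eq_zero, add_zero]
    intro j hj
    rw [coeff_C_mul_X_pow, if_neg (Finset.mem_range.1 hj).ne']
  have huj : ∀ j < k, u.coeff j = D j := by
    intro j hj
    rw [coeff_add, coeff_X_pow, if_neg hj.ne, zero_add, finsetSum_coeff,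
      Finset.sum_eq_single j]
    · rw [coeff_C_mul_X_pow, if_pos rfl]
    · intro i _ hi
      rw [coeff_C_mul_X_pow, if_neg hi.symm]
    · intro h
      exact absurd (Finset.mem_range.2 hj) h
  have humap : u.map (coordEval q α) = H := by
    rw [hHmon.as_sum, hHdeg, Polynomial.map_add, Polynomial.map_pow, map_X, Polynomial.map_sum]
    congr 1
    refine Finset.sum_congr rfl fun j _ => ?_
    rw [Polynomial.map_mul, map_C, Polynomial.map_pow, map_X, hco, ← hD]
  have hvmap : v.map (coordEval q α) = H' := by
    conv_rhs => rw [H'.as_sum_range_C_mul_X_pow]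
    rw [Polynomial.map_sum]
    refine Finset.sum_congr rfl fun j _ => ?_
    rw [Polynomial.map_mul, map_C, Polynomial.map_pow, map_X, hco, ← hD']
  have huv : (u * v).map (coordEval q α) = (genericLine P F).map
      (MvPolynomial.aeval q : MvPolynomial (Fin m) ℂ →ₐ[ℂ] E).toRingHom := by
    rw [Polynomial.map_mul, humap, hvmap, hHH']
    congr 1
    exact RingHom.ext fun a => (aeval_algebraMap_X a).symm
  have hDle : ∀ j < k, (D j).natDegree ≤ k - j := by
    intro j hj
    obtain ⟨c, hc⟩ := scaledEval_coeff_of_mul_eq hF ((hco _).trans hα) hmon.ne_zero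
      (fun p hp => genericLine_dvd_of_coordEval_eq_zero hd hF hsm hm hP hq ((hco _).trans hα) hp)
      hq huk huv hj.le
    rw [huj j hj] at hc
    exact natDegree_le_of_scaledEval_eq hd hF hsm hm hP hq ((hco _).trans hα) (hDdeg j) hc
  have hconst : ∀ j, 1 ≤ j → j < k →
      H.coeff j = algebraMap (MvPolynomial (Fin m) ℂ) E ((D j).coeff 0) := by
    intro j h1 hj
    have h0 : (D j).map (algebraMap (MvPolynomial (Fin m) ℂ) E) - C (H.coeff j) = 0 := by
      apply eq_zero_of_natDegree_lt_card_of_eval_eq_zero' _ B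
      · intro ρ hρ
        obtain ⟨σ, rfl⟩ := htrans ρ (hBR hρ)
        rw [eval_sub, eval_C, eval_map, ← aeval_def, ← hσ, ← hD, sub_eq_zero]
        have h2 := congrArg (fun p => p.coeff j) (hHσ σ hρ)
        simp only [coeff_map] at h2
        exact h2
      · rw [natDegree_sub_C, natDegree_map_eq_of_injective hinj]
        have := hDle j hj
        change _ < k
        omega
    have h3 := congrArg (fun p => p.coeff 0) h0
    simp only [coeff_sub, coeff_map, coeff_C_zero, coeff_zero] at h3
    exact (sub_eq_zero.1 h3).symm
  have hk : 1 ≤ k := Finset.card_pos.2 ⟨α, hαB⟩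
  let h : (MvPolynomial (Fin m) ℂ)[X] :=
    X ^ k + ∑ j ∈ Finset.range k, C (if j = 0 then 0 else (D j).coeff 0) * X ^ j
  have hlow : (∑ j ∈ Finset.range k, C (if j = 0 then 0 else (D j).coeff 0) * X ^ j :
      (MvPolynomial (Fin m) ℂ)[X]).degree < k := by
    rw [← mem_degreeLT]
    refine Submodule.sum_mem _ fun j hj => ?_
    rw [mem_degreeLT]
    exact (degree_C_mul_X_pow_le _ _).trans_lt (by exact_mod_cast Finset.mem_range.1 hj)
  have hhmon : h.Monic := monic_X_pow_add hlow
  have hhdeg : h.natDegree = k := natDegree_eq_of_degree_eq_some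
    ((degree_add_eq_left_of_degree_lt (by rwa [degree_X_pow])).trans (degree_X_pow k))
  have hhH : h.map (algebraMap (MvPolynomial (Fin m) ℂ) E) = H - C (H.coeff 0) := by
    rw [eq_sub_iff_add_eq]
    conv_rhs => rw [hHmon.as_sum, hHdeg]
    rw [Polynomial.map_add, Polynomial.map_pow, map_X, Polynomial.map_sum, add_assoc]
    congr 1
    obtain ⟨k', hk'⟩ : ∃ k', k = k' + 1 := ⟨k - 1, by omega⟩
    change ∑ i ∈ Finset.range k, _ + _ = ∑ i ∈ Finset.range k, _
    rw [hk', Finset.sum_range_succ', Finset.sum_range_succ' _ k']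
    rw [if_pos rfl, C_0, zero_mul, Polynomial.map_zero, add_zero, pow_zero, mul_one]
    congr 1
    refine Finset.sum_congr rfl fun j hj => ?_
    rw [if_neg (Nat.succ_ne_zero j), Polynomial.map_mul, map_C, Polynomial.map_pow, map_X,
      hconst (j + 1) (by omega) (by have := Finset.mem_range.1 hj; omega)]
  have hval : ∀ ρ ∈ B, aeval ρ h = - H.coeff 0 := by
    intro ρ hρ
    rw [aeval_def, ← eval_map, hhH, eval_sub, eval_C]
    have : H.eval ρ = 0 := by
      rw [eval_prod]
      exact Finset.prod_eq_zero hρ (by rw [eval_sub, eval_X, eval_C, sub_self])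
    rw [this, zero_sub]
  let S := R.image fun ρ => aeval ρ h
  have hcardS : k * S.card ≤ d := by
    rw [← hcardR]
    apply Finset.mul_card_image_le_card
    intro y hy
    obtain ⟨ρ, hρ, rfl⟩ := Finset.mem_image.1 hy
    obtain ⟨σ, rfl⟩ := htrans ρ hρ
    refine (Finset.card_image_of_injective B σ.injective).ge.trans (Finset.card_le_card ?_)
    intro x hx
    obtain ⟨y, hy, rfl⟩ := Finset.mem_image.1 hx
    rw [Finset.mem_filter]
    refine ⟨hσR σ y (hBR hy), ?_⟩
    rw [← hσ, ← hσ, hval y hy, hval α hαB]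
  have hαint : IsIntegral (MvPolynomial (Fin m) ℂ) α := ⟨_, hmon, hα⟩
  have hβint : IsIntegral (MvPolynomial (Fin m) ℂ) (aeval α h) := 
    adjoin_le_integralClosure hαint (aeval_mem_adjoin_singleton _ _)
  let g := minpoly (MvPolynomial (Fin m) ℂ) (aeval α h)
  have hgmon : g.Monic := minpoly.monic hβint
  have hgK : minpoly (RatFuncField m) (aeval α h) = g.map (algebraMap _ (RatFuncField m)) :=
    minpoly.isIntegrallyClosed_eq_field_fractions' (RatFuncField m) hβint
  have hgdeg : g.natDegree ≤ S.card := by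
    rw [← hgmon.natDegree_map (algebraMap _ (RatFuncField m)), ← hgK,
      ← card_rootSet_eq_natDegree (K := E)
        (Algebra.IsSeparable.isSeparable (RatFuncField m) (aeval α h))
        (Normal.splits inferInstance _), ← Set.toFinset_card]
    apply Finset.card_le_card
    intro y hy
    rw [Set.mem_toFinset, mem_rootSet] at hy
    obtain ⟨σ, rfl⟩ := minpoly.exists_algEquiv_of_root'
      (Algebra.IsAlgebraic.isAlgebraic (R := RatFuncField m) (aeval α h)) hy.2
    refine Finset.mem_image.2 ⟨σ α, hσR σ α (hBR hαB), (hσ σ α h).symm⟩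
  have hdvd : genericLine P F ∣ g.comp h := by
    apply dvd_of_aeval_eq_zero_of_irreducible hmon hirr hα
    rw [aeval_comp, minpoly.aeval]
  have hghmon : (g.comp h).Monic := hgmon.comp hhmon (by omega)
  have hghdeg : (g.comp h).natDegree = g.natDegree * k := by rw [natDegree_comp, hhdeg]
  have hle : g.natDegree * k ≤ d := by
    refine le_trans ?_ hcardS
    rw [mul_comm]
    exact Nat.mul_le_mul_left k hgdeg
  have heq := eq_of_monic_of_dvd_of_natDegree_le hmon hghmon hdvd (by rw [hghdeg, hdeg]; exact hle)
  refine ⟨g, h, hgmon, hhmon, hhdeg, ?_, heq.symm⟩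
  rw [← hdeg, ← heq, hghdeg]

end Decomposition

section LocalMonodromy

open Polynomial

lemma exists_powerSeries_root {k : Type*} [Field k] {f : (PowerSeries k)[X]}
    (hf : f.Monic) {z : k} (hz : (f.map PowerSeries.constantCoeff).eval z = 0)
    (hz' : (derivative (f.map PowerSeries.constantCoeff)).eval z ≠ 0) :
    ∃ r : PowerSeries k, f.IsRoot r ∧ PowerSeries.constantCoeff r = z := by
  have hcc : ∀ (g : (PowerSeries k)[X]), PowerSeries.constantCoeff (g.eval (PowerSeries.C z)) =
      (g.map PowerSeries.constantCoeff).eval z := by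
    intro g
    have h := hom_eval₂ g (RingHom.id _) (PowerSeries.constantCoeff (R := k)) (PowerSeries.C z)
    rw [PowerSeries.constantCoeff_C, RingHom.comp_id] at h
    rw [eval_map]
    exact h
  have hmem : ∀ r : PowerSeries k, r ∈ Ideal.span {(PowerSeries.X : PowerSeries k)} ↔
      PowerSeries.constantCoeff r = 0 := by
    intro r
    rw [Ideal.mem_span_singleton, PowerSeries.X_dvd_iff]
  have hunit : IsUnit (Ideal.Quotient.mk (Ideal.span {(PowerSeries.X : PowerSeries k)})
      (f.derivative.eval (PowerSeries.C z))) := by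
    refine IsUnit.map _ (PowerSeries.isUnit_iff_constantCoeff.2 ?_)
    rw [hcc, ← derivative_map]
    exact hz'.isUnit
  obtain ⟨r, hr, hrz⟩ := HenselianRing.is_henselian f hf (PowerSeries.C z)
    ((hmem _).2 (by rw [hcc, hz])) hunit
  refine ⟨r, hr, ?_⟩
  rw [hmem, map_sub, PowerSeries.constantCoeff_C, sub_eq_zero] at hrz
  exact hrz

/-- A polynomial over `k⟦s⟧` whose reduction is `X²` times a separable split polynomial and
whose constant term has a nonzero linear term has exactly two ramified roots. -/
lemma exists_powerSeries_eisenstein_factor {k : Type*} [Field k] {f : (PowerSeries k)[X]}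
    (hf : f.Monic) {Z : Finset k} (hZ : (0 : k) ∉ Z)
    (hfZ : f.map PowerSeries.constantCoeff = X ^ 2 * ∏ z ∈ Z, (X - C z))
    (h1 : PowerSeries.coeff 1 (f.coeff 0) ≠ 0) :
    ∃ (g : (PowerSeries k)[X]) (S : Finset (PowerSeries k)), g.Monic ∧ Irreducible g ∧
      g.natDegree = 2 ∧ f = g * ∏ r ∈ S, (X - C r) := by
  classical
  have hder : ∀ z ∈ Z, (derivative (f.map PowerSeries.constantCoeff)).eval z ≠ 0 := by
    intro z hz
    have hz0 : z ≠ 0 := fun h => hZ (h ▸ hz)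
    rw [hfZ, ← Finset.mul_prod_erase Z _ hz, mul_left_comm, derivative_mul, eval_add, eval_mul,
      eval_mul (p := X - C z), eval_sub, eval_X, eval_C, sub_self, zero_mul, add_zero, derivative_sub,
      derivative_X, derivative_C, sub_zero, eval_one, one_mul, eval_mul, eval_pow, eval_X,
      eval_prod]
    refine mul_ne_zero (pow_ne_zero 2 hz0) (Finset.prod_ne_zero_iff.2 fun w hw => ?_)
    rw [eval_sub, eval_X, eval_C, sub_ne_zero]
    exact (Finset.mem_erase.1 hw).1.symm
  have hex : ∀ z : k, ∃ r : PowerSeries k, z ∈ Z → f.IsRoot r ∧ PowerSeries.constantCoeff r = z := by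
    intro z
    by_cases hz : z ∈ Z
    · obtain ⟨r, hr⟩ := exists_powerSeries_root hf (z := z) (by
        rw [hfZ, eval_mul, eval_prod, Finset.prod_eq_zero hz, mul_zero]
        rw [eval_sub, eval_X, eval_C, sub_self]) (hder z hz)
      exact ⟨r, fun _ => hr⟩
    · exact ⟨0, fun h => absurd h hz⟩
  choose r hr using hex
  have hrinj : Set.InjOn r Z := by
    intro a ha b hb hab
    rw [← (hr a ha).2, ← (hr b hb).2, hab]
  have hdvd : ∏ z ∈ Z, (X - C (r z)) ∣ f := by
    have h2 : (Z.val.map r) ≤ f.roots := by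
      rw [Multiset.le_iff_subset]
      · intro x hx
        obtain ⟨z, hz, rfl⟩ := Multiset.mem_map.1 hx
        exact (mem_roots hf.ne_zero).2 (hr z hz).1
      · exact (Multiset.nodup_map_iff_inj_on Z.nodup).2 fun a ha b hb h => hrinj ha hb h
    have h3 := (Multiset.prod_X_sub_C_dvd_iff_le_roots hf.ne_zero _).2 h2
    rw [Multiset.map_map] at h3
    exact h3
  obtain ⟨g, hg⟩ := hdvd
  have hpmon : (∏ z ∈ Z, (X - C (r z))).Monic := monic_prod_X_sub_C _ _
  have hgmon : g.Monic := hpmon.of_mul_monic_left (hg ▸ hf)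
  have hpmap : (∏ z ∈ Z, (X - C (r z))).map PowerSeries.constantCoeff = ∏ z ∈ Z, (X - C z) := by
    rw [Polynomial.map_prod]
    refine Finset.prod_congr rfl fun z hz => ?_
    rw [Polynomial.map_sub, map_X, map_C, (hr z hz).2]
  have hgmap : g.map PowerSeries.constantCoeff = X ^ 2 := by
    have h2 := hfZ
    rw [hg, Polynomial.map_mul, hpmap, mul_comm] at h2
    exact mul_right_cancel₀ (monic_prod_X_sub_C _ _).ne_zero h2
  have hgdeg : g.natDegree = 2 := by
    rw [← hgmon.natDegree_map PowerSeries.constantCoeff, hgmap, natDegree_X_pow]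
  have hmem : ∀ n, n < 2 → PowerSeries.X ∣ g.coeff n := by
    intro n hn
    rw [PowerSeries.X_dvd_iff, ← coeff_map, hgmap, coeff_X_pow, if_neg hn.ne]
  refine ⟨g, Z.image r, hgmon, ?_, hgdeg, ?_⟩
  · have hE : g.IsEisensteinAt (Ideal.span {(PowerSeries.X : PowerSeries k)}) := by
      refine ⟨?_, ?_, ?_⟩
      · rw [hgmon.leadingCoeff]
        intro h
        exact PowerSeries.span_X_isPrime.ne_top ((Ideal.eq_top_iff_one _).2 h)
      · intro n hn
        rw [hgdeg] at hn
        exact Ideal.mem_span_singleton.2 (hmem n hn)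
      · rw [Ideal.span_singleton_pow, Ideal.mem_span_singleton]
        rintro ⟨w, hw⟩
        apply h1
        rw [hg, mul_coeff_zero, hw, mul_left_comm, PowerSeries.coeff_X_pow_mul', if_neg (by omega)]
    exact hE.irreducible PowerSeries.span_X_isPrime hgmon.isPrimitive (by omega)
  · rw [hg, Finset.prod_image hrinj, mul_comm]

end LocalMonodromy

section MonodromyTransposition

open Polynomial

lemma exists_local_transposition {k : Type*} [Field k] [CharZero k] {M Ω : Type*} [Field M]
    [Algebra (PowerSeries k) M] [IsFractionRing (PowerSeries k) M] [Field Ω] [Algebra M Ω]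
    [IsAlgClosed Ω] [Algebra.IsAlgebraic M Ω]
    {f : (PowerSeries k)[X]} (hf : f.Monic) {Z : Finset k} (hZ : 0 ∉ Z)
    (hfZ : f.map PowerSeries.constantCoeff = X ^ 2 * ∏ z ∈ Z, (X - C z))
    (h1 : PowerSeries.coeff 1 (f.coeff 0) ≠ 0) :
    ∃ (τ : Ω ≃ₐ[M] Ω) (w₁ w₂ : Ω), w₁ ≠ w₂ ∧ τ w₁ = w₂ ∧ τ w₂ = w₁ ∧
      eval₂ ((algebraMap M Ω).comp (algebraMap (PowerSeries k) M)) w₁ f = 0 ∧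
      eval₂ ((algebraMap M Ω).comp (algebraMap (PowerSeries k) M)) w₂ f = 0 ∧
      ∀ w, eval₂ ((algebraMap M Ω).comp (algebraMap (PowerSeries k) M)) w f = 0 →
        w ≠ w₁ → w ≠ w₂ → τ w = w := by
  classical
  obtain ⟨g, S, hg, hirr, hdeg, rfl⟩ := exists_powerSeries_eisenstein_factor hf hZ hfZ h1
  have hcM : CharZero M := by
    have : Algebra k M := ((algebraMap (PowerSeries k) M).comp PowerSeries.C).toAlgebra
    exact charZero_of_injective_algebraMap (algebraMap k M).injective
  have hirrM : Irreducible (g.map (algebraMap (PowerSeries k) M)) :=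
    (hg.irreducible_iff_irreducible_map_fraction_map).1 hirr
  have hnormal : Normal M Ω := by
    have : IsAlgClosure M Ω := ⟨inferInstance, inferInstance⟩
    exact IsAlgClosure.normal M Ω
  have hdegM : (g.map (algebraMap (PowerSeries k) M)).natDegree = 2 := by
    rw [hg.natDegree_map, hdeg]
  set gΩ := (g.map (algebraMap (PowerSeries k) M)).map (algebraMap M Ω) with hgΩ
  have hmonΩ : gΩ.Monic := (hg.map _).map _
  have hcard : Multiset.card gΩ.roots = 2 := by
    rw [← (IsAlgClosed.splits gΩ).natDegree_eq_card_roots, hgΩ, natDegree_map, hdegM]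
  obtain ⟨w₁, w₂, hw⟩ := Multiset.card_eq_two.1 hcard
  have hnodup : gΩ.roots.Nodup := nodup_roots (hirrM.separable.map)
  have hne : w₁ ≠ w₂ := by
    rintro rfl
    rw [hw] at hnodup
    simp at hnodup
  have hroot : ∀ w, eval w gΩ = 0 ↔ w = w₁ ∨ w = w₂ := by
    intro w
    rw [← IsRoot.def, ← mem_roots hmonΩ.ne_zero, hw]
    simp
  have hmin : minpoly M w₁ = g.map (algebraMap (PowerSeries k) M) := by
    refine (minpoly.eq_of_irreducible_of_monic hirrM ?_ (hg.map _)).symm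
    rw [aeval_def, ← eval_map]
    exact (hroot w₁).2 (Or.inl rfl)
  obtain ⟨τ, hτ⟩ := minpoly.exists_algEquiv_of_root' (K := M) (x := w₂) (y := w₁)
    (Algebra.IsAlgebraic.isAlgebraic w₁) (by
      rw [hmin, aeval_def, ← eval_map]
      exact (hroot w₂).2 (Or.inr rfl))
  have hτ2 : τ w₂ = w₁ := by
    have h2 : eval (τ w₂) gΩ = 0 := by
      rw [hgΩ, eval_map, ← aeval_def, aeval_algHom_apply τ, aeval_def, ← eval_map, (hroot w₂).2 (Or.inr rfl), map_zero]
    rcases (hroot _).1 h2 with h | h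
    · exact h
    · exact absurd (τ.injective (hτ.trans h.symm)) hne
  have hev : ∀ w, eval₂ ((algebraMap M Ω).comp (algebraMap (PowerSeries k) M)) w g = eval w gΩ := by
    intro w
    rw [hgΩ, map_map, eval_map]
  refine ⟨τ, w₁, w₂, hne, hτ, hτ2, ?_, ?_, ?_⟩
  · rw [eval₂_mul, hev, (hroot w₁).2 (Or.inl rfl), zero_mul]
  · rw [eval₂_mul, hev, (hroot w₂).2 (Or.inr rfl), zero_mul]
  · intro w hw h1 h2
    rw [eval₂_mul, hev, mul_eq_zero, hroot, eval₂_finsetProd, Finset.prod_eq_zero_iff] at hw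
    rcases hw with h | ⟨r, -, h⟩
    · tauto
    · rw [eval₂_sub, eval₂_X, eval₂_C, sub_eq_zero] at h
      rw [h]
      exact τ.commutes _

/-- A degeneration over a power series ring with exactly one nondegenerate double root gives a
transposition in a Galois group. -/
theorem exists_transposition_of_powerSeries {k : Type*} [Field k] [CharZero k] {A K E : Type*}
    [CommRing A] [IsDomain A] [Field K] [Algebra A K] [IsFractionRing A K] [Field E] [Algebra K E]
    [Normal K E] {f : A[X]} (hf : f.Monic) {R : Finset E}
    (hR : f.map ((algebraMap K E).comp (algebraMap A K)) = ∏ ρ ∈ R, (X - C ρ))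
    {ψ : A →+* PowerSeries k} (hψ : Function.Injective ψ) {Z : Finset k} (hZ : 0 ∉ Z)
    (hfZ : (f.map ψ).map PowerSeries.constantCoeff = X ^ 2 * ∏ z ∈ Z, (X - C z))
    (h1 : PowerSeries.coeff 1 ((f.map ψ).coeff 0) ≠ 0) :
    ∃ σ : E ≃ₐ[K] E, ∃ ρ₁ ∈ R, ∃ ρ₂ ∈ R, ρ₁ ≠ ρ₂ ∧ σ ρ₁ = ρ₂ ∧ σ ρ₂ = ρ₁ ∧
      ∀ ρ ∈ R, ρ ≠ ρ₁ → ρ ≠ ρ₂ → σ ρ = ρ := by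
  let M := FractionRing (PowerSeries k)
  let Ω := AlgebraicClosure M
  let ψM : A →+* M := (algebraMap (PowerSeries k) M).comp ψ
  have hψM : Function.Injective ψM := (IsFractionRing.injective (PowerSeries k) M).comp hψ
  let : Algebra K M := (IsFractionRing.lift (K := K) hψM).toAlgebra
  let ι : E →ₐ[K] Ω := IsAlgClosed.lift
  let : Algebra E Ω := ι.toRingHom.toAlgebra
  have : IsScalarTower K E Ω := IsScalarTower.of_algebraMap_eq fun x => (ι.commutes x).symm
  obtain ⟨τ, w₁, w₂, hne, h12, h21, hw1, hw2, hfix⟩ :=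
    exists_local_transposition (M := M) (Ω := Ω) (hf.map ψ) hZ hfZ h1
  have hev : ∀ w : Ω, eval₂ ((algebraMap M Ω).comp (algebraMap (PowerSeries k) M)) w (f.map ψ) = 0 ↔
      ∃ ρ ∈ R, w = ι ρ := by
    intro w
    have hcomp : ((algebraMap M Ω).comp (algebraMap (PowerSeries k) M)).comp ψ =
        ι.toRingHom.comp ((algebraMap K E).comp (algebraMap A K)) := by
      refine RingHom.ext fun a => ?_
      refine Eq.trans ?_ (ι.commutes (algebraMap A K a)).symm
      exact congrArg (algebraMap M Ω) (IsFractionRing.lift_algebraMap hψM a).symm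
    rw [eval₂_map, hcomp, ← eval_map, ← map_map, hR, Polynomial.map_prod, eval_prod,
      Finset.prod_eq_zero_iff]
    refine exists_congr fun ρ => and_congr_right fun _ => ?_
    rw [Polynomial.map_sub, map_X, map_C, eval_sub, eval_X, eval_C, sub_eq_zero]
    rfl
  obtain ⟨ρ₁, hρ1, rfl⟩ := (hev w₁).1 hw1
  obtain ⟨ρ₂, hρ2, rfl⟩ := (hev w₂).1 hw2
  have hσ : ∀ x, ι (((τ.restrictScalars K).restrictNormal E) x) = τ (ι x) := fun x =>
    AlgEquiv.restrictNormal_commutes (τ.restrictScalars K) E x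
  refine ⟨(τ.restrictScalars K).restrictNormal E, ρ₁, hρ1, ρ₂, hρ2, ?_, ?_, ?_, ?_⟩
  · rintro rfl
    exact hne rfl
  · exact ι.injective ((hσ _).trans h12)
  · exact ι.injective ((hσ _).trans h21)
  · intro ρ hρ h1 h2
    refine ι.injective ((hσ _).trans (hfix _ ((hev _).2 ⟨ρ, hρ, rfl⟩) ?_ ?_))
    · exact fun h => h1 (ι.injective h)
    · exact fun h => h2 (ι.injective h)

end MonodromyTransposition

section TangentPoint

open Polynomial

variable {m : ℕ} {k : Type*} [Field k] [Algebra ℂ k]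

/-- The power series expansion at the origin of the pencil of lines `x + s • Q`. -/
noncomputable def lineSeries (x : Fin m → ℂ) (Q : Fin m → k) :
    MvPolynomial (Fin m) ℂ →+* PowerSeries k :=
  (coeToPowerSeries.ringHom (R := k)).comp (line (fun i => algebraMap ℂ k (x i)) Q).toRingHom

lemma lineSeries_apply (x : Fin m → ℂ) (Q : Fin m → k) (p : MvPolynomial (Fin m) ℂ) :
    lineSeries x Q p = (line (fun i => algebraMap ℂ k (x i)) Q p : PowerSeries k) := rfl

lemma lineSeries_injective (x : Fin m → ℂ) {Q : Fin m → k}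
    (hQ : Function.Injective (MvPolynomial.aeval Q : MvPolynomial (Fin m) ℂ →ₐ[ℂ] k)) :
    Function.Injective (lineSeries x Q) := by
  rw [injective_iff_map_eq_zero]
  intro p hp
  rw [lineSeries_apply, coe_eq_zero_iff] at hp
  have h1 := congrArg (eval 1) hp
  rw [line_eval, eval_zero] at h1
  let T : MvPolynomial (Fin m) ℂ →ₐ[ℂ] MvPolynomial (Fin m) ℂ :=
    MvPolynomial.aeval fun i => MvPolynomial.X i + MvPolynomial.C (x i)
  let T' : MvPolynomial (Fin m) ℂ →ₐ[ℂ] MvPolynomial (Fin m) ℂ :=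
    MvPolynomial.aeval fun i => MvPolynomial.X i - MvPolynomial.C (x i)
  have hT : T'.comp T = AlgHom.id ℂ _ := by
    apply MvPolynomial.algHom_ext
    intro i
    simp [T, T', ← MvPolynomial.algebraMap_eq]
  have hQT : (MvPolynomial.aeval Q).comp T =
      MvPolynomial.aeval fun i => algebraMap ℂ k (x i) + 1 * Q i := by
    apply MvPolynomial.algHom_ext
    intro i
    simp [T, ← MvPolynomial.algebraMap_eq, add_comm]
  rw [← hQT, AlgHom.comp_apply] at h1
  have h2 : T p = 0 := hQ (h1.trans (map_zero _).symm)
  have h3 : T' (T p) = p := congrArg (fun f => f p) hT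
  rw [← h3, h2, map_zero]

lemma constantCoeff_lineSeries (x : Fin m → ℂ) (Q : Fin m → k) (p : MvPolynomial (Fin m) ℂ) :
    PowerSeries.constantCoeff (lineSeries x Q p) = algebraMap ℂ k (MvPolynomial.aeval x p) := by
  rw [lineSeries_apply, ← PowerSeries.coeff_zero_eq_constantCoeff_apply, coeff_coe,
    line_coeff_zero]
  exact MvPolynomial.aeval_algebraMap_apply k x p

lemma exists_transposition_of_tangent_of_injective [CharZero k] {Q : Fin m → k}
    (hQ : Function.Injective (MvPolynomial.aeval Q : MvPolynomial (Fin m) ℂ →ₐ[ℂ] k))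
    {K E : Type*} [Field K] [Algebra (MvPolynomial (Fin m) ℂ) K]
    [IsFractionRing (MvPolynomial (Fin m) ℂ) K] [Field E] [Algebra K E] [Normal K E]
    {d : ℕ} {F : MvPolynomial (Fin m) ℂ} (hF : F.IsHomogeneous d) {P : Fin m → ℂ}
    (hP : MvPolynomial.eval P F = 1) {R : Finset E}
    (hR : (genericLine P F).map ((algebraMap K E).comp (algebraMap (MvPolynomial (Fin m) ℂ) K)) =
      ∏ ρ ∈ R, (X - C ρ)) {x : Fin m → ℂ} {Z : Finset ℂ} (hZ : 0 ∉ Z)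
    (hx : line x P F = X ^ 2 * ∏ z ∈ Z, (X - C z))
    (hgrad : ∃ i, MvPolynomial.eval x (MvPolynomial.pderiv i F) ≠ 0) :
    ∃ σ : E ≃ₐ[K] E, ∃ ρ₁ ∈ R, ∃ ρ₂ ∈ R, ρ₁ ≠ ρ₂ ∧ σ ρ₁ = ρ₂ ∧ σ ρ₂ = ρ₁ ∧
      ∀ ρ ∈ R, ρ ≠ ρ₁ → ρ ≠ ρ₂ → σ ρ = ρ := by
  classical
  refine exists_transposition_of_powerSeries (genericLine_monic hF hP).1 hR
    (lineSeries_injective x hQ) (Z := Z.map ⟨algebraMap ℂ k, (algebraMap ℂ k).injective⟩) ?_ ?_ ?_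
  · rw [Finset.mem_map]
    rintro ⟨z, hz, hz0⟩
    have : z = 0 := (algebraMap ℂ k).injective (hz0.trans (map_zero _).symm)
    exact hZ (this ▸ hz)
  · have hcomp : PowerSeries.constantCoeff.comp (lineSeries x Q) =
        (algebraMap ℂ k).comp (MvPolynomial.aeval x : _ →ₐ[ℂ] ℂ).toRingHom :=
      RingHom.ext fun p => constantCoeff_lineSeries x Q p
    rw [map_map, hcomp, ← map_map, genericLine_map, hx, Polynomial.map_mul, Polynomial.map_pow,
      map_X, Polynomial.map_prod, Finset.prod_map]
    simp
  · rw [coeff_map, genericLine, line_coeff_zero, MvPolynomial.aeval_X_left_apply,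
      lineSeries_apply, coeff_coe, line_coeff_one]
    intro h
    have h1 : MvPolynomial.aeval Q (∑ i, MvPolynomial.X i *
        MvPolynomial.C (MvPolynomial.eval x (MvPolynomial.pderiv i F))) = 0 := by
      rw [← h, map_sum]
      refine Finset.sum_congr rfl fun i _ => ?_
      rw [map_mul, MvPolynomial.aeval_X, MvPolynomial.aeval_C]
      exact congrArg (Q i * ·) (MvPolynomial.aeval_algebraMap_apply k x _).symm
    have h2 := hQ (h1.trans (map_zero _).symm)
    obtain ⟨i, hi⟩ := hgrad
    refine hi ?_
    have h3 := congrArg (MvPolynomial.eval (Pi.single i 1)) h2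
    rw [map_sum, map_zero] at h3
    simpa [Pi.single_apply] using h3

/-- A multiple root of a polynomial without two coincidences among its roots, moved to the
origin. -/
lemma exists_comp_eq_sq_mul_prod {d : ℕ} {f : ℂ[X]} (hf : f.natDegree ≤ d) (hd : f.coeff d = 1)
    (hbad : ¬ BadRoots d f) (hsep : ¬ f.Separable) :
    ∃ (a : ℂ) (Z : Finset ℂ), 0 ∉ Z ∧ f.comp (X + C a) = X ^ 2 * ∏ z ∈ Z, (X - C z) := by
  classical
  obtain ⟨ζ, hζ⟩ := exists_roots_of_natDegree_le hf (by rw [hd]; exact one_ne_zero)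
  have hinj : ¬ Function.Injective ζ := by
    intro h
    refine hsep ?_
    rw [hζ, hd, C_1, one_mul]
    exact separable_prod_X_sub_C_iff.2 h
  obtain ⟨a, b, hab, hne⟩ := Function.not_injective_iff.1 hinj
  have hno : ∀ c e, c ≠ e → s(a, b) ≠ s(c, e) → ζ c ≠ ζ e := fun c e hce hs h =>
    hbad ⟨ζ, hζ, a, b, c, e, hne, hce, hs, hab, h⟩
  have hoff : ∀ i, i ≠ a → i ≠ b → ζ i ≠ ζ a := fun i hia hib =>
    hno i a hia (by rw [Ne, Sym2.eq_iff]; rintro (⟨h, -⟩ | ⟨-, h⟩) <;> tauto)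
  refine ⟨ζ a, ((Finset.univ.erase a).erase b).image fun i => ζ i - ζ a, ?_, ?_⟩
  · rw [Finset.mem_image]
    rintro ⟨i, hi, h⟩
    rw [Finset.mem_erase, Finset.mem_erase] at hi
    exact hoff i hi.2.1 hi.1 (sub_eq_zero.1 h)
  · rw [Finset.prod_image, hζ, hd, C_1, one_mul, Polynomial.prod_comp,
      ← Finset.mul_prod_erase Finset.univ _ (Finset.mem_univ a),
      ← Finset.mul_prod_erase (Finset.univ.erase a) _
        (Finset.mem_erase.2 ⟨hne.symm, Finset.mem_univ b⟩), ← mul_assoc, ← hab]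
    · congr 1
      · simp [sq]
      · refine Finset.prod_congr rfl fun i _ => ?_
        simp only [sub_comp, X_comp, C_comp, C_sub]
        ring
    · intro i hi j hj hij
      rw [Finset.coe_erase, Finset.coe_erase] at hi hj
      by_contra hne'
      refine hno i j hne' ?_ (sub_left_injective hij)
      rw [Ne, Sym2.eq_iff]
      rintro (⟨h, -⟩ | ⟨h, -⟩)
      · exact hi.1.2 h.symm
      · exact hj.1.2 h.symm

/-- A simple tangent line through `P` gives a transposition in the monodromy group. -/
theorem exists_transposition_of_tangent {E : Type*} [Field E] [Algebra (RatFuncField m) E]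
    [Normal (RatFuncField m) E]
    {d : ℕ} {F : MvPolynomial (Fin m) ℂ} (hF : F.IsHomogeneous d) {P : Fin m → ℂ}
    (hP : MvPolynomial.eval P F = 1) {R : Finset E}
    (hR : (genericLine P F).map ((algebraMap (RatFuncField m) E).comp
      (algebraMap (MvPolynomial (Fin m) ℂ) (RatFuncField m))) =
      ∏ ρ ∈ R, (X - C ρ)) {x : Fin m → ℂ} {Z : Finset ℂ} (hZ : 0 ∉ Z)
    (hx : line x P F = X ^ 2 * ∏ z ∈ Z, (X - C z))
    (hgrad : ∃ i, MvPolynomial.eval x (MvPolynomial.pderiv i F) ≠ 0) :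
    ∃ σ : E ≃ₐ[RatFuncField m] E, ∃ ρ₁ ∈ R, ∃ ρ₂ ∈ R, ρ₁ ≠ ρ₂ ∧ σ ρ₁ = ρ₂ ∧ σ ρ₂ = ρ₁ ∧
      ∀ ρ ∈ R, ρ ≠ ρ₁ → ρ ≠ ρ₂ → σ ρ = ρ := by
  have : CharZero (RatFuncField m) :=
    charZero_of_injective_algebraMap (algebraMap ℂ (RatFuncField m)).injective
  refine exists_transposition_of_tangent_of_injective (k := RatFuncField m)
    (Q := fun i => algebraMap (MvPolynomial (Fin m) ℂ) (RatFuncField m) (MvPolynomial.X i))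
    ?_ hF hP hR hZ hx hgrad
  intro a b hab
  rw [aeval_algebraMap_X, aeval_algebraMap_X] at hab
  exact IsFractionRing.injective _ _ hab

end TangentPoint

section FullMonodromy

open Polynomial

/-- A group acting faithfully and transitively on a finite subset `R`, containing a transposition
and without proper blocks, is the full symmetric group. -/
lemma nonempty_mulEquiv_perm_of_block {G E : Type*} [Group G] [MulAction G E] [DecidableEq E]
    {R : Finset E} (hGR : ∀ (σ : G), ∀ ρ ∈ R, σ • ρ ∈ R)
    (hfaith : ∀ σ : G, (∀ ρ ∈ R, σ • ρ = ρ) → σ = 1)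
    (htrans : ∀ α ∈ R, ∀ β ∈ R, ∃ σ : G, σ • α = β)
    (hswap : ∃ σ : G, ∃ ρ₁ ∈ R, ∃ ρ₂ ∈ R, ρ₁ ≠ ρ₂ ∧ σ • ρ₁ = ρ₂ ∧ σ • ρ₂ = ρ₁ ∧
      ∀ ρ ∈ R, ρ ≠ ρ₁ → ρ ≠ ρ₂ → σ • ρ = ρ)
    (hblock : ∀ B ⊆ R, ∀ α ∈ B, (∀ σ : G, σ • α ∈ B → B.image (σ • ·) = B) → 2 ≤ B.card →
      B = R) :
    Nonempty (G ≃* Equiv.Perm R) := by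
  have hiff : ∀ (σ : G) (ρ : E), σ • ρ ∈ R ↔ ρ ∈ R := fun σ ρ =>
    ⟨fun h => by simpa using hGR σ⁻¹ _ h, hGR σ ρ⟩
  let Φ : G →* Equiv.Perm R :=
    { toFun := fun σ => (MulAction.toPerm σ : Equiv.Perm E).subtypePerm (hiff σ)
      map_one' := by ext; simp
      map_mul' := fun σ τ => Equiv.ext fun ρ => Subtype.ext (mul_smul σ τ (ρ : E)) }
  have hΦ : ∀ σ (ρ : R), ((Φ σ ρ : R) : E) = σ • (ρ : E) := fun σ ρ => rfl
  have hinj : Function.Injective Φ := by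
    rw [injective_iff_map_eq_one]
    intro σ hσ
    refine hfaith σ fun ρ hρ => ?_
    have := hΦ σ ⟨ρ, hρ⟩
    rw [hσ] at this
    exact this.symm
  obtain ⟨σ₀, ρ₁, h₁, ρ₂, h₂, hne, h12, h21, hfix⟩ := hswap
  have hsw : Φ σ₀ = Equiv.swap ⟨ρ₁, h₁⟩ ⟨ρ₂, h₂⟩ := by
    ext ρ
    rw [hΦ, Equiv.swap_apply_def]
    split_ifs with ha hb
    · rw [ha]; exact h12
    · rw [hb]; exact h21
    · exact hfix ρ ρ.2 (fun h => ha (Subtype.ext h)) fun h => hb (Subtype.ext h)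
  have hprim : MulAction.IsPreprimitive Φ.range R :=
    { exists_smul_eq := by
        intro α β
        obtain ⟨σ, hσ⟩ := htrans α α.2 β β.2
        exact ⟨⟨Φ σ, σ, rfl⟩, Subtype.ext hσ⟩
      isTrivialBlock_of_isBlock := by
        intro B hB
        rw [MulAction.IsTrivialBlock, or_iff_not_imp_left]
        intro hns
        rw [Set.not_subsingleton_iff] at hns
        rw [MulAction.isBlock_iff_smul_eq_of_mem] at hB
        obtain ⟨α, hα, β, hβ, hαβ⟩ := hns
        classical
        let B' : Finset E := B.toFinset.map (Function.Embedding.subtype _)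
        have hmem : ∀ ρ : R, (ρ : E) ∈ B' ↔ ρ ∈ B := by
          intro ρ
          simp [B']
        have hB'R : B' ⊆ R := by
          intro ρ hρ
          obtain ⟨r, -, rfl⟩ := Finset.mem_map.1 hρ
          exact r.2
        have hB' := hblock B' hB'R α ((hmem α).2 hα) (by
            intro σ hσ
            have hσB : Φ σ α ∈ B := (hmem _).1 hσ
            have h := hB (g := ⟨Φ σ, σ, rfl⟩) hα hσB
            refine Finset.eq_of_subset_of_card_le ?_
              (Finset.card_image_of_injective _ (MulAction.injective σ)).ge
            intro ρ hρ
            obtain ⟨r, hr, rfl⟩ := Finset.mem_image.1 hρ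
            have h3 : Φ σ ⟨r, hB'R hr⟩ ∈ B := by
              rw [← h]
              exact ⟨_, (hmem ⟨r, hB'R hr⟩).1 hr, rfl⟩
            exact (hmem _).2 h3) (by
          have h2 : ({(α : E), (β : E)} : Finset E) ⊆ B' := by
            intro ρ hρ
            rw [Finset.mem_insert, Finset.mem_singleton] at hρ
            rcases hρ with rfl | rfl
            · exact (hmem _).2 hα
            · exact (hmem _).2 hβ
          have h3 := Finset.card_le_card h2
          rwa [Finset.card_pair (fun h => hαβ (Subtype.ext h))] at h3)
        refine Set.eq_univ_of_forall fun ρ => ?_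
        rw [← hmem, hB']
        exact ρ.2 }
  have htop : Φ.range = ⊤ :=
    Equiv.Perm.subgroup_eq_top_of_isPreprimitive_of_isSwap_mem hprim (Φ σ₀)
      ⟨_, _, fun h => hne (congrArg Subtype.val h), hsw⟩ ⟨σ₀, rfl⟩
  exact ⟨MulEquiv.ofBijective Φ ⟨hinj, MonoidHom.range_eq_top.1 htop⟩⟩

variable {m : ℕ} {E : Type*} [Field E] [Algebra ℂ E] [Algebra (MvPolynomial (Fin m) ℂ) E]
  [IsScalarTower ℂ (MvPolynomial (Fin m) ℂ) E] [Algebra (RatFuncField m) E]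
  [IsScalarTower (MvPolynomial (Fin m) ℂ) (RatFuncField m) E]

/-- Smoothness, a simple tangent line through `P` and indecomposable restrictions to lines force
the monodromy group of the projection from `P` to be the full symmetric group. -/
theorem nonempty_mulEquiv_perm_of_tangent [FiniteDimensional (RatFuncField m) E]
    [IsGalois (RatFuncField m) E] {d : ℕ} (hd : 2 ≤ d)
    {F : MvPolynomial (Fin m) ℂ} (hF : F.IsHomogeneous d)
    (hsm : ∀ x : Fin m → ℂ, x ≠ 0 → ∃ i, MvPolynomial.eval x (MvPolynomial.pderiv i F) ≠ 0)
    (hm : 3 ≤ m) {P : Fin m → ℂ} (hP : MvPolynomial.eval P F = 1) {R : Finset E}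
    (hR : (genericLine P F).map (algebraMap (MvPolynomial (Fin m) ℂ) E) =
      ∏ ρ ∈ R, (X - C ρ))
    (hfaith : ∀ σ : E ≃ₐ[RatFuncField m] E, (∀ ρ ∈ R, σ ρ = ρ) → σ = 1)
    (htan : ∃ x : Fin m → ℂ, (∃ i, MvPolynomial.eval x (MvPolynomial.pderiv i F) ≠ 0) ∧
      ∃ Z : Finset ℂ, 0 ∉ Z ∧ line x P F = X ^ 2 * ∏ z ∈ Z, (X - C z))
    (hindec : ∀ l e, 2 ≤ l → 2 ≤ e → l * e = d → ∃ x : Fin m → ℂ, ¬ ∃ g h : ℂ[X], g.Monic ∧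
      g.natDegree = e ∧ h.Monic ∧ h.natDegree = l ∧ line x P F = g.comp h) :
    Nonempty ((E ≃ₐ[RatFuncField m] E) ≃* Equiv.Perm (Fin d)) := by
  classical
  obtain ⟨hmon, hdeg⟩ := genericLine_monic hF hP
  have hirr := genericLine_irreducible (by omega) hF hsm hm hP
  have hinj := algebraMap_injective_of_ratFuncField (m := m) (E := E)
  have hroot : ∀ ρ, aeval ρ (genericLine P F) = 0 ↔ ρ ∈ R := by
    intro ρ
    rw [aeval_def, ← eval_map, hR, eval_prod, Finset.prod_eq_zero_iff]
    constructor
    · rintro ⟨a, ha, h⟩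
      rw [eval_sub, eval_X, eval_C, sub_eq_zero] at h
      rwa [h]
    · intro h
      exact ⟨ρ, h, by rw [eval_sub, eval_X, eval_C, sub_self]⟩
  have hσ : ∀ (σ : E ≃ₐ[RatFuncField m] E) (x : E) (p : (MvPolynomial (Fin m) ℂ)[X]),
      σ (aeval x p) = aeval (σ x) p := by
    intro σ x p
    exact (aeval_algHom_apply (σ.toAlgHom.restrictScalars (MvPolynomial (Fin m) ℂ)) x p).symm
  have hσR : ∀ (σ : E ≃ₐ[RatFuncField m] E) ρ, ρ ∈ R → σ ρ ∈ R := by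
    intro σ ρ h
    rw [← hroot] at h ⊢
    rw [← hσ, h, map_zero]
  have hcardR : R.card = d := by
    have := congrArg natDegree hR
    rw [natDegree_map_eq_of_injective hinj, hdeg, natDegree_finsetProd_X_sub_C_eq_card] at this
    exact this.symm
  have htrans : ∀ α ∈ R, ∀ ρ ∈ R, ∃ σ : E ≃ₐ[RatFuncField m] E, σ α = ρ := by
    intro α hα ρ hρ
    refine minpoly.exists_algEquiv_of_root'
      (Algebra.IsAlgebraic.isAlgebraic (R := RatFuncField m) α) ?_
    rw [← minpoly.eq_of_irreducible_of_monic
      (hmon.irreducible_iff_irreducible_map_fraction_map.1 hirr) (x := α) ?_ (hmon.map _),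
      aeval_map_algebraMap, (hroot ρ).2 hρ]
    rw [aeval_map_algebraMap, (hroot α).2 hα]
  obtain ⟨x, hx, Z, hZ, hxZ⟩ := htan
  have hswap := exists_transposition_of_tangent (E := E) hF hP (R := R) (by
    rw [← IsScalarTower.algebraMap_eq]; exact hR) hZ hxZ hx
  obtain ⟨ε⟩ := nonempty_mulEquiv_perm_of_block (G := E ≃ₐ[RatFuncField m] E) hσR hfaith htrans
    hswap (by
      intro B hBR α hα hB h2
      obtain ⟨g, h, hg, hh, hhd, hgd, hgh⟩ :=
        exists_comp_of_block (by omega) hF hsm hm hP hR hBR hα hB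
      by_contra hne
      have hlt := Finset.card_lt_card (hBR.ssubset_of_ne hne)
      have hg2 : 2 ≤ g.natDegree := by
        by_contra hlt2
        have : g.natDegree = 0 ∨ g.natDegree = 1 := by omega
        rcases this with h0 | h0 <;> rw [h0] at hgd <;> omega
      obtain ⟨y, hy⟩ := hindec B.card g.natDegree h2 hg2 (by rw [mul_comm]; exact hgd)
      refine hy ⟨g.map (MvPolynomial.aeval y : _ →ₐ[ℂ] ℂ).toRingHom,
        h.map (MvPolynomial.aeval y : _ →ₐ[ℂ] ℂ).toRingHom, hg.map _, hg.natDegree_map _,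
        hh.map _, (hh.natDegree_map _).trans hhd, ?_⟩
      rw [← genericLine_map, hgh, map_comp])
  exact ⟨ε.trans (Finset.equivFinOfCardEq hcardR).permCongrHom⟩

end FullMonodromy

section GaloisGroup

open Polynomial

variable {m : ℕ}

lemma fFP_eq_map_genericLine (F : MvPolynomial (Fin m) ℂ) (P : Fin m → ℂ) :
    fFP F P = (genericLine P F).map (algebraMap (MvPolynomial (Fin m) ℂ) (RatFuncField m)) := by
  induction F using MvPolynomial.induction_on with
  | C a =>
    rw [fFP, MvPolynomial.eval₂_C, ← MvPolynomial.algebraMap_eq, AlgHom.commutes]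
    exact (Polynomial.map_C (algebraMap (MvPolynomial (Fin m) ℂ) (RatFuncField m))).symm
  | add p q hp hq =>
    rw [map_add, Polynomial.map_add, ← hp, ← hq]
    exact MvPolynomial.eval₂_add _ _
  | mul_X p i hp =>
    rw [map_mul, Polynomial.map_mul, ← hp, genericLine_X, Polynomial.map_add, Polynomial.map_mul,
      map_C, map_C, map_X]
    exact (MvPolynomial.eval₂_mul _ _).trans (congrArg _ (MvPolynomial.eval₂_X _ _ _))

lemma BadRoots.of_C_mul {d : ℕ} {c : ℂ} (hc : c ≠ 0) {f : ℂ[X]} (h : BadRoots d (C c * f)) :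
    BadRoots d f := by
  obtain ⟨ζ, hζ, h⟩ := h
  refine ⟨ζ, ?_, h⟩
  rw [coeff_C_mul, C_mul, mul_assoc] at hζ
  exact mul_left_cancel₀ (C_ne_zero.2 hc) hζ

lemma nonempty_algEquiv_mulEquiv_perm {E : Type*} [Field E] [Algebra ℂ E]
    [Algebra (MvPolynomial (Fin m) ℂ) E] [IsScalarTower ℂ (MvPolynomial (Fin m) ℂ) E]
    [Algebra (RatFuncField m) E] [IsScalarTower (MvPolynomial (Fin m) ℂ) (RatFuncField m) E] {d : ℕ} (hd : 2 ≤ d)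
    {F : MvPolynomial (Fin m) ℂ} (hF : F.IsHomogeneous d)
    (hsm : ∀ x : Fin m → ℂ, x ≠ 0 → ∃ i, MvPolynomial.eval x (MvPolynomial.pderiv i F) ≠ 0)
    (hm : 3 ≤ m) {P : Fin m → ℂ} (hP : MvPolynomial.eval P F ≠ 0)
    [hE : IsSplittingField (RatFuncField m) E (fFP F P)]
    (htan : ∃ x : Fin m → ℂ, ¬ BadRoots d (line x P F) ∧ ¬ (line x P F).Separable ∧
      ∀ a : ℂ, (fun i => x i + a * P i) ≠ 0)
    (hindec : ∀ l e, 2 ≤ l → 2 ≤ e → l * e = d → ∃ x : Fin m → ℂ, ¬ ∃ g h : ℂ[X], g.Monic ∧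
      g.natDegree = e ∧ h.Monic ∧ h.natDegree = l ∧
      line x P F = C (MvPolynomial.eval P F) * g.comp h) :
    Nonempty ((E ≃ₐ[RatFuncField m] E) ≃* Equiv.Perm (Fin d)) := by
  classical
  set u := MvPolynomial.eval P F with hu
  obtain ⟨F', hF'⟩ : ∃ F', F' = MvPolynomial.C u⁻¹ * F := ⟨_, rfl⟩
  have hFF' : F = MvPolynomial.C u * F' := by
    rw [hF', ← mul_assoc, ← MvPolynomial.C_mul, mul_inv_cancel₀ hP, MvPolynomial.C_1, one_mul]
  have hF'h : F'.IsHomogeneous d := by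
    have := (MvPolynomial.isHomogeneous_C (Fin m) u⁻¹).mul hF
    rwa [zero_add, ← hF'] at this
  have hP' : MvPolynomial.eval P F' = 1 := by
    rw [hF', map_mul, MvPolynomial.eval_C, ← hu, inv_mul_cancel₀ hP]
  have hline : ∀ x, line x P F = C u * line x P F' := by
    intro x
    rw [hFF', map_mul, ← MvPolynomial.algebraMap_eq, AlgHom.commutes]
    rfl
  have hsm' : ∀ x : Fin m → ℂ, x ≠ 0 →
      ∃ i, MvPolynomial.eval x (MvPolynomial.pderiv i F') ≠ 0 := by
    intro x hx
    obtain ⟨i, hi⟩ := hsm x hx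
    refine ⟨i, fun h => hi ?_⟩
    rw [hFF', MvPolynomial.pderiv_C_mul, map_mul, h, mul_zero]
  obtain ⟨hmon, hdeg⟩ := genericLine_monic hF'h hP'
  have hirr : Irreducible ((genericLine P F').map
      (algebraMap (MvPolynomial (Fin m) ℂ) (RatFuncField m))) :=
    hmon.irreducible_iff_irreducible_map_fraction_map.1
      (genericLine_irreducible (by omega) hF'h hsm' hm hP')
  have hchar : CharZero (RatFuncField m) :=
    charZero_of_injective_algebraMap (algebraMap ℂ (RatFuncField m)).injective
  have hsep := hirr.separable
  let u' : RatFuncField m := algebraMap (MvPolynomial (Fin m) ℂ) (RatFuncField m) (MvPolynomial.C u)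
  have hu' : u' ≠ 0 := by
    intro h
    have := IsFractionRing.injective (MvPolynomial (Fin m) ℂ) (RatFuncField m)
      (h.trans (map_zero _).symm)
    rw [MvPolynomial.C_eq_zero] at this
    exact hP this
  have hfF : fFP F P = C u' * fFP F' P := by
    rw [fFP_eq_map_genericLine, fFP_eq_map_genericLine, hFF', map_mul, Polynomial.map_mul,
      ← MvPolynomial.algebraMap_eq, AlgHom.commutes]
    exact congrArg (· * _) (map_C _)
  have hf'0 : fFP F' P ≠ 0 := by rw [fFP_eq_map_genericLine]; exact hirr.ne_zero
  have hsplit : ((fFP F' P).map (algebraMap (RatFuncField m) E)).Splits := by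
    have h := IsSplittingField.splits E (fFP F P)
    refine h.of_dvd (Polynomial.map_ne_zero ?_) (Polynomial.map_dvd _ ?_)
    · rw [hfF]
      exact mul_ne_zero (C_ne_zero.2 hu') hf'0
    · exact hfF ▸ Dvd.intro_left _ rfl
  have hGal : IsGalois (RatFuncField m) E := by
    refine IsGalois.of_separable_splitting_field (p := fFP F P) ?_
    rw [hfF, fFP_eq_map_genericLine]
    exact Separable.unit_mul (isUnit_C.2 (isUnit_iff_ne_zero.2 hu')) hsep
  have hfin : FiniteDimensional (RatFuncField m) E := IsSplittingField.finiteDimensional E (fFP F P)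
  refine nonempty_mulEquiv_perm_of_tangent (E := E) hd hF'h hsm' hm hP'
    (R := ((fFP F' P).map (algebraMap (RatFuncField m) E)).roots.toFinset)
    ?_ ?_ ?_ ?_
  · have h1 := hsplit.eq_prod_roots_of_monic
      (by rw [fFP_eq_map_genericLine]; exact (hmon.map _).map _)
    rw [IsScalarTower.algebraMap_eq (MvPolynomial (Fin m) ℂ) (RatFuncField m)
      E, ← map_map, ← fFP_eq_map_genericLine]
    refine h1.trans ?_
    rw [Finset.prod, Multiset.toFinset_val, Multiset.dedup_eq_self.2]
    refine nodup_roots (p := (fFP F' P).map (algebraMap (RatFuncField m) E)) ?_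
    rw [fFP_eq_map_genericLine]
    exact hsep.map
  · intro σ h
    have h1 : (σ : E →ₐ[RatFuncField m] E) = AlgHom.id _ _ := by
      refine AlgHom.ext_of_adjoin_eq_top (IsSplittingField.adjoin_rootSet E (fFP F P))
        fun ρ hρ => h ρ ?_
      rw [Multiset.mem_toFinset, mem_roots (Polynomial.map_ne_zero hf'0), IsRoot.def, eval_map]
      rw [mem_rootSet, hfF, map_mul, aeval_C, mul_eq_zero] at hρ
      rcases hρ.2 with h0 | h0
      · exact absurd ((map_eq_zero _).1 h0) hu'
      · exact h0
    exact AlgEquiv.ext fun x => congrArg (fun f => f x) h1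
  · obtain ⟨x, hb, hns, hx0⟩ := htan
    have hline' : line x P F' = C u⁻¹ * line x P F := by
      rw [hline, ← mul_assoc, ← C_mul, inv_mul_cancel₀ hP, C_1, one_mul]
    obtain ⟨a, Z, hZ, h⟩ := exists_comp_eq_sq_mul_prod (d := d) (f := line x P F')
      (line_natDegree_le hF'h x P) (by rw [line_coeff_top_complex hF'h, hP'])
      (fun h => hb ((hline' ▸ h).of_C_mul (inv_ne_zero hP)))
      (fun h => hns (hline x ▸ h.unit_mul (isUnit_C.2 (isUnit_iff_ne_zero.2 hP))))
    refine ⟨_, hsm' _ (hx0 a), Z, hZ, ?_⟩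
    rw [← line_comp, h]
  · intro l e hl he hle
    obtain ⟨x, hx⟩ := hindec l e hl he hle
    refine ⟨x, fun ⟨g, h, hg, hgd, hh, hhd, hgh⟩ => hx ⟨g, h, hg, hgd, hh, hhd, ?_⟩⟩
    rw [hline, hgh]

theorem nonempty_gal_mulEquiv_perm {d : ℕ} (hd : 2 ≤ d)
    {F : MvPolynomial (Fin m) ℂ} (hF : F.IsHomogeneous d)
    (hsm : ∀ x : Fin m → ℂ, x ≠ 0 → ∃ i, MvPolynomial.eval x (MvPolynomial.pderiv i F) ≠ 0)
    (hm : 3 ≤ m) {P : Fin m → ℂ} (hP : MvPolynomial.eval P F ≠ 0)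
    (htan : ∃ x : Fin m → ℂ, ¬ BadRoots d (line x P F) ∧ ¬ (line x P F).Separable ∧
      ∀ a : ℂ, (fun i => x i + a * P i) ≠ 0)
    (hindec : ∀ l e, 2 ≤ l → 2 ≤ e → l * e = d → ∃ x : Fin m → ℂ, ¬ ∃ g h : ℂ[X], g.Monic ∧
      g.natDegree = e ∧ h.Monic ∧ h.natDegree = l ∧
      line x P F = C (MvPolynomial.eval P F) * g.comp h) :
    Nonempty ((fFP F P).Gal ≃* Equiv.Perm (Fin d)) := by
  have htower : IsScalarTower ℂ (MvPolynomial (Fin m) ℂ) (fFP F P).SplittingField :=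
    IsScalarTower.to₁₂₄ ℂ (MvPolynomial (Fin m) ℂ) (RatFuncField m) (fFP F P).SplittingField
  exact nonempty_algEquiv_mulEquiv_perm (E := (fFP F P).SplittingField) hd hF hsm hm hP htan hindec

end GaloisGroup

section LineDiscriminant

open Polynomial

variable {m : ℕ}

lemma resultant_derivative_prod_X_sub_C {d : ℕ} {c : ℂ} (hc : c ≠ 0) (ζ : Fin d → ℂ) :
    resultant (C c * ∏ a, (X - C (ζ a))) (derivative (C c * ∏ a, (X - C (ζ a)))) d (d - 1) =
      c ^ (d - 1) * ∏ a, (c * ∏ b ∈ Finset.univ.erase a, (ζ a - ζ b)) := by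
  set f : ℂ[X] := C c * ∏ a, (X - C (ζ a)) with hf
  have hdeg : f.natDegree = d := by
    rw [hf, natDegree_C_mul hc, natDegree_finsetProd_X_sub_C_eq_card]
    simp
  have hlead : f.leadingCoeff = c := by
    rw [hf, leadingCoeff_mul, leadingCoeff_C, leadingCoeff_prod]
    simp
  have hroots : f.roots = Finset.univ.val.map ζ := by
    rw [hf, roots_C_mul _ hc]
    refine Eq.trans ?_ (roots_multiset_prod_X_sub_C (Finset.univ.val.map ζ))
    rw [Multiset.map_map]
    rfl
  have h := resultant_eq_prod_eval f (derivative f) (d - 1)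
    ((natDegree_derivative_le f).trans (by rw [hdeg])) (IsAlgClosed.splits f)
  rw [hdeg, hlead, hroots, Multiset.map_map] at h
  rw [h]
  congr 1
  refine Finset.prod_congr rfl fun a _ => ?_
  have h1 := Lagrange.eval_nodal_derivative_eval_node_eq (v := ζ) (Finset.mem_univ a)
  simp only [Lagrange.eval_nodal] at h1
  rw [← h1, Function.comp, hf, derivative_C_mul, eval_C_mul]
  rfl

/-- The discriminant, up to a constant, of the restriction of `F` to the line `x + tP`. -/
noncomputable def lineDisc {R : Type*} [CommRing R] [Algebra ℂ R] (d : ℕ) (x P : Fin m → R)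
    (F : MvPolynomial (Fin m) ℂ) : R :=
  resultant (line x P F) (derivative (line x P F)) d (d - 1)

variable {d : ℕ} {F : MvPolynomial (Fin m) ℂ} {P : Fin m → ℂ}

lemma exists_line_roots (hF : F.IsHomogeneous d) (hP : MvPolynomial.eval P F ≠ 0)
    (x : Fin m → ℂ) : ∃ ζ : Fin d → ℂ,
      line x P F = C (MvPolynomial.eval P F) * ∏ a, (X - C (ζ a)) := by
  have h := exists_roots_of_natDegree_le (line_natDegree_le hF x P)
    (by rwa [line_coeff_top_complex hF])
  rwa [line_coeff_top_complex hF] at h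

lemma lineDisc_eq_prod (hP : MvPolynomial.eval P F ≠ 0) {x : Fin m → ℂ} {ζ : Fin d → ℂ}
    (h : line x P F = C (MvPolynomial.eval P F) * ∏ a, (X - C (ζ a))) :
    lineDisc d x P F = MvPolynomial.eval P F ^ (d - 1) *
      ∏ a, (MvPolynomial.eval P F * ∏ b ∈ Finset.univ.erase a, (ζ a - ζ b)) := by
  rw [lineDisc, h, resultant_derivative_prod_X_sub_C hP]

lemma lineDisc_ne_zero_iff (hF : F.IsHomogeneous d) (hP : MvPolynomial.eval P F ≠ 0)
    (x : Fin m → ℂ) : lineDisc d x P F ≠ 0 ↔ (line x P F).Separable := by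
  obtain ⟨ζ, h⟩ := exists_line_roots hF hP x
  have hu : IsUnit (C (MvPolynomial.eval P F)) :=
    isUnit_C.2 (isUnit_iff_ne_zero.2 hP)
  rw [lineDisc_eq_prod hP h, h]
  have h1 : (C (MvPolynomial.eval P F) * ∏ a, (X - C (ζ a))).Separable ↔
      Function.Injective ζ := by
    rw [← separable_prod_X_sub_C_iff]
    exact ⟨fun h => h.of_mul_right, fun h => h.unit_mul hu⟩
  rw [h1]
  simp only [ne_eq, mul_eq_zero, pow_eq_zero_iff', hP, false_and, false_or,
    Finset.prod_eq_zero_iff, Finset.mem_univ, true_and, Finset.mem_erase, sub_eq_zero]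
  constructor
  · intro h a b hab
    by_contra hne
    exact h ⟨a, b, ⟨fun h => hne h.symm, trivial⟩, hab⟩
  · rintro h ⟨a, b, ⟨hne, -⟩, hab⟩
    exact hne (h hab).symm

lemma lineDisc_add_smul (hF : F.IsHomogeneous d) (hP : MvPolynomial.eval P F ≠ 0)
    (x : Fin m → ℂ) (c : ℂ) : lineDisc d (fun i => x i + c * P i) P F = lineDisc d x P F := by
  obtain ⟨ζ, h⟩ := exists_line_roots hF hP x
  have h' : line (fun i => x i + c * P i) P F =
      C (MvPolynomial.eval P F) * ∏ a, (X - C (ζ a - c)) := by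
    rw [← line_comp, h, mul_comp, C_comp, Polynomial.prod_comp]
    congr 1
    refine Finset.prod_congr rfl fun a _ => ?_
    rw [sub_comp, X_comp, C_comp, C_sub]
    ring
  rw [lineDisc_eq_prod hP h, lineDisc_eq_prod hP h']
  simp

lemma lineDisc_smul (hF : F.IsHomogeneous d) (hP : MvPolynomial.eval P F ≠ 0)
    (x : Fin m → ℂ) {c : ℂ} (hc : c ≠ 0) :
    lineDisc d (fun i => c * x i) P F = c ^ (d * (d - 1)) * lineDisc d x P F := by
  obtain ⟨ζ, h⟩ := exists_line_roots hF hP x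
  have h' : line (fun i => c * x i) P F =
      C (MvPolynomial.eval P F) * ∏ a, (X - C (c * ζ a)) := by
    refine Polynomial.funext fun t => ?_
    have h1 : (fun i => c * x i + t * P i) = fun i => c * (x i + (c⁻¹ * t) * P i) := by
      funext i
      field_simp
    rw [line_eval, h1, aeval_mul_of_isHomogeneous hF, ← line_eval, h, eval_mul, eval_mul,
      eval_C, eval_C, eval_prod, eval_prod, mul_left_comm]
    have h2 : c ^ d = ∏ _a : Fin d, c := by simp
    rw [h2, ← Finset.prod_mul_distrib]
    congr 1
    refine Finset.prod_congr rfl fun a _ => ?_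
    simp only [eval_sub, eval_X, eval_C]
    field_simp
  rw [lineDisc_eq_prod hP h, lineDisc_eq_prod hP h', mul_left_comm]
  congr 1
  rw [mul_comm d, pow_mul]
  have h2 : (c ^ (d - 1)) ^ d = ∏ _a : Fin d, c ^ (d - 1) := by simp
  rw [h2, ← Finset.prod_mul_distrib]
  refine Finset.prod_congr rfl fun a _ => ?_
  have h3 : c ^ (d - 1) = ∏ _b ∈ Finset.univ.erase a, c := by simp
  rw [mul_left_comm, h3, ← Finset.prod_mul_distrib]
  congr 1
  exact Finset.prod_congr rfl fun b _ => by ring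

/-- The discriminant of the pencil of lines `v + su + tP`, as a polynomial in `s`. -/
noncomputable def pencilDisc (d : ℕ) (v u P : Fin m → ℂ) (F : MvPolynomial (Fin m) ℂ) : ℂ[X] :=
  lineDisc d (fun i => C (v i) + X * C (u i)) (fun i => C (P i)) F

lemma pencil_map (v u P : Fin m → ℂ) (F : MvPolynomial (Fin m) ℂ) (s : ℂ) :
    (line (R := ℂ[X]) (fun i => C (v i) + X * C (u i)) (fun i => C (P i)) F).map (evalRingHom s) =
      line (fun i => v i + s * u i) P F := by
  have h := line_map (aeval s : ℂ[X] →ₐ[ℂ] ℂ) (fun i => C (v i) + X * C (u i)) (fun i => C (P i)) F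
  have h1 : (aeval s : ℂ[X] →ₐ[ℂ] ℂ).toRingHom = evalRingHom s := by
    ext <;> simp
  rw [h1] at h
  rw [h]
  simp only [map_add, map_mul, aeval_C, aeval_X, Algebra.algebraMap_self_apply]

lemma pencilDisc_eval (d : ℕ) (v u P : Fin m → ℂ) (F : MvPolynomial (Fin m) ℂ) (s : ℂ) :
    (pencilDisc d v u P F).eval s = lineDisc d (fun i => v i + s * u i) P F := by
  rw [lineDisc, ← pencil_map, derivative_map, resultant_map_map]
  rfl

lemma le_natDegree_pencilDisc (hF : F.IsHomogeneous d)
    (hP : MvPolynomial.eval P F ≠ 0) {u : Fin m → ℂ} (hu : (line u P F).Separable)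
    (v : Fin m → ℂ) : d * (d - 1) ≤ (pencilDisc d v u P F).natDegree := by
  by_contra! hlt
  set N := d * (d - 1)
  have h0 : (reflect N (pencilDisc d v u P F)).eval 0 = 0 := by
    rw [← coeff_zero_eq_eval_zero, coeff_reflect, revAt_le (Nat.zero_le N), Nat.sub_zero]
    exact coeff_eq_zero_of_natDegree_lt hlt
  have h1 : (pencilDisc d u v P F).eval 0 ≠ 0 := by
    rw [pencilDisc_eval]
    simpa using (lineDisc_ne_zero_iff hF hP u).2 hu
  have h2 : X * pencilDisc d u v P F = X * reflect N (pencilDisc d v u P F) := by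
    refine Polynomial.funext fun s => ?_
    rw [eval_mul, eval_mul, eval_X]
    by_cases hs : s = 0
    · simp [hs]
    · congr 1
      let _ : Invertible s⁻¹ := invertibleOfNonzero (inv_ne_zero hs)
      have h3 := eval₂_reflect_mul_pow (RingHom.id ℂ) s⁻¹ N (pencilDisc d v u P F) hlt.le
      rw [invOf_eq_inv, inv_inv] at h3
      change (reflect N (pencilDisc d v u P F)).eval s * _ = (pencilDisc d v u P F).eval s⁻¹ at h3
      have h4 : (fun i => u i + s * v i) = fun i => s * (v i + s⁻¹ * u i) := by
        funext i
        field_simp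
        ring
      rw [pencilDisc_eval, h4, lineDisc_smul hF hP _ hs, ← pencilDisc_eval, ← h3, mul_left_comm,
        ← mul_pow, mul_inv_cancel₀ hs, one_pow, mul_one]
  rw [mul_left_cancel₀ X_ne_zero h2] at h1
  exact h1 h0

end LineDiscriminant

section DiscriminantMultiplicity

open Polynomial UniqueFactorizationMonoid EuclideanDomain

lemma exists_radical_factorization {f : ℂ[X]} (hf : 0 < f.natDegree) :
    ∃ r h k : ℂ[X], f = r * h ∧ derivative f = h * k ∧ r.natDegree + h.natDegree = f.natDegree ∧
      k.natDegree + 1 ≤ r.natDegree ∧ (∀ ζ, f.IsRoot ζ → r.IsRoot ζ) ∧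
      ∀ ζ, f.IsRoot ζ → k.eval ζ ≠ 0 := by
  have hf0 : f ≠ 0 := fun h => by simp [h] at hf
  obtain ⟨k, hk⟩ := divRadical_dvd_derivative f
  have hrh : radical f * divRadical f = f := radical_mul_divRadical
  have hh0 : divRadical f ≠ 0 := divRadical_ne_zero hf0
  have hr0 : radical f ≠ 0 := radical_ne_zero
  have hd0 : derivative f ≠ 0 := fun h => by
    rw [derivative_eq_zero.1 h] at hf
    exact lt_irrefl _ hf
  have hk0 : k ≠ 0 := fun h => hd0 (by rw [hk, h, mul_zero])
  have hdeg : (radical f).natDegree + (divRadical f).natDegree = f.natDegree := by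
    rw [← natDegree_mul hr0 hh0, hrh]
  have hroot : ∀ ζ, f.IsRoot ζ → (radical f).IsRoot ζ := fun ζ hζ => by
    rw [← dvd_iff_isRoot]
    exact (dvd_radical_iff (irreducible_X_sub_C ζ).prime.isRadical hf0).2 (dvd_iff_isRoot.2 hζ)
  refine ⟨radical f, divRadical f, k, hrh.symm, hk, hdeg, ?_, hroot, ?_⟩
  · have h1 := natDegree_derivative_lt hf.ne'
    rw [hk, natDegree_mul hh0 hk0] at h1
    omega
  · intro ζ hζ h0
    have h1 := derivative_rootMultiplicity_of_root hζ
    rw [hk, rootMultiplicity_mul (hk ▸ hd0)] at h1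
    have h2 : f.rootMultiplicity ζ =
        (radical f).rootMultiplicity ζ + (divRadical f).rootMultiplicity ζ := by
      rw [← rootMultiplicity_mul (by rwa [hrh]), hrh]
    have h3 : (radical f).rootMultiplicity ζ ≤ 1 := by
      by_contra! hlt
      have h4 := (le_rootMultiplicity_iff hr0).1 (Nat.succ_le_of_lt hlt)
      rw [Nat.succ_eq_add_one, one_add_one_eq_two, sq] at h4
      exact not_isUnit_X_sub_C ζ (squarefree_radical _ h4)
    have h5 := (rootMultiplicity_pos hk0).2 h0
    have h6 := (rootMultiplicity_pos hr0).2 (hroot ζ hζ)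
    omega

lemma rootMultiplicity_resultant_derivative_le {d : ℕ} (hd : 2 ≤ d) {f : ℂ[X][X]}
    (hf : f.natDegree ≤ d) {c : ℂ} (hc : c ≠ 0) (hfc : f.coeff d = C c) {s : ℂ}
    (hs : ∀ ζ, (f.map (evalRingHom s)).IsRoot ζ → (derivative (f.eval (C ζ))).eval s ≠ 0) :
    (resultant f (derivative f) d (d - 1)).rootMultiplicity s ≤ d - 1 := by
  set f₀ := f.map (evalRingHom s) with hf₀
  have hf₀c : f₀.coeff d = c := by rw [hf₀, coeff_map, hfc]; simp
  have hf₀d : f₀.natDegree = d :=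
    le_antisymm (natDegree_map_le.trans hf) (le_natDegree_of_ne_zero (by rwa [hf₀c]))
  have hfd : f.natDegree = d :=
    le_antisymm hf (le_natDegree_of_ne_zero (by rw [hfc]; exact C_ne_zero.2 hc))
  have hdfd : (derivative f).natDegree = d - 1 := by rw [natDegree_derivative, hfd]
  obtain ⟨r, h, k, hrh, hhk, hdeg, hkr, hroot, hk⟩ :=
    exists_radical_factorization (f := f₀) (by omega)
  obtain ⟨φ, hφ⟩ : C (X - C s) ∣ f - f₀.map C := by
    rw [C_dvd_iff_dvd_coeff]
    intro i
    rw [coeff_sub, coeff_map, hf₀, coeff_map, dvd_iff_isRoot]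
    simp
  have hfφ : f = f₀.map C + C (X - C s) * φ := by rw [← hφ]; ring
  have hφd : φ.natDegree ≤ d := by
    rw [natDegree_le_iff_coeff_eq_zero]
    intro N hN
    have h1 := congrArg (fun q => q.coeff N) hφ
    simp only [coeff_sub, coeff_C_mul, coeff_map] at h1
    rw [coeff_eq_zero_of_natDegree_lt (hf.trans_lt hN),
      coeff_eq_zero_of_natDegree_lt (hf₀d.le.trans_lt hN), C_0, sub_zero, eq_comm] at h1
    exact (mul_eq_zero.1 h1).resolve_left (X_sub_C_ne_zero s)
  have hrC : (r.map C).natDegree = r.natDegree := natDegree_map_eq_of_injective C_injective r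
  set ψ := r.map C * derivative φ - φ * k.map C with hψ
  have key : r.map C * derivative f + f * (-(k.map C)) = C (X - C s) * ψ := by
    have h1 : derivative f = (derivative f₀).map C + C (X - C s) * derivative φ := by
      conv_lhs => rw [hfφ]
      rw [derivative_add, derivative_C_mul, derivative_map]
    rw [h1, hhk]
    conv_lhs => rw [hfφ, hrh]
    rw [hψ, Polynomial.map_mul, Polynomial.map_mul]
    ring
  have hres : resultant f (r.map C) d r.natDegree * resultant f (derivative f) d (d - 1) =
      (X - C s) ^ d * resultant f ψ d (r.natDegree + (d - 1)) := by
    rw [← resultant_C_mul_right, ← key, resultant_add_mul_right _ _ _ _ _ _ hf]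
    · have h1 := resultant_mul_right f (r.map C) (derivative f) d hf
      rw [hrC, hdfd] at h1
      exact h1.symm
    · rw [natDegree_neg, natDegree_map_eq_of_injective C_injective]
      omega
  have hmap : ∀ g : ℂ[X], (g.map C).map (evalRingHom s) = g := fun g => by
    rw [Polynomial.map_map]
    exact (congrArg (fun φ => g.map φ) (RingHom.ext fun a => by simp)).trans g.map_id
  have hsp := IsAlgClosed.splits f₀
  have hlead : f₀.leadingCoeff = c := by rw [leadingCoeff, hf₀d, hf₀c]
  have hev : ∀ (g : ℂ[X][X]) (n : ℕ), (resultant f g d n).eval s =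
      resultant f₀ (g.map (evalRingHom s)) d n := fun g n =>
    (resultant_map_map f g d n (evalRingHom s)).symm
  have hφ0 : ∀ ζ, f₀.IsRoot ζ → (φ.map (evalRingHom s)).eval ζ ≠ 0 := by
    intro ζ hζ h0
    refine hs ζ hζ ?_
    rw [hfφ, eval_add, eval_C_mul, eval_map, eval₂_at_apply, derivative_add, derivative_C,
      derivative_mul, zero_add, eval_add, eval_mul, eval_mul]
    rw [map_evalRingHom_eval] at h0
    change eval s (eval (C ζ) φ) = 0 at h0
    simp [h0]
  have hψ0 : (resultant f ψ d (r.natDegree + (d - 1))).eval s ≠ 0 := by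
    have h1 := resultant_eq_prod_eval f₀ (ψ.map (evalRingHom s)) (r.natDegree + (d - 1))
      (natDegree_map_le.trans ?_) hsp
    · rw [hf₀d] at h1
      rw [hev, h1, hlead]
      refine mul_ne_zero (pow_ne_zero _ hc) (Multiset.prod_ne_zero ?_)
      rw [Multiset.mem_map]
      rintro ⟨ζ, hζ, h2⟩
      have hζ' := isRoot_of_mem_roots hζ
      rw [hψ, Polynomial.map_sub, Polynomial.map_mul, Polynomial.map_mul, hmap, hmap, eval_sub,
        eval_mul, eval_mul, (hroot ζ hζ').eq_zero, zero_mul, zero_sub, neg_eq_zero] at h2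
      exact mul_ne_zero (hφ0 ζ hζ') (hk ζ hζ') h2
    · refine (natDegree_sub_le _ _).trans (max_le ?_ ?_)
      · refine natDegree_mul_le.trans ?_
        rw [hrC]
        exact Nat.add_le_add_left ((natDegree_derivative_le φ).trans (by omega)) _
      · refine natDegree_mul_le.trans ?_
        rw [natDegree_map_eq_of_injective C_injective]
        omega
  have hr0 : (resultant f (r.map C) d r.natDegree).eval s = 0 := by
    obtain ⟨ζ, hζ⟩ := IsAlgClosed.exists_root f₀ (by
      rw [degree_eq_natDegree (fun h => by simp [h] at hf₀d; omega), hf₀d]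
      exact_mod_cast (by omega : d ≠ 0))
    have h1 := resultant_eq_prod_eval f₀ r r.natDegree le_rfl hsp
    rw [hf₀d] at h1
    rw [hev, hmap, h1, Multiset.prod_eq_zero, mul_zero]
    rw [Multiset.mem_map]
    exact ⟨ζ, (mem_roots (fun h => by simp [h] at hf₀d; omega)).2 hζ, (hroot ζ hζ).eq_zero⟩
  have hψne : resultant f ψ d (r.natDegree + (d - 1)) ≠ 0 := fun h => hψ0 (by rw [h, eval_zero])
  have hrhs : (X - C s) ^ d * resultant f ψ d (r.natDegree + (d - 1)) ≠ 0 :=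
    mul_ne_zero (pow_ne_zero _ (X_sub_C_ne_zero s)) hψne
  have h1 := congrArg (rootMultiplicity s) hres
  have hlhs := hres ▸ hrhs
  rw [rootMultiplicity_mul hlhs, rootMultiplicity_mul hrhs, rootMultiplicity_X_sub_C_pow,
    rootMultiplicity_eq_zero hψ0] at h1
  have h2 := (rootMultiplicity_pos (left_ne_zero_of_mul hlhs)).2 hr0
  omega

end DiscriminantMultiplicity

section TangentLines

open Polynomial

variable {m d : ℕ} {F : MvPolynomial (Fin m) ℂ} {P : Fin m → ℂ}

lemma pencilDisc_add_smul (hF : F.IsHomogeneous d) (hP : MvPolynomial.eval P F ≠ 0)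
    (v u : Fin m → ℂ) (c : ℂ) :
    pencilDisc d v (fun i => u i + c * P i) P F = pencilDisc d v u P F := by
  refine Polynomial.funext fun s => ?_
  rw [pencilDisc_eval, pencilDisc_eval, ← lineDisc_add_smul hF hP (fun i => v i + s * u i) (s * c)]
  congr 1
  funext i
  ring

lemma rootMultiplicity_pencilDisc_le_of_transverse (hd : 2 ≤ d) (hF : F.IsHomogeneous d)
    (hP : MvPolynomial.eval P F ≠ 0) {v u : Fin m → ℂ} {s : ℂ}
    (hs : ∀ ζ, (line (fun i => v i + s * u i) P F).IsRoot ζ →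
      ∑ i, u i * MvPolynomial.eval (fun i => v i + s * u i + ζ * P i) (MvPolynomial.pderiv i F) ≠ 0) :
    (pencilDisc d v u P F).rootMultiplicity s ≤ d - 1 := by
  refine rootMultiplicity_resultant_derivative_le hd (line_natDegree_le hF _ _) hP ?_ fun ζ hζ => ?_
  · rw [line_coeff_top hF]
    exact MvPolynomial.aeval_algebraMap_apply ℂ[X] P F
  · rw [pencil_map] at hζ
    have h1 : (line (R := ℂ[X]) (fun i => C (v i) + X * C (u i)) (fun i => C (P i)) F).eval (C ζ) =
        line (fun i => v i + ζ * P i) u F := by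
      rw [line_eval, line]
      congr 2
      funext i
      rw [C_add, C_mul]
      ring
    rw [h1, line_derivative, eval_finsetSum]
    convert hs ζ hζ using 2 with i
    rw [eval_mul, eval_C, line_eval, MvPolynomial.aeval_eq_eval]
    congr 3
    funext j
    ring

lemma exists_add_mul_ne_zero {ι : Type*} (T : Finset ι) (a b : ι → ℂ)
    (h : ∀ i ∈ T, a i ≠ 0 ∨ b i ≠ 0) : ∃ c : ℂ, ∀ i ∈ T, a i + c * b i ≠ 0 := by
  have hne : ∏ i ∈ T, (C (a i) + X * C (b i)) ≠ 0 := by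
    rw [Finset.prod_ne_zero_iff]
    intro i hi h0
    have h1 := congrArg (fun p => coeff p 0) h0
    have h2 := congrArg (fun p => coeff p 1) h0
    simp at h1 h2
    exact (h i hi).elim (fun h => h h1) (fun h => h h2)
  obtain ⟨c, hc⟩ := Polynomial.exists_eval_ne_zero_of_natDegree_lt_card _ hne
    (by simpa using Cardinal.natCast_lt_aleph0.trans_le (Cardinal.aleph0_le_mk ℂ))
  refine ⟨c, fun i hi h0 => hc ?_⟩
  rw [eval_prod]
  refine Finset.prod_eq_zero hi ?_
  rw [eval_add, eval_mul, eval_C, eval_C, eval_X, h0]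

lemma rootMultiplicity_pencilDisc_le (hd : 2 ≤ d) (hF : F.IsHomogeneous d)
    (hsm : ∀ x : Fin m → ℂ, x ≠ 0 → ∃ i, MvPolynomial.eval x (MvPolynomial.pderiv i F) ≠ 0)
    (hP : MvPolynomial.eval P F ≠ 0) {v u : Fin m → ℂ}
    (hspan : ∀ w : Fin m → ℂ, ∃ α β γ : ℂ, ∀ i, w i = α * v i + β * u i + γ * P i)
    (hne : ∀ s a : ℂ, (fun i => v i + s * u i + a * P i) ≠ 0) (s : ℂ) :
    (pencilDisc d v u P F).rootMultiplicity s ≤ d - 1 := by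
  set y : ℂ → Fin m → ℂ := fun ζ i => v i + s * u i + ζ * P i with hy
  set f := line (fun i => v i + s * u i) P F with hf
  set D : (Fin m → ℂ) → ℂ → ℂ := fun w ζ =>
    ∑ i, w i * MvPolynomial.eval (y ζ) (MvPolynomial.pderiv i F) with hD
  have hf0 : f ≠ 0 := fun h => by
    have := line_coeff_top_complex hF (fun i => v i + s * u i) P
    rw [← hf, h, coeff_zero] at this
    exact hP this.symm
  have hDne : ∀ ζ ∈ f.roots.toFinset, D u ζ ≠ 0 ∨ D P ζ ≠ 0 := by
    intro ζ hζ
    have hζ' : f.IsRoot ζ := isRoot_of_mem_roots (Multiset.mem_toFinset.1 hζ)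
    by_contra! h
    have hFy : MvPolynomial.eval (y ζ) F = 0 := by
      have h1 := hζ'.eq_zero
      rwa [hf, line_eval, MvPolynomial.aeval_eq_eval] at h1
    have hDy : D (y ζ) ζ = 0 := by
      have h1 := congrArg (MvPolynomial.eval (y ζ)) hF.sum_X_mul_pderiv
      simpa [hFy] using h1
    have hDv : D v ζ = 0 := by
      have h1 : D (y ζ) ζ = D v ζ + s * D u ζ + ζ * D P ζ := by
        simp only [hD, Finset.mul_sum, ← Finset.sum_add_distrib]
        refine Finset.sum_congr rfl fun i _ => ?_
        change (v i + s * u i + ζ * P i) * _ = _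
        ring
      rwa [h.1, h.2, hDy, mul_zero, mul_zero, add_zero, add_zero, eq_comm] at h1
    obtain ⟨j, hj⟩ := hsm (y ζ) (hne s ζ)
    obtain ⟨α, β, γ, hw⟩ := hspan (Pi.single j 1)
    have h1 : D (Pi.single j 1) ζ = α * D v ζ + β * D u ζ + γ * D P ζ := by
      simp only [hD, Finset.mul_sum, ← Finset.sum_add_distrib]
      refine Finset.sum_congr rfl fun i _ => ?_
      rw [hw]
      ring
    rw [hDv, h.1, h.2] at h1
    refine hj ?_
    simpa [hD, Pi.single_apply] using h1
  obtain ⟨c, hc⟩ := exists_add_mul_ne_zero f.roots.toFinset (D u) (D P) hDne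
  rw [← pencilDisc_add_smul hF hP v u c]
  refine rootMultiplicity_pencilDisc_le_of_transverse hd hF hP fun ζ hζ => ?_
  have h1 : f.IsRoot (ζ + s * c) := by
    have h2 := hζ.eq_zero
    rw [line_eval] at h2
    change f.eval _ = 0
    rw [hf, line_eval, ← h2]
    congr 2
    funext i
    ring
  have h2 := hc (ζ + s * c) (Multiset.mem_toFinset.2 ((mem_roots hf0).2 h1))
  convert h2 using 1
  simp only [hD, Finset.mul_sum, ← Finset.sum_add_distrib]
  refine Finset.sum_congr rfl fun i _ => ?_
  have h3 : (fun i => v i + s * (u i + c * P i) + ζ * P i) = y (ζ + s * c) := by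
    funext i
    simp only [hy]
    ring
  rw [h3]
  ring

lemma exists_not_separable_of_pencil (hd : 2 ≤ d) (hF : F.IsHomogeneous d)
    (hP : MvPolynomial.eval P F ≠ 0) {u : Fin m → ℂ} (hu : (line u P F).Separable)
    (v : Fin m → ℂ) : ∃ s : ℂ, ¬ (line (fun i => v i + s * u i) P F).Separable := by
  have h1 := le_natDegree_pencilDisc hF hP hu v
  have h2 : 1 ≤ d * (d - 1) := Nat.mul_pos (by omega) (by omega)
  obtain ⟨s, hs⟩ := IsAlgClosed.exists_root (pencilDisc d v u P F) (by
    rw [degree_eq_natDegree (fun h => by rw [h, natDegree_zero] at h1; omega)]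
    exact_mod_cast (by omega : (pencilDisc d v u P F).natDegree ≠ 0))
  refine ⟨s, fun h => ?_⟩
  rw [← lineDisc_ne_zero_iff hF hP, ← pencilDisc_eval] at h
  exact h hs

lemma exists_injective_not_separable (hd : 3 ≤ d) (hF : F.IsHomogeneous d)
    (hsm : ∀ x : Fin m → ℂ, x ≠ 0 → ∃ i, MvPolynomial.eval x (MvPolynomial.pderiv i F) ≠ 0)
    (hP : MvPolynomial.eval P F ≠ 0) {v u : Fin m → ℂ} (hu : (line u P F).Separable)
    (hspan : ∀ w : Fin m → ℂ, ∃ α β γ : ℂ, ∀ i, w i = α * v i + β * u i + γ * P i)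
    (hne : ∀ s a : ℂ, (fun i => v i + s * u i + a * P i) ≠ 0) :
    ∃ s : Fin 3 → ℂ, Function.Injective s ∧
      ∀ j, ¬ (line (fun i => v i + s j * u i) P F).Separable := by
  set δ := pencilDisc d v u P F
  have h1 : d * (d - 1) ≤ δ.natDegree := le_natDegree_pencilDisc hF hP hu v
  have hδ : δ ≠ 0 := fun h => by
    rw [h, natDegree_zero] at h1
    have h2 : 1 ≤ d * (d - 1) := Nat.mul_pos (by omega) (by omega)
    omega
  have h2 : δ.natDegree ≤ δ.roots.toFinset.card * (d - 1) := by
    rw [(IsAlgClosed.splits δ).natDegree_eq_card_roots, ← Multiset.toFinset_sum_count_eq,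
      ← smul_eq_mul]
    refine Finset.sum_le_card_nsmul _ _ _ fun s _ => ?_
    rw [count_roots]
    exact rootMultiplicity_pencilDisc_le (by omega) hF hsm hP hspan hne s
  have h3 : d ≤ δ.roots.toFinset.card :=
    Nat.le_of_mul_le_mul_right (h1.trans h2) (by omega)
  obtain ⟨T, hT, hcard⟩ := Finset.exists_subset_card_eq (hd.trans h3)
  refine ⟨fun j => (T.equivFinOfCardEq hcard).symm j,
    Subtype.val_injective.comp (Equiv.injective _), fun j h => ?_⟩
  rw [← lineDisc_ne_zero_iff hF hP, ← pencilDisc_eval] at h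
  exact h (isRoot_of_mem_roots (Multiset.mem_toFinset.1
    (hT ((T.equivFinOfCardEq hcard).symm j).2)))

lemma not_badRoots_two (f : ℂ[X]) : ¬ BadRoots 2 f := by
  rintro ⟨ζ, -, a, b, c, e, hab, hce, hne, -⟩
  revert a b c e
  decide

end TangentLines

section Rescaling

open Polynomial

variable {m d : ℕ} {F : MvPolynomial (Fin m) ℂ}

lemma line_smul_comp (x P : Fin m → ℂ) (a : ℂ) :
    line x (a • P) F = (line x P F).comp (C a * X) := by
  refine Polynomial.funext fun t => ?_
  rw [eval_comp, line_eval, line_eval, eval_mul, eval_C, eval_X]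
  congr 2
  funext i
  rw [Pi.smul_apply, smul_eq_mul]
  ring

lemma Polynomial.Separable.comp_C_mul_X {f : ℂ[X]} (hf : f.Separable) {a : ℂ} (ha : a ≠ 0) :
    (f.comp (C a * X)).Separable := by
  have h := IsCoprime.map hf (compRingHom (C a * X))
  rw [coe_compRingHom_apply, coe_compRingHom_apply] at h
  rw [Separable, derivative_comp, derivative_C_mul, derivative_X, mul_one]
  exact (isCoprime_mul_unit_left_right (isUnit_C.2 (isUnit_iff_ne_zero.2 ha)) _ _).2 h

lemma BadRoots.comp_C_mul_X {f : ℂ[X]} (hf : BadRoots d f) {a : ℂ} (ha : a ≠ 0) :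
    BadRoots d (f.comp (C a * X)) := by
  obtain ⟨ζ, hζ, i, j, k, l, hij, hkl, hne, h1, h2⟩ := hf
  refine ⟨fun i => a⁻¹ * ζ i, ?_, i, j, k, l, hij, hkl, hne, congrArg (a⁻¹ * ·) h1,
    congrArg (a⁻¹ * ·) h2⟩
  rw [comp_C_mul_X_coeff]
  conv_lhs => rw [hζ]
  rw [mul_comp, C_comp, Polynomial.prod_comp, C_mul, mul_assoc]
  have h3 : C (a ^ d) = ∏ _i : Fin d, C a := by simp
  rw [h3, ← Finset.prod_mul_distrib]
  congr 1
  refine Finset.prod_congr rfl fun i _ => ?_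
  rw [sub_comp, X_comp, C_comp, mul_sub, ← C_mul, mul_inv_cancel_left₀ ha]

lemma comp_inv_smul (f : ℂ[X]) {a : ℂ} (ha : a ≠ 0) :
    (f.comp (C a * X)).comp (C a⁻¹ * X) = f := by
  rw [comp_assoc, mul_comp, C_comp, X_comp, ← mul_assoc, ← C_mul, mul_inv_cancel₀ ha, C_1, one_mul,
    comp_X]

lemma line_smul_separable_iff (x P : Fin m → ℂ) {a : ℂ} (ha : a ≠ 0) :
    (line x (a • P) F).Separable ↔ (line x P F).Separable := by
  rw [line_smul_comp]
  refine ⟨fun h => ?_, fun h => h.comp_C_mul_X ha⟩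
  rw [← comp_inv_smul (line x P F) ha]
  exact h.comp_C_mul_X (inv_ne_zero ha)

lemma BadRoots.of_line_smul {x P : Fin m → ℂ} {a : ℂ} (ha : a ≠ 0)
    (h : BadRoots d (line x (a • P) F)) : BadRoots d (line x P F) := by
  rw [line_smul_comp] at h
  rw [← comp_inv_smul (line x P F) ha]
  exact h.comp_C_mul_X (inv_ne_zero ha)

lemma exists_comp_of_line_smul {l e : ℕ} (hF : F.IsHomogeneous (l * e)) {x P : Fin m → ℂ} {a : ℂ}
    (ha : a ≠ 0)
    (h : ∃ g h : ℂ[X], g.Monic ∧ g.natDegree = e ∧ h.Monic ∧ h.natDegree = l ∧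
      line x (a • P) F = C (MvPolynomial.eval (a • P) F) * g.comp h) :
    ∃ g h : ℂ[X], g.Monic ∧ g.natDegree = e ∧ h.Monic ∧ h.natDegree = l ∧
      line x P F = C (MvPolynomial.eval P F) * g.comp h := by
  obtain ⟨g, h, hg, hge, hh, hhl, heq⟩ := h
  refine ⟨g.scaleRoots (a ^ l), h.scaleRoots a, (monic_scaleRoots_iff _).2 hg,
    (natDegree_scaleRoots _ _).trans hge, (monic_scaleRoots_iff _).2 hh,
    (natDegree_scaleRoots _ _).trans hhl, Polynomial.funext fun t => ?_⟩
  obtain ⟨t, rfl⟩ : ∃ t', t = a * t' := ⟨a⁻¹ * t, by field_simp⟩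
  have h1 := congrArg (eval t) heq
  rw [line_smul_comp, eval_comp, eval_mul, eval_C, eval_X, eval_mul, eval_C, eval_comp] at h1
  have h2 := aeval_mul_of_isHomogeneous hF a P
  rw [MvPolynomial.aeval_eq_eval, MvPolynomial.aeval_eq_eval] at h2
  change MvPolynomial.eval (a • P) F = a ^ (l * e) * MvPolynomial.eval P F at h2
  rw [h1, h2, eval_mul, eval_C, eval_comp, scaleRoots_eval_mul, hhl,
    scaleRoots_eval_mul, hge, ← pow_mul]
  ring

end Rescaling

section TangentPoints

open MvPolynomial

variable {m d k : ℕ}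

/-- Some line through `P`, avoiding the origin of the cone over `P`, is simply tangent. -/
def HasSimpleTangent (d : ℕ) (P : Fin m → ℂ) (F : MvPolynomial (Fin m) ℂ) : Prop :=
  ∃ x : Fin m → ℂ, ¬ BadRoots d (line x P F) ∧ ¬ (line x P F).Separable ∧
    ∀ a : ℂ, (fun i => x i + a * P i) ≠ 0

lemma HasSimpleTangent.smul {P : Fin m → ℂ} {F : MvPolynomial (Fin m) ℂ}
    (h : HasSimpleTangent d P F) {a : ℂ} (ha : a ≠ 0) : HasSimpleTangent d (a • P) F := by
  obtain ⟨x, h1, h2, h3⟩ := h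
  refine ⟨x, fun h => h1 (h.of_line_smul ha), fun h => h2 ((line_smul_separable_iff x P ha).1 h),
    fun c => ?_⟩
  convert h3 (c * a) using 2 with i
  rw [Pi.smul_apply, smul_eq_mul, mul_assoc]

lemma exists_eq_smul_chartPt (b : Module.Basis (Fin (k + 1)) ℂ (Fin m → ℂ)) {P : Fin m → ℂ}
    {c : Fin (k + 1)} (hc : b.repr P c ≠ 0) :
    ∃ p, P = b.repr P c • chartPt (b.reindex (finSuccEquiv' c)) p := by
  refine ⟨fun j => (b.repr P c)⁻¹ * b.repr P (c.succAbove j), ?_⟩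
  conv_lhs => rw [← b.sum_repr P, Fin.sum_univ_succAbove _ c]
  rw [chartPt, smul_add, Finset.smul_sum]
  simp only [Module.Basis.reindex_apply, finSuccEquiv'_symm_none, finSuccEquiv'_symm_some,
    smul_smul, mul_inv_cancel_left₀ hc]

variable (b : Module.Basis (Option (Fin k)) ℂ (Fin m → ℂ))

lemma repr_chartPt_none (p : Fin k → ℂ) : b.repr (chartPt b p) none = 1 := by
  simp [chartPt]

lemma repr_chartPt_some (p : Fin k → ℂ) (j : Fin k) : b.repr (chartPt b p) (some j) = p j := by
  simp [chartPt, Finsupp.single_apply]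

lemma ne_zero_of_repr {p : Fin k → ℂ} {v : Fin k → ℂ} {z j : Fin k} (hj : v j ≠ 0) (hjz : j ≠ z)
    (s a : ℂ) :
    (fun i => (∑ j, v j • b (some j)) i + s * b (some z) i + a * chartPt b p i) ≠ 0 := by
  intro h
  have h0 : (∑ j, v j • b (some j)) + s • b (some z) + a • chartPt b p = 0 := h
  have h1 := congrArg (fun w => b.repr w none) h0
  have h2 := congrArg (fun w => b.repr w (some j)) h0
  simp only [map_add, map_smul, map_sum, Finsupp.add_apply, Finsupp.smul_apply, repr_chartPt_none,
    repr_chartPt_some, Finsupp.finsetSum_apply, Module.Basis.repr_self, map_zero,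
    Finsupp.zero_apply, Finsupp.single_apply, smul_eq_mul] at h1 h2
  simp only [reduceCtorEq, if_false, mul_zero, Finset.sum_const_zero, zero_add, mul_one,
    Option.some.injEq, mul_ite, Finset.sum_ite_eq', Finset.mem_univ, if_true, hjz.symm] at h1 h2
  rw [h1, zero_mul, add_zero, add_zero] at h2
  exact hj h2

theorem genericForm_hasSimpleTangent_two (b : Module.Basis (Option (Fin 2)) ℂ (Fin m → ℂ))
    (hd : 2 ≤ d) : GenericForm d (fun F : MvPolynomial (Fin m) ℂ => ∀ p : Fin 2 → ℂ,
      eval (chartPt b p) F ≠ 0 → (line (b (some 0)) (chartPt b p) F).Separable →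
      HasSimpleTangent d (chartPt b p) F) := by
  refine ((genericForm_smooth (by omega)).and (genericForm_pencil_two b hd)).mono ?_
  rintro F hF ⟨hsm, hpen⟩ p hP hu
  have hne : ∀ s a : ℂ,
      (fun i => b (some 1) i + s * b (some 0) i + a * chartPt b p i) ≠ 0 := by
    intro s a
    have h := ne_zero_of_repr b (p := p) (v := ![0, 1]) (z := 0) (j := 1) (by simp) (by simp) s a
    simpa using h
  rcases hd.eq_or_lt with rfl | hd3
  · obtain ⟨s, hs⟩ := exists_not_separable_of_pencil le_rfl hF hP hu (b (some 1))
    exact ⟨_, not_badRoots_two _, hs, fun a => hne s a⟩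
  · have hspan : ∀ w : Fin m → ℂ, ∃ α β γ : ℂ, ∀ i,
        w i = α * b (some 1) i + β * b (some 0) i + γ * chartPt b p i := by
      intro w
      refine ⟨b.repr w (some 1) - b.repr w none * p 1, b.repr w (some 0) - b.repr w none * p 0,
        b.repr w none, fun i => ?_⟩
      conv_lhs => rw [← b.sum_repr w]
      simp [chartPt, Fintype.sum_option, Fin.sum_univ_two]
      ring
    obtain ⟨s, hs, hsep⟩ := exists_injective_not_separable hd3 hF hsm hP hu hspan hne
    obtain ⟨j, hj⟩ := hpen p hP s hs
    exact ⟨_, hj, hsep j, fun a => hne (s j) a⟩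

theorem genericForm_hasSimpleTangent_three {r : ℕ}
    (b : Module.Basis (Option (Fin (3 + r))) ℂ (Fin m → ℂ))
    (hd : 2 ≤ d) : GenericForm d (fun F : MvPolynomial (Fin m) ℂ => ∀ p : Fin (3 + r) → ℂ,
      eval (chartPt b p) F ≠ 0 → (line (b (some 0)) (chartPt b p) F).Separable →
      HasSimpleTangent d (chartPt b p) F) := by
  refine (genericForm_pencil b hd).mono ?_
  intro F hF hpen p hP hu
  obtain ⟨v, hv, hv0, hbad⟩ := hpen p hP
  obtain ⟨j, hj⟩ : ∃ j, v j ≠ 0 := by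
    by_contra! h
    exact hv (funext h)
  have hj0 : j ≠ 0 := fun h => hj (h ▸ hv0)
  obtain ⟨s, hs⟩ := exists_not_separable_of_pencil hd hF hP hu (∑ j, v j • b (some j))
  exact ⟨_, hbad s, hs, fun a => ne_zero_of_repr b hj hj0 s a⟩

theorem genericForm_hasSimpleTangent_chart (b : Module.Basis (Option (Fin k)) ℂ (Fin m → ℂ))
    (hk : 2 ≤ k) (hd : 2 ≤ d) : GenericForm d (fun F : MvPolynomial (Fin m) ℂ => ∀ p : Fin k → ℂ,
      eval (chartPt b p) F ≠ 0 →
      (line (b (some ⟨0, by omega⟩)) (chartPt b p) F).Separable →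
      HasSimpleTangent d (chartPt b p) F) := by
  rcases hk.eq_or_lt with rfl | hk
  · exact genericForm_hasSimpleTangent_two b hd
  · obtain ⟨r, rfl⟩ := Nat.exists_eq_add_of_le hk
    exact genericForm_hasSimpleTangent_three b hd

lemma not_separable_line_zero (hd : 2 ≤ d) {F : MvPolynomial (Fin m) ℂ} (hF : F.IsHomogeneous d)
    {P : Fin m → ℂ} (hP : eval P F ≠ 0) : ¬ (line 0 P F).Separable := by
  rw [← lineDisc_ne_zero_iff hF hP, not_not]
  have h1 := lineDisc_smul hF hP 0 (two_ne_zero (α := ℂ))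
  have h2 : (fun i => (2 : ℂ) * (0 : Fin m → ℂ) i) = 0 := by
    funext i
    exact mul_zero _
  rw [h2] at h1
  by_contra h0
  have h3 : (2 : ℂ) ^ (d * (d - 1)) = 1 := by
    refine mul_right_cancel₀ h0 ?_
    rw [← h1, one_mul]
  have h4 : (2 : ℕ) ^ (d * (d - 1)) = 1 := by exact_mod_cast h3
  have h5 : 1 ≤ d * (d - 1) := Nat.mul_pos (by omega) (by omega)
  rw [Nat.pow_eq_one] at h4
  omega

theorem genericForm_hasSimpleTangent_basis (hk : 2 ≤ k) (hd : 2 ≤ d)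
    (b : Module.Basis (Fin (k + 1)) ℂ (Fin m → ℂ)) :
    GenericForm d (fun F : MvPolynomial (Fin m) ℂ => ∀ P : Fin m → ℂ,
      eval P F ≠ 0 → (line (b 0) P F).Separable → HasSimpleTangent d P F) := by
  have key : ∀ c : Fin k, _ := fun c =>
    genericForm_hasSimpleTangent_chart (b.reindex (finSuccEquiv' c.succ)) hk hd
  refine (GenericForm.forall_finite key).mono ?_
  intro F hF h P hP hsep
  by_cases hc : ∃ c : Fin k, b.repr P c.succ ≠ 0
  · obtain ⟨c, hc⟩ := hc
    obtain ⟨p, hp⟩ := exists_eq_smul_chartPt b hc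
    set a := b.repr P c.succ
    have hP' : eval (chartPt (b.reindex (finSuccEquiv' c.succ)) p) F ≠ 0 := by
      intro h0
      have h2 := aeval_mul_of_isHomogeneous hF a (chartPt (b.reindex (finSuccEquiv' c.succ)) p)
      rw [aeval_eq_eval, aeval_eq_eval, h0, mul_zero] at h2
      rw [hp] at hP
      exact hP h2
    have hu : (b.reindex (finSuccEquiv' c.succ)) (some ⟨0, by omega⟩) = b 0 := by
      rw [Module.Basis.reindex_apply, finSuccEquiv'_symm_some]
      congr 1
    have h3 := h c p hP'
    rw [hu] at h3
    rw [hp] at hsep ⊢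
    exact (h3 ((line_smul_separable_iff _ _ hc).1 hsep)).smul hc
  · push Not at hc
    exfalso
    have hPb : P = b.repr P 0 • b 0 := by
      conv_lhs => rw [← b.sum_repr P, Fin.sum_univ_succ]
      simp [hc]
    set a := b.repr P 0
    have ha : a ≠ 0 := by
      intro h0
      rw [h0, zero_smul] at hPb
      have h2 := not_separable_line_zero hd hF hP
      rw [hPb] at hP
      have h3 := aeval_mul_of_isHomogeneous hF (0 : ℂ) (0 : Fin m → ℂ)
      rw [zero_pow (by omega), zero_mul, aeval_eq_eval] at h3
      refine hP (Eq.trans ?_ h3)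
      congr 2
      funext i
      simp
    have h2 := not_separable_line_zero hd hF hP
    rw [← lineDisc_ne_zero_iff hF hP] at h2 hsep
    have h3 := lineDisc_add_smul hF hP 0 a⁻¹
    have h4 : (fun i => (0 : Fin m → ℂ) i + a⁻¹ * P i) = b 0 := by
      funext i
      conv_lhs => rw [hPb]
      simp [ha]
    rw [h4] at h3
    rw [h3] at hsep
    exact h2 hsep

end TangentPoints

section GeneralForms

open MvPolynomial

variable {k d : ℕ}

lemma exists_basis_apply_zero {u : Fin (k + 1) → ℂ} (hu : u ≠ 0) :
    ∃ b : Module.Basis (Fin (k + 1)) ℂ (Fin (k + 1) → ℂ), b 0 = u := by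
  obtain ⟨A, hA⟩ := SeparatingDual.exists_continuousLinearEquiv_apply_eq (R := ℂ)
    (x := (Pi.single 0 1 : Fin (k + 1) → ℂ)) (y := u) (by simp) hu
  exact ⟨(Pi.basisFun ℂ _).map A.toLinearEquiv, by simpa using hA⟩

theorem genericForm_hasSimpleTangent (hk : 2 ≤ k) (hd : 2 ≤ d) (u : Fin (k + 1) → ℂ) :
    GenericForm d (fun F : MvPolynomial (Fin (k + 1)) ℂ => ∀ P : Fin (k + 1) → ℂ,
      eval P F ≠ 0 → (line u P F).Separable → HasSimpleTangent d P F) := by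
  by_cases hu : u = 0
  · exact genericForm_of_forall fun F hF P hP hsep =>
      (not_separable_line_zero hd hF hP (hu ▸ hsep)).elim
  · obtain ⟨b, rfl⟩ := exists_basis_apply_zero hu
    exact genericForm_hasSimpleTangent_basis hk hd b

/-- The coordinate chart at the `c`-th standard basis vector. -/
noncomputable def stdChart (c : Fin (k + 1)) :
    Module.Basis (Option (Fin k)) ℂ (Fin (k + 1) → ℂ) :=
  (Pi.basisFun ℂ (Fin (k + 1))).reindex (finSuccEquiv' c)

lemma exists_stdChart (hd : 2 ≤ d) {F : MvPolynomial (Fin (k + 1)) ℂ} (hF : F.IsHomogeneous d)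
    {P : Fin (k + 1) → ℂ} (hP : eval P F ≠ 0) :
    ∃ c p, ∃ a : ℂ, a ≠ 0 ∧ chartPt (stdChart c) p = a • P ∧
      eval (chartPt (stdChart c) p) F ≠ 0 := by
  have hP0 : P ≠ 0 := by
    rintro rfl
    have h := aeval_mul_of_isHomogeneous hF (0 : ℂ) (0 : Fin (k + 1) → ℂ)
    rw [zero_pow (by omega), zero_mul, aeval_eq_eval] at h
    refine hP (Eq.trans ?_ h)
    congr 2
    funext i
    exact (mul_zero _).symm
  obtain ⟨c, hc⟩ : ∃ c, P c ≠ 0 := by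
    by_contra! h
    exact hP0 (funext h)
  obtain ⟨p, hp⟩ := exists_eq_smul_chartPt (Pi.basisFun ℂ (Fin (k + 1))) (P := P) (c := c)
    (by simpa using hc)
  rw [Pi.basisFun_repr] at hp
  have hp' : chartPt (stdChart c) p = (P c)⁻¹ • P := by
    conv_rhs => rw [hp]
    rw [smul_smul]
    have h1 : (P c)⁻¹ * P c = 1 := inv_mul_cancel₀ hc
    conv_rhs => rw [← hp]
    rw [h1, one_smul]
    rfl
  refine ⟨c, p, (P c)⁻¹, inv_ne_zero hc, hp', ?_⟩
  have h := aeval_mul_of_isHomogeneous hF (P c)⁻¹ P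
  rw [aeval_eq_eval, aeval_eq_eval] at h
  rw [hp']
  exact fun h0 => mul_ne_zero (pow_ne_zero d (inv_ne_zero hc)) hP (h.symm.trans h0)

theorem genericForm_exists_separable (hk : 2 ≤ k) (hd : 2 ≤ d) :
    GenericForm d (fun F : MvPolynomial (Fin (k + 1)) ℂ => ∀ P : Fin (k + 1) → ℂ,
      eval P F ≠ 0 → ∃ c i, (line (framePt (stdChart c) hk i) P F).Separable) := by
  refine (GenericForm.forall_finite fun c => genericForm_squarefree (stdChart c) hk hd).mono ?_
  intro F hF h P hP
  obtain ⟨c, p, a, ha, hp, hpF⟩ := exists_stdChart hd hF hP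
  obtain ⟨i, hi⟩ := h c p hpF
  rw [hp] at hi
  exact ⟨c, i, (line_smul_separable_iff _ _ ha).1 hi⟩

theorem genericForm_forall_hasSimpleTangent (hk : 2 ≤ k) (hd : 2 ≤ d) :
    GenericForm d (fun F : MvPolynomial (Fin (k + 1)) ℂ => ∀ P : Fin (k + 1) → ℂ,
      eval P F ≠ 0 → HasSimpleTangent d P F) := by
  refine ((genericForm_exists_separable hk hd).and (GenericForm.forall_finite
    fun ci : Fin (k + 1) × Option (Fin k) =>
      genericForm_hasSimpleTangent hk hd (framePt (stdChart ci.1) hk ci.2))).mono ?_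
  rintro F hF ⟨h1, h2⟩ P hP
  obtain ⟨c, i, hi⟩ := h1 P hP
  exact h2 (c, i) P hP hi

theorem genericForm_forall_not_composite (hk : 2 ≤ k) {l e : ℕ} (hl : 2 ≤ l) (he : 2 ≤ e) :
    GenericForm (l * e) (fun F : MvPolynomial (Fin (k + 1)) ℂ => ∀ P : Fin (k + 1) → ℂ,
      eval P F ≠ 0 → ∃ x, ¬ ∃ g h : Polynomial ℂ, g.Monic ∧ g.natDegree = e ∧ h.Monic ∧
        h.natDegree = l ∧ line x P F = Polynomial.C (eval P F) * g.comp h) := by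
  refine (GenericForm.forall_finite
    fun c => genericForm_not_composite (stdChart c) hk hl he).mono ?_
  intro F hF h P hP
  obtain ⟨c, p, a, ha, hp, hpF⟩ := exists_stdChart (by nlinarith) hF hP
  obtain ⟨i, hi⟩ := h c p hpF
  rw [hp] at hi
  refine ⟨framePt (stdChart c) hk i, fun h' => hi ?_⟩
  refine exists_comp_of_line_smul hF (inv_ne_zero ha) ?_
  rwa [inv_smul_smul₀ ha]

theorem genericForm_nonempty_gal_mulEquiv_perm (hk : 2 ≤ k) (hd : 2 ≤ d) :
    GenericForm d (fun F : MvPolynomial (Fin (k + 1)) ℂ => ∀ P : Fin (k + 1) → ℂ,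
      eval P F ≠ 0 → Nonempty ((fFP F P).Gal ≃* Equiv.Perm (Fin d))) := by
  have hcomp : ∀ le : Fin (d + 1) × Fin (d + 1),
      GenericForm d (fun F : MvPolynomial (Fin (k + 1)) ℂ => 2 ≤ (le.1 : ℕ) → 2 ≤ (le.2 : ℕ) →
        (le.1 : ℕ) * le.2 = d → ∀ P : Fin (k + 1) → ℂ,
        eval P F ≠ 0 → ∃ x, ¬ ∃ g h : Polynomial ℂ, g.Monic ∧ g.natDegree = le.2 ∧ h.Monic ∧
          h.natDegree = le.1 ∧ line x P F = Polynomial.C (eval P F) * g.comp h) := by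
    rintro ⟨l, e⟩
    by_cases h : 2 ≤ (l : ℕ) ∧ 2 ≤ (e : ℕ) ∧ (l : ℕ) * e = d
    · have h1 := genericForm_forall_not_composite (k := k) hk h.1 h.2.1
      rw [h.2.2] at h1
      exact h1.mono fun F _ h2 _ _ _ => h2
    · exact genericForm_of_forall fun F _ h1 h2 h3 => (h ⟨h1, h2, h3⟩).elim
  refine ((genericForm_smooth (by omega)).and ((genericForm_forall_hasSimpleTangent hk hd).and
    (GenericForm.forall_finite hcomp))).mono ?_
  rintro F hF ⟨hsm, htan, hindec⟩ P hP
  refine nonempty_gal_mulEquiv_perm hd hF hsm (by omega) hP (htan P hP) fun l e hl he hle => ?_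
  have hl' : l < d + 1 := by nlinarith
  have he' : e < d + 1 := by nlinarith
  exact hindec (⟨l, hl'⟩, ⟨e, he'⟩) hl he hle P hP

end GeneralForms

/-- For all `n ≥ 1`, `d ≥ 2`, a general homogeneous `F` of degree `d` in `n+2` variables
(i.e. all `F` in the nonvanishing locus of some polynomial function `Φ` on `V_d` that is not
identically zero on `V_d`) satisfies: for every point `P ∈ ℂ^{n+2}` with `F(P) ≠ 0`, the Galois
group of the splitting field of `f_{F,P}` over `K` is isomorphic to `S_d`. -/
theorem general_hypersurface_outer_points_uniform (n d : ℕ) (hn : 1 ≤ n) (hd : 2 ≤ d) :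
    ∃ Φ : MvPolynomial ((Fin (n + 2)) →₀ ℕ) ℂ,
      (∃ F₀ : MvPolynomial (Fin (n + 2)) ℂ, F₀.IsHomogeneous d ∧
        MvPolynomial.eval (fun s => MvPolynomial.coeff s F₀) Φ ≠ 0) ∧
      ∀ F : MvPolynomial (Fin (n + 2)) ℂ, F.IsHomogeneous d →
        MvPolynomial.eval (fun s => MvPolynomial.coeff s F) Φ ≠ 0 →
        ∀ P : Fin (n + 2) → ℂ, MvPolynomial.eval P F ≠ 0 →
          Nonempty ((fFP F P).Gal ≃* Equiv.Perm (Fin d)) := by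
  exact genericForm_nonempty_gal_mulEquiv_perm (k := n + 1) (by omega) hd
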